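/- arXiv:2408.12147 — 3 statements merged into one kernel-verified Lean document; each statement's English description precedes it below -/
import Mathlib

section
/- Let G be a Moore graph of degree D and diameter m > 1, with N vertices, regarded as a metric space via the shortest path metric. Then for all n, ℓ ≥ 0 the magnitude homology MH_n^ℓ(G) is a free ℤ-module; it is zero unless (n, ℓ) = (2i + j, (m+1)i + j) for some integers i, j ≥ 0, in which case its rank equals N·(D(D−1)^m)^i·(C(i+j−1, i−1) + D·C(i+j−1, i)), where C(s,t) denotes the binomial coefficient with the conventions C(−1,−1) = 1 and C(s,t) = 0 if s < t or t < 0 ≤ s. Equivalently, the rank function R(n,ℓ) = rank MH_n^ℓ(G) satisfies R(n,ℓ) = R(n−1, ℓ−1) + D(D−1)^m·R(n−2, ℓ−m−1) for (n,ℓ) ∉ {(0,0),(1,1)} with n, ℓ ≥ 0, together with R(0,0) = N, R(1,1) = ND, and R(n,ℓ) = 0 when n < 0 or ℓ < 0. -/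
open scoped ENNReal NNReal

attribute [local instance] Classical.propDecidable

/-- A quasi metric space: `d x y = 0 ↔ x = y` and the triangle inequality;
infinite values and non-symmetry are allowed. -/
structure QuasiMetric (X : Type) : Type where
  d : X → X → ℝ≥0∞
  d_eq_zero_iff : ∀ x y : X, d x y = 0 ↔ x = y
  triangle : ∀ x y z : X, d x z ≤ d x y + d y z

namespace QuasiMetric

variable {X : Type} (q : QuasiMetric X)

/-- `q.Btw x y z` means `x ≤ y ≤ z`, i.e. `d x y + d y z = d x z`. -/
def Btw (x y z : X) : Prop := q.d x y + q.d y z = q.d x z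

/-- A quasi metric space is geodetic if each interval `I(a,b)` (with `d a b < ∞`)
is totally ordered by `x ⪯ y ↔ a ≤ x ≤ y`. -/
def Geodetic : Prop :=
  ∀ a b x y : X, q.d a b ≠ ∞ → q.Btw a x b → q.Btw a y b →
    q.Btw a x y ∨ q.Btw a y x

/-- The length of a tuple `(x_0, …, x_n)`. -/
noncomputable def len {n : ℕ} (t : Fin (n + 1) → X) : ℝ≥0∞ :=
  ∑ i : Fin n, q.d (t i.castSucc) (t i.succ)

end QuasiMetric

/-- The `n`-th magnitude chain group: the free abelian group on all `(n+1)`-tuples.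
(The magnitude chain complex itself lives on the submodules spanned by tuples with
finite consecutive distances; see `QuasiMetric.grMC` below.) -/
abbrev MC (X : Type) (n : ℕ) : Type := (Fin (n + 1) → X) →₀ ℤ

namespace QuasiMetric

variable {X : Type} (q : QuasiMetric X)

/-- The condition under which the `i`-th entry of a tuple `(x_0, …, x_{n+1})` is deleted by
the boundary operator: `x_{i-1} ≤ x_i ≤ x_{i+1}` with the conventions `x_{-1} = x_1` and
`x_{n+2} = x_n`. -/
def delCond {n : ℕ} (t : Fin (n + 2) → X) (i : Fin (n + 2)) : Prop :=
  q.Btw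
    (if _ : (i : ℕ) = 0 then t ⟨1, by omega⟩
      else t ⟨(i : ℕ) - 1, by have := i.isLt; omega⟩)
    (t i)
    (if _ : (i : ℕ) = n + 1 then t ⟨n, by omega⟩
      else t ⟨(i : ℕ) + 1, by have := i.isLt; omega⟩)

/-- The boundary operator `∂ = Σ_i (-1)^i ∂_i` of the magnitude chain complex, where
`∂_i` deletes `x_i` when `x_{i-1} ≤ x_i ≤ x_{i+1}` (conventions `x_{-1} = x_1`,
`x_{n+2} = x_n`) and is zero otherwise. -/
noncomputable def bdry (n : ℕ) : MC X (n + 1) →ₗ[ℤ] MC X n :=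
  Finsupp.lift (MC X n) ℤ (Fin (n + 2) → X) fun t =>
    ∑ i : Fin (n + 2),
      if q.delCond t i then ((-1 : ℤ) ^ (i : ℕ)) • Finsupp.single (t ∘ i.succAbove) (1 : ℤ)
      else 0

/-- The degree `n`, length `ℓ` part of the magnitude chain complex: the span of the
tuples of length `ℓ`. (For `ℓ ≠ ∞` all consecutive distances of such tuples are finite.) -/
noncomputable def grMC (n : ℕ) (ℓ : ℝ≥0∞) : Submodule ℤ (MC X n) :=
  Submodule.span ℤ {c | ∃ t : Fin (n + 1) → X, q.len t = ℓ ∧ c = Finsupp.single t 1}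

/-- Cycles of the degree `n`, length `ℓ` part of the magnitude chain complex. -/
noncomputable def grZ (n : ℕ) (ℓ : ℝ≥0∞) : Submodule ℤ (MC X n) :=
  match n with
  | 0 => q.grMC 0 ℓ
  | (m + 1) => q.grMC (m + 1) ℓ ⊓ LinearMap.ker (q.bdry m)

/-- Boundaries of the degree `n`, length `ℓ` part of the magnitude chain complex. -/
noncomputable def grB (n : ℕ) (ℓ : ℝ≥0∞) : Submodule ℤ (MC X n) :=
  Submodule.map (q.bdry n) (q.grMC (n + 1) ℓ)

/-- The magnitude homology `MH_n^ℓ(X)` : cycles modulo boundaries in the degree `n`,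
length `ℓ` part of the magnitude chain complex. -/
abbrev grMH (n : ℕ) (ℓ : ℝ≥0∞) : Type :=
  ↥(q.grZ n ℓ) ⧸ Submodule.comap (q.grZ n ℓ).subtype (q.grB n ℓ)

end QuasiMetric

/-- A finite connected simple graph regarded as a quasi metric space via the shortest
path metric. -/
noncomputable def SimpleGraph.toQuasiMetric {V : Type} (G : SimpleGraph V)
    (hG : G.Connected) : QuasiMetric V where
  d x y := (G.dist x y : ℝ≥0∞)
  d_eq_zero_iff x y := by
    rw [show ((G.dist x y : ℝ≥0∞) = 0 ↔ G.dist x y = 0) by exact_mod_cast Iff.rfl]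
    constructor
    · intro h
      rcases (G.dist_eq_zero_iff_eq_or_not_reachable).mp h with h' | h'
      · exact h'
      · exact absurd (hG.preconnected x y) h'
    · intro h; simp [h]
  triangle x y z := by
    rw [show ((G.dist x z : ℝ≥0∞) ≤ (G.dist x y : ℝ≥0∞) + (G.dist y z : ℝ≥0∞) ↔
        G.dist x z ≤ G.dist x y + G.dist y z) by exact_mod_cast Iff.rfl]
    exact hG.dist_triangle

/-- The binomial coefficient `C(s,t)` for integers, with the conventions `C(-1,-1) = 1`
and `C(s,t) = 0` whenever `s < t` or `t < 0 ≤ s`. -/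
def intC (s t : ℤ) : ℤ :=
  if t < 0 ∨ s < t then (if s = -1 ∧ t = -1 then 1 else 0)
  else (s.toNat).choose t.toNat

/-- A matching on the cells of a based chain complex over `ℤ` (with differential `d` and with the
set `T n` of cells in degree `n`) all of whose unmatched cells are cycles. `pair k u v` says that
`u` is matched with its face `v` at level `k`; the levels witness acyclicity. -/
structure LevelMatching {κ : Type*} (d : (κ →₀ ℤ) →ₗ[ℤ] (κ →₀ ℤ)) (T : ℕ → Set κ) where
  crit : Set κ
  pair : ℕ → κ → κ → Prop
  pair_unique : ∀ {k k' u u' v}, pair k u v → pair k' u' v → u = u' ∧ k = k'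
  not_crit : ∀ {k u v}, pair k u v → v ∉ crit
  not_pair : ∀ {k k' u v w}, pair k u v → ¬ pair k' v w
  total : ∀ {n s}, s ∈ T n → s ∈ crit ∨ (∃ k v, pair k s v) ∨ ∃ k u, pair k u s
  d_d : ∀ x, d (d x) = 0
  d_crit : ∀ {s}, s ∈ crit → d (Finsupp.single s 1) = 0
  d_pair : ∀ {k u v}, pair k u v → ∃ ε : ℤ, ε * ε = 1 ∧
    d (Finsupp.single u 1) - ε • Finsupp.single v 1 ∈ Finsupp.supported ℤ ℤ
      {w | w ∈ crit ∨ (∃ k' v', pair k' w v') ∨ ∃ k' u', k < k' ∧ pair k' u' w}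
  d_mem : ∀ {n u}, u ∈ T (n + 1) → d (Finsupp.single u 1) ∈ Finsupp.supported ℤ ℤ (T n)
  pair_mem : ∀ {n k u v}, pair k u v → v ∈ T n → u ∈ T (n + 1)
  level_le : ∀ {n k u v}, pair k u v → v ∈ T n → k ≤ n

namespace LevelMatching

variable {κ : Type*} {d : (κ →₀ ℤ) →ₗ[ℤ] (κ →₀ ℤ)} {T : ℕ → Set κ}

/-- The cells that are matched with one of their faces. -/
def up (A : LevelMatching d T) : Set κ := {s | ∃ k v, A.pair k s v}

theorem eq_zero_of_d_mem (A : LevelMatching d T) {x : κ →₀ ℤ} (hx : x ∈ Finsupp.supported ℤ ℤ A.up)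
    (hd : d x ∈ Finsupp.supported ℤ ℤ (A.crit ∪ A.up)) : x = 0 := by
  by_contra hne
  have hsupp : ∀ u ∈ x.support, ∃ k v, A.pair k u v := fun u hu => hx hu
  choose! lev down hpair using hsupp
  obtain ⟨u, hu, hmin⟩ := Finset.exists_min_image x.support lev (Finsupp.support_nonempty_iff.2 hne)
  have hv0 : d x (down u) = 0 := by
    by_contra h
    rcases hd (Finsupp.mem_support_iff.2 h) with h | ⟨k, v, h⟩
    · exact A.not_crit (hpair u hu) h
    · exact A.not_pair (hpair u hu) h
  have hexp : d x (down u) = ∑ u' ∈ x.support, x u' * d (Finsupp.single u' 1) (down u) := by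
    conv_lhs => rw [← Finsupp.sum_single x, Finsupp.sum, map_sum, Finsupp.finsetSum_apply]
    refine Finset.sum_congr rfl fun u' _ => ?_
    rw [← mul_one (x u'), ← smul_eq_mul, ← Finsupp.smul_single, map_smul, Finsupp.smul_apply]
    simp
  have hgood : ∀ u' ∈ x.support, ∃ ε : ℤ, ε * ε = 1 ∧
      d (Finsupp.single u' 1) (down u) = ε • Finsupp.single (down u') (1 : ℤ) (down u) := by
    intro u' hu'
    obtain ⟨ε, hε, h⟩ := A.d_pair (hpair u' hu')
    refine ⟨ε, hε, ?_⟩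
    by_contra hcon
    have hmem : down u ∈
        (d (Finsupp.single u' 1) - ε • Finsupp.single (down u') (1 : ℤ)).support := by
      rw [Finsupp.mem_support_iff, Finsupp.sub_apply, Finsupp.smul_apply]
      exact sub_ne_zero.2 hcon
    rcases h hmem with h | ⟨k, v, h⟩ | ⟨k, w, hk, h⟩
    · exact A.not_crit (hpair u hu) h
    · exact A.not_pair (hpair u hu) h
    · have := (A.pair_unique h (hpair u hu)).2
      have := hmin u' hu'
      omega
  rw [hexp, Finset.sum_eq_single u] at hv0
  · obtain ⟨ε, hε, h⟩ := hgood u hu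
    rw [h] at hv0
    have : x u ≠ 0 := Finsupp.mem_support_iff.1 hu
    have hε0 : ε ≠ 0 := by rintro rfl; simp at hε
    simp_all
  · intro u' hu' hne'
    obtain ⟨ε, hε, h⟩ := hgood u' hu'
    rw [h, Finsupp.single_eq_of_ne, smul_zero, mul_zero]
    intro heq
    have h1 := hpair u' hu'
    rw [← heq] at h1
    exact hne' (A.pair_unique h1 (hpair u hu)).1
  · exact fun h => absurd hu h

theorem single_mem (A : LevelMatching d T) (n j : ℕ) :
    ∀ s ∈ T n, (∀ k u, A.pair k u s → n < k + j) →
    (Finsupp.single s 1 : κ →₀ ℤ) ∈ (Finsupp.supported ℤ ℤ (T (n + 1))).map d ⊔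
      Finsupp.supported ℤ ℤ ((A.crit ∪ A.up) ∩ T n) := by
  induction j with
  | zero =>
    intro s hs hlev
    refine Submodule.mem_sup_right (Finsupp.single_mem_supported ℤ _ ⟨?_, hs⟩)
    rcases A.total hs with h | h | ⟨k, u, h⟩
    · exact Or.inl h
    · exact Or.inr h
    · have := A.level_le h hs
      have := hlev k u h
      omega
  | succ j ih =>
    intro s hs hlev
    rcases A.total hs with h | h | ⟨k, u, h⟩
    · exact Submodule.mem_sup_right (Finsupp.single_mem_supported ℤ _ ⟨Or.inl h, hs⟩)
    · exact Submodule.mem_sup_right (Finsupp.single_mem_supported ℤ _ ⟨Or.inr h, hs⟩)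
    obtain ⟨ε, hε, hrest⟩ := A.d_pair h
    have hu := A.pair_mem h hs
    have hdu : d (Finsupp.single u 1) ∈ (Finsupp.supported ℤ ℤ (T (n + 1))).map d ⊔
        Finsupp.supported ℤ ℤ ((A.crit ∪ A.up) ∩ T n) :=
      Submodule.mem_sup_left ⟨_, Finsupp.single_mem_supported ℤ _ hu, rfl⟩
    have hrestT : d (Finsupp.single u 1) - ε • Finsupp.single s 1 ∈
        Finsupp.supported ℤ ℤ (T n) :=
      sub_mem (A.d_mem hu) (Submodule.smul_mem _ _ (Finsupp.single_mem_supported ℤ _ hs))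
    have hmem : d (Finsupp.single u 1) - ε • Finsupp.single s 1 ∈
        (Finsupp.supported ℤ ℤ (T (n + 1))).map d ⊔
        Finsupp.supported ℤ ℤ ((A.crit ∪ A.up) ∩ T n) := by
      have hle : Finsupp.supported ℤ ℤ ({w | w ∈ A.crit ∨ (∃ k' v', A.pair k' w v') ∨
          ∃ k' u', k < k' ∧ A.pair k' u' w} ∩ T n) ≤
          (Finsupp.supported ℤ ℤ (T (n + 1))).map d ⊔
            Finsupp.supported ℤ ℤ ((A.crit ∪ A.up) ∩ T n) := by
        rw [Finsupp.supported_eq_span_single ℤ ({w | _} ∩ T n), Submodule.span_le]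
        rintro _ ⟨w, ⟨hw, hwT⟩, rfl⟩
        rcases hw with hw | hw | ⟨k', u', hk, hw⟩
        · exact Submodule.mem_sup_right (Finsupp.single_mem_supported ℤ _ ⟨Or.inl hw, hwT⟩)
        · exact Submodule.mem_sup_right (Finsupp.single_mem_supported ℤ _ ⟨Or.inr hw, hwT⟩)
        · refine ih w hwT fun k'' u'' hp => ?_
          have := (A.pair_unique hw hp).2
          have := hlev k u h
          omega
      exact hle fun w hw => ⟨hrest hw, hrestT hw⟩
    have hs' : (Finsupp.single s 1 : κ →₀ ℤ) = ε • (d (Finsupp.single u 1) -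
        (d (Finsupp.single u 1) - ε • Finsupp.single s 1)) := by
      rw [sub_sub_cancel, smul_smul, hε, one_smul]
    rw [hs']
    exact Submodule.smul_mem _ _ (sub_mem hdu hmem)

theorem exists_decomp (A : LevelMatching d T) {n : ℕ} {x : κ →₀ ℤ}
    (hx : x ∈ Finsupp.supported ℤ ℤ (T n)) :
    ∃ y ∈ Finsupp.supported ℤ ℤ (T (n + 1)), ∃ c ∈ Finsupp.supported ℤ ℤ (A.crit ∩ T n),
      ∃ u ∈ Finsupp.supported ℤ ℤ A.up, x = d y + (c + u) := by
  have hle : Finsupp.supported ℤ ℤ (T n) ≤ (Finsupp.supported ℤ ℤ (T (n + 1))).map d ⊔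
      Finsupp.supported ℤ ℤ ((A.crit ∪ A.up) ∩ T n) := by
    rw [Finsupp.supported_eq_span_single ℤ (T n), Submodule.span_le]
    rintro _ ⟨s, hs, rfl⟩
    exact A.single_mem n (n + 1) s hs fun k u _ => by omega
  obtain ⟨_, ⟨y, hy, rfl⟩, r, hr, rfl⟩ := Submodule.mem_sup.1 (hle hx)
  rw [Set.union_inter_distrib_right, Finsupp.supported_union] at hr
  obtain ⟨c, hc, u, hu, rfl⟩ := Submodule.mem_sup.1 hr
  exact ⟨y, hy, c, hc, u, fun w hw => (hu hw).1, rfl⟩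

theorem d_eq_zero_of_mem_crit (A : LevelMatching d T) {c : κ →₀ ℤ}
    (hc : c ∈ Finsupp.supported ℤ ℤ A.crit) :
    d c = 0 := by
  have h : Finsupp.supported ℤ ℤ A.crit ≤ LinearMap.ker d := by
    rw [Finsupp.supported_eq_span_single, Submodule.span_le]
    rintro _ ⟨s, hs, rfl⟩
    exact A.d_crit hs
  exact h hc

/-- Every cycle is homologous to a combination of critical cells. -/
theorem exists_crit_add_d (A : LevelMatching d T) {n : ℕ} {z : κ →₀ ℤ}
    (hz : z ∈ Finsupp.supported ℤ ℤ (T n))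
    (hd : d z = 0) : ∃ c ∈ Finsupp.supported ℤ ℤ (A.crit ∩ T n),
      ∃ y ∈ Finsupp.supported ℤ ℤ (T (n + 1)), z = c + d y := by
  obtain ⟨y, hy, c, hc, u, hu, rfl⟩ := A.exists_decomp hz
  have hu0 : u = 0 := by
    refine A.eq_zero_of_d_mem hu ?_
    rw [map_add, map_add, A.d_d, A.d_eq_zero_of_mem_crit fun w hw => (hc hw).1, zero_add,
      zero_add] at hd
    rw [hd]
    exact zero_mem _
  exact ⟨c, hc, y, hy, by rw [hu0, add_zero, add_comm]⟩

/-- A combination of critical cells that bounds is zero. -/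
theorem eq_zero_of_crit_eq_d (A : LevelMatching d T) {n : ℕ} {c y : κ →₀ ℤ}
    (hc : c ∈ Finsupp.supported ℤ ℤ A.crit)
    (hy : y ∈ Finsupp.supported ℤ ℤ (T n)) (h : d y = c) : c = 0 := by
  obtain ⟨x, -, c', hc', u, hu, rfl⟩ := A.exists_decomp hy
  rw [map_add, map_add, A.d_d, A.d_eq_zero_of_mem_crit fun w hw => (hc' hw).1, zero_add,
      zero_add] at h
  rw [← h, A.eq_zero_of_d_mem hu, map_zero]
  rw [h]
  exact fun w hw => Or.inl (hc hw)

end LevelMatching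

namespace SimpleGraph

variable {V : Type} (G : SimpleGraph V)

/-- `x ≤ y ≤ z` for the shortest path metric. -/
def DistBtw (x y z : V) : Prop := G.dist x y + G.dist y z = G.dist x z

/-- `DistBtw` with an optional left neighbour; without one, the first entry of a tuple may be
deleted exactly when it is repeated. -/
def CtxBtw : Option V → V → V → Prop
  | none, x, y => x = y
  | some a, x, y => G.DistBtw a x y

variable {G}

theorem distBtw_self_left (x y : V) : G.DistBtw x x y := by
  simp [DistBtw]

theorem ctxBtw_self (o : Option V) (x : V) : G.CtxBtw o x x := by
  cases o <;> simp [CtxBtw, DistBtw]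

theorem distBtw_loop (hG : G.Connected) {x y : V} : G.DistBtw x y x ↔ x = y := by
  simp [DistBtw, hG.dist_eq_zero_iff, eq_comm]

theorem DistBtw.trans (hG : G.Connected) {a b c e : V} (h : G.DistBtw a b e)
    (h' : G.DistBtw b c e) : G.DistBtw a b c ∧ G.DistBtw a c e := by
  unfold DistBtw at *
  have h1 : G.dist a c ≤ G.dist a b + G.dist b c := hG.dist_triangle
  have h2 : G.dist a e ≤ G.dist a c + G.dist c e := hG.dist_triangle
  omega

theorem DistBtw.trans' (hG : G.Connected) {a b c e : V} (h : G.DistBtw a b c)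
    (h' : G.DistBtw a c e) : G.DistBtw b c e ∧ G.DistBtw a b e := by
  unfold DistBtw at *
  have h1 : G.dist b e ≤ G.dist b c + G.dist c e := hG.dist_triangle
  have h2 : G.dist a e ≤ G.dist a b + G.dist b e := hG.dist_triangle
  omega

theorem ctxBtw_exchange (hG : G.Connected) (o : Option V) (b c e : V) :
    G.CtxBtw o b c ∧ G.CtxBtw o c e ↔ G.DistBtw b c e ∧ G.CtxBtw o b e := by
  cases o with
  | none =>
    simp only [CtxBtw]
    constructor
    · rintro ⟨rfl, rfl⟩
      exact ⟨distBtw_self_left _ _, rfl⟩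
    · rintro ⟨h, rfl⟩
      exact ⟨(distBtw_loop hG).1 h, ((distBtw_loop hG).1 h).symm⟩
  | some a => exact ⟨fun h => h.1.trans' hG h.2, fun h => h.2.trans hG h.1⟩

variable (G)

/-- The linear map prepending `b` to lists. -/
noncomputable abbrev consMap (b : V) : (List V →₀ ℤ) →ₗ[ℤ] (List V →₀ ℤ) :=
  Finsupp.lmapDomain ℤ ℤ (List.cons b)

/-- The face of `b :: w` deleting `b`, where `o` is the left neighbour of `b`. -/
noncomputable def headFace (o : Option V) (b : V) : List V → (List V →₀ ℤ)
  | [] => if o = some b then Finsupp.single [] 1 else 0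
  | c :: w => if G.CtxBtw o b c then Finsupp.single (c :: w) 1 else 0

/-- The magnitude boundary of a tuple preceded by an optional left neighbour. -/
noncomputable def listBdry : Option V → List V → (List V →₀ ℤ)
  | _, [] => 0
  | o, b :: w => G.headFace o b w - consMap b (listBdry (some b) w)

/-- The linear extension of `headFace`. -/
noncomputable def headFaceMap (o : Option V) (b : V) : (List V →₀ ℤ) →ₗ[ℤ] (List V →₀ ℤ) :=
  Finsupp.linearCombination ℤ (G.headFace o b)

/-- The linear extension of `listBdry`. -/
noncomputable def listBdryMap (o : Option V) : (List V →₀ ℤ) →ₗ[ℤ] (List V →₀ ℤ) :=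
  Finsupp.linearCombination ℤ (G.listBdry o)

variable {G}

@[simp] theorem headFaceMap_single (o : Option V) (b : V) (w : List V) :
    G.headFaceMap o b (Finsupp.single w 1) = G.headFace o b w := by
  simp [headFaceMap]

@[simp] theorem listBdryMap_single (o : Option V) (w : List V) :
    G.listBdryMap o (Finsupp.single w 1) = G.listBdry o w := by
  simp [listBdryMap]

theorem listBdryMap_consMap (o : Option V) (b : V) (x : List V →₀ ℤ) :
    G.listBdryMap o (consMap b x) =
      G.headFaceMap o b x - consMap b (G.listBdryMap (some b) x) := by
  have h : G.listBdryMap o ∘ₗ consMap b =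
      G.headFaceMap o b - consMap b ∘ₗ G.listBdryMap (some b) := by
    refine Finsupp.lhom_ext' fun w => LinearMap.ext_ring ?_
    simp [listBdry, Finsupp.mapDomain_single]
  exact LinearMap.congr_fun h x

theorem headFaceMap_consMap (o : Option V) (b c : V) (x : List V →₀ ℤ) :
    G.headFaceMap o b (consMap c x) = if G.CtxBtw o b c then consMap c x else 0 := by
  have h : G.headFaceMap o b ∘ₗ consMap c = if G.CtxBtw o b c then consMap c else 0 := by
    refine Finsupp.lhom_ext' fun w => LinearMap.ext_ring ?_
    split_ifs with h <;> simp [headFace, Finsupp.mapDomain_single, h]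
  rw [← LinearMap.comp_apply, h]
  split_ifs <;> rfl

theorem headFaceMap_headFace (hG : G.Connected) (o : Option V) (b c : V) (w : List V) :
    G.headFaceMap o b (G.headFace (some b) c w) =
      if G.CtxBtw o b c then G.headFace o c w else 0 := by
  cases w with
  | nil =>
    by_cases hbc : b = c
    · subst hbc
      simp [headFace, ctxBtw_self]
    · have h : ¬ (G.CtxBtw o b c ∧ o = some c) := by
        rintro ⟨h, rfl⟩
        exact hbc ((distBtw_loop hG).1 h).symm
      simp only [headFace, Option.some.injEq, hbc, if_false, map_zero]
      rw [← ite_and, if_neg h]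
  | cons e w =>
    have := ctxBtw_exchange hG o b c e
    simp only [headFace, apply_ite (G.headFaceMap o b), map_zero, headFaceMap_single]
    rw [← ite_and, ← ite_and]
    exact if_congr this.symm rfl rfl

theorem listBdryMap_listBdry (hG : G.Connected) (o : Option V) (l : List V) :
    G.listBdryMap o (G.listBdry o l) = 0 := by
  induction l generalizing o with
  | nil => simp [listBdry]
  | cons b w ih =>
    rw [listBdry, map_sub, listBdryMap_consMap, ih, map_zero, sub_zero, sub_eq_zero]
    cases w with
    | nil =>
      simp only [headFace, listBdry, map_zero]
      split_ifs <;> simp [listBdry]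
    | cons c w =>
      rw [listBdry, map_sub, headFaceMap_consMap, headFaceMap_headFace hG, headFace]
      split_ifs <;> simp [listBdry]

theorem listBdryMap_listBdryMap (hG : G.Connected) (o : Option V) (x : List V →₀ ℤ) :
    G.listBdryMap o (G.listBdryMap o x) = 0 := by
  have h : G.listBdryMap o ∘ₗ G.listBdryMap o = 0 := by
    refine Finsupp.lhom_ext' fun w => LinearMap.ext_ring ?_
    simpa using listBdryMap_listBdry hG o w
  exact LinearMap.congr_fun h x

theorem consMap_mem {b : V} {s t : Set (List V)} (h : ∀ w ∈ s, b :: w ∈ t) {x : List V →₀ ℤ}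
    (hx : x ∈ Finsupp.supported ℤ ℤ s) : consMap b x ∈ Finsupp.supported ℤ ℤ t := by
  have : consMap b x ∈ Finsupp.supported ℤ ℤ (List.cons b '' s) := by
    rw [← Finsupp.lmapDomain_supported]
    exact Submodule.mem_map_of_mem hx
  refine Finsupp.supported_mono ?_ this
  rintro _ ⟨w, hw, rfl⟩
  exact h w hw

theorem ite_single_mem {p : Prop} [Decidable p] {w : List V} {s : Set (List V)} (h : p → w ∈ s) :
    (if p then Finsupp.single w 1 else 0 : List V →₀ ℤ) ∈ Finsupp.supported ℤ ℤ s := by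
  split_ifs with hp
  · exact Finsupp.single_mem_supported ℤ _ (h hp)
  · exact zero_mem _

variable (G)

/-- The length of a tuple of vertices. -/
noncomputable def listLen : List V → ℕ
  | [] => 0
  | [_] => 0
  | b :: c :: w => G.dist b c + listLen (c :: w)

/-- The length of a tuple preceded by an optional left neighbour. -/
noncomputable def ctxLen : Option V → List V → ℕ
  | none, w => G.listLen w
  | some a, w => G.listLen (a :: w)

variable {G}

theorem ctxLen_of_ctxBtw {o : Option V} {b c : V} (w : List V) (h : G.CtxBtw o b c) :
    G.ctxLen o (c :: w) = G.ctxLen o (b :: c :: w) := by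
  cases o with
  | none =>
    obtain rfl : b = c := h
    simp [ctxLen, listLen]
  | some a =>
    have : G.dist a b + G.dist b c = G.dist a c := h
    simp only [ctxLen, listLen]
    omega

theorem ctxLen_cons_inj {o : Option V} {b : V} {w w' : List V}
    (h : G.ctxLen (some b) w = G.ctxLen (some b) w') :
    G.ctxLen o (b :: w) = G.ctxLen o (b :: w') := by
  cases o with
  | none => exact h
  | some a => simpa [ctxLen, listLen] using h

theorem listBdry_mem (o : Option V) (l : List V) : G.listBdry o l ∈ Finsupp.supported ℤ ℤ
    {w | w.length + 1 = l.length ∧ G.ctxLen o w = G.ctxLen o l} := by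
  induction l generalizing o with
  | nil => exact zero_mem _
  | cons b l ih =>
    refine sub_mem ?_ (consMap_mem ?_ (ih (some b)))
    · cases l with
      | nil =>
        refine ite_single_mem ?_
        rintro rfl
        simp [ctxLen, listLen]
      | cons c l => exact ite_single_mem fun h => ⟨rfl, ctxLen_of_ctxBtw l h⟩
    · rintro w ⟨h1, h2⟩
      exact ⟨by simp [h1], ctxLen_cons_inj h2⟩

variable (G)

/-- `c` is the first vertex on the geodesic from `b` to `c` that makes `b` undeletable. -/
def MinSing (o : Option V) (b c : V) : Prop :=
  ¬ G.CtxBtw o b c ∧ ∀ z, G.DistBtw b z c → ¬ G.CtxBtw o b z → z = c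

/-- Every entry of the list is minimally singular over its two predecessors. -/
inductive CritTail : Option V → V → List V → Prop
  | nil (o : Option V) (b : V) : CritTail o b []
  | cons {o : Option V} {b c : V} {w : List V} :
      G.MinSing o b c → CritTail (some b) c w → CritTail o b (c :: w)

/-- The matching on tuples without repeated neighbours: after a critical prefix ending in `b`,
an entry `e` that is not minimally singular is matched with the insertion of the minimally
singular vertex `c` between `b` and `e`. -/
inductive TailPair : ℕ → Option V → V → List V → List V → Prop
  | here {o : Option V} {b c e : V} {w : List V} : G.MinSing o b c → c ≠ e → G.DistBtw b c e →
      (e :: w).IsChain (· ≠ ·) → TailPair 0 o b (c :: e :: w) (e :: w)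
  | cons {k : ℕ} {o : Option V} {b c : V} {u v : List V} :
      G.MinSing o b c → TailPair k (some b) c u v → TailPair (k + 1) o b (c :: u) (c :: v)

/-- The tails that are critical, matched with a face, or matched above level `k`. -/
def tailRest (k : ℕ) (o : Option V) (b : V) : Set (List V) :=
  {w | G.CritTail o b w ∨ (∃ k' v, G.TailPair k' o b w v) ∨ ∃ k' u, k < k' ∧ G.TailPair k' o b u w}

/-- Intervals between two vertices are totally ordered. -/
def IsGeodetic : Prop :=
  ∀ a b x y : V, G.DistBtw a x b → G.DistBtw a y b → G.DistBtw a x y ∨ G.DistBtw a y x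

variable {G}

theorem exists_minSing (hG : G.Connected) {o : Option V} {b c : V} (h : ¬ G.CtxBtw o b c) :
    ∃ y, G.MinSing o b y ∧ G.DistBtw b y c := by
  have hex : ∃ n y, G.dist b y = n ∧ ¬ G.CtxBtw o b y ∧ G.DistBtw b y c :=
    ⟨_, c, rfl, h, by simp [DistBtw]⟩
  obtain ⟨y, hy, hs, hb⟩ := Nat.find_spec hex
  refine ⟨y, ⟨hs, fun z hz hzs => ?_⟩, hb⟩
  have h1 := hz.trans' hG hb
  have h2 := Nat.find_min' hex ⟨z, rfl, hzs, h1.2⟩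
  have h3 : G.dist b z + G.dist z y = G.dist b y := hz
  exact hG.dist_eq_zero_iff.1 (by omega)

theorem MinSing.eq (hgeo : G.IsGeodetic) {o : Option V} {b c y y' : V} (hy : G.MinSing o b y)
    (hb : G.DistBtw b y c) (hy' : G.MinSing o b y') (hb' : G.DistBtw b y' c) : y = y' := by
  rcases hgeo b c y y' hb hb' with h | h
  · exact hy'.2 y h hy.1
  · exact (hy.2 y' h hy'.1).symm

theorem MinSing.ne {o : Option V} {b c : V} (h : G.MinSing o b c) : b ≠ c := by
  rintro rfl
  exact h.1 (ctxBtw_self o b)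

theorem CritTail.isChain {o : Option V} {b : V} {w : List V} (h : G.CritTail o b w) :
    (b :: w).IsChain (· ≠ ·) := by
  induction h with
  | nil => simp
  | cons h _ ih => exact List.isChain_cons_cons.2 ⟨h.ne, ih⟩

theorem TailPair.isChain (hG : G.Connected) {k : ℕ} {o : Option V} {b : V} {u v : List V}
    (h : G.TailPair k o b u v) : (b :: u).IsChain (· ≠ ·) ∧ (b :: v).IsChain (· ≠ ·) := by
  induction h with
  | @here o b c e w hm hne hb hc =>
    refine ⟨List.isChain_cons_cons.2 ⟨hm.ne, List.isChain_cons_cons.2 ⟨hne, hc⟩⟩,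
      List.isChain_cons_cons.2 ⟨?_, hc⟩⟩
    rintro rfl
    exact hm.ne ((distBtw_loop hG).1 hb)
  | cons hm _ ih => exact ⟨List.isChain_cons_cons.2 ⟨hm.ne, ih.1⟩,
      List.isChain_cons_cons.2 ⟨hm.ne, ih.2⟩⟩

theorem TailPair.level_le {k : ℕ} {o : Option V} {b : V} {u v : List V}
    (h : G.TailPair k o b u v) : k ≤ v.length := by
  induction h with
  | here => exact Nat.zero_le _
  | cons _ _ ih => simpa using ih

theorem TailPair.length {k : ℕ} {o : Option V} {b : V} {u v : List V}
    (h : G.TailPair k o b u v) : u.length = v.length + 1 ∧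
      G.listLen (b :: u) = G.listLen (b :: v) := by
  induction h with
  | @here o b c e w _ _ hb _ =>
    have : G.dist b c + G.dist c e = G.dist b e := hb
    refine ⟨rfl, ?_⟩
    simp only [listLen]
    omega
  | cons _ _ ih => exact ⟨by simp [ih.1], by simp only [listLen, ih.2]⟩

theorem TailPair.unique (hgeo : G.IsGeodetic) {k k' : ℕ} {o : Option V} {b : V}
    {u u' v : List V} (h : G.TailPair k o b u v) (h' : G.TailPair k' o b u' v) :
    u = u' ∧ k = k' := by
  induction h generalizing k' u' with
  | here hm hne hb hc =>
    cases h' with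
    | here hm' hne' hb' hc' => exact ⟨by rw [hm.eq hgeo hb hm' hb'], rfl⟩
    | cons hm' h' => exact absurd (hm'.2 _ hb hm.1) hne
  | cons hm h ih =>
    cases h' with
    | here hm' hne' hb' hc' => exact absurd (hm.2 _ hb' hm'.1) hne'
    | cons hm' h' =>
      obtain ⟨rfl, rfl⟩ := ih h'
      exact ⟨rfl, rfl⟩

theorem TailPair.not_critTail {k : ℕ} {o : Option V} {b : V} {u v : List V}
    (h : G.TailPair k o b u v) : ¬ G.CritTail o b v := by
  induction h with
  | here hm hne hb hc =>
    rintro ⟨⟩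
    rename_i hm' _
    exact hne (hm'.2 _ hb hm.1)
  | cons hm h ih =>
    rintro ⟨⟩
    exact ih ‹_›

theorem TailPair.not_tailPair (hG : G.Connected) {k k' : ℕ} {o : Option V} {b : V} {u v w : List V}
    (h : G.TailPair k o b u v) : ¬ G.TailPair k' o b v w := by
  induction h generalizing k' w with
  | here hm hne hb hc =>
    intro h'
    cases h' with
    | here hm' _ _ _ => exact hne (hm'.2 _ hb hm.1)
    | cons hm' _ => exact hne (hm'.2 _ hb hm.1)
  | @cons k o b c u v hm h ih =>
    intro h'
    cases h' with
    | here hm' hne' hb' hc' =>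
      cases h with
      | here hm2 hne2 hb2 hc2 => exact hm2.1 (hb'.trans hG hb2).1
      | cons hm2 h2 => exact hm2.1 hb'
    | cons hm' h' => exact ih h'

theorem tail_total (hG : G.Connected) {o : Option V} {b : V} {w : List V}
    (hc : (b :: w).IsChain (· ≠ ·)) (hs : ∀ c ∈ w.head?, ¬ G.CtxBtw o b c) :
    G.CritTail o b w ∨ (∃ k v, G.TailPair k o b w v) ∨ ∃ k u, G.TailPair k o b u w := by
  induction w generalizing o b with
  | nil => exact Or.inl (.nil o b)
  | cons c w ih =>
    have hcs := hs c rfl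
    have hcw := (List.isChain_cons_cons.1 hc).2
    by_cases hm : G.MinSing o b c
    · by_cases hw : ∀ e ∈ w.head?, ¬ G.CtxBtw (some b) c e
      · rcases ih hcw hw with h | ⟨k, v, h⟩ | ⟨k, u, h⟩
        · exact Or.inl (.cons hm h)
        · exact Or.inr (Or.inl ⟨_, _, .cons hm h⟩)
        · exact Or.inr (Or.inr ⟨_, _, .cons hm h⟩)
      · push Not at hw
        obtain ⟨e, he, hb⟩ := hw
        cases w with
        | nil => simp at he
        | cons e' w =>
          obtain rfl : e' = e := by simpa using he
          obtain ⟨hne, hew⟩ := List.isChain_cons_cons.1 hcw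
          exact Or.inr (Or.inl ⟨_, _, .here hm hne hb hew⟩)
    · obtain ⟨y, hy, hb⟩ := exists_minSing hG hcs
      refine Or.inr (Or.inr ⟨_, _, .here hy ?_ hb hcw⟩)
      rintro rfl
      exact hm hy

theorem listBdry_isChain (hG : G.Connected) {b : V} {w : List V}
    (hc : (b :: w).IsChain (· ≠ ·)) :
    G.listBdry (some b) w ∈ Finsupp.supported ℤ ℤ {l | (b :: l).IsChain (· ≠ ·)} := by
  induction w generalizing b with
  | nil => exact zero_mem _
  | cons c w ih =>
    obtain ⟨hbc, hcw⟩ := List.isChain_cons_cons.1 hc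
    refine sub_mem ?_ (consMap_mem (fun l hl => List.isChain_cons_cons.2 ⟨hbc, hl⟩) (ih hcw))
    cases w with
    | nil => exact ite_single_mem fun _ => List.isChain_singleton _
    | cons e w =>
      refine ite_single_mem fun h => ?_
      refine List.isChain_cons_cons.2 ⟨?_, (List.isChain_cons_cons.1 hcw).2⟩
      rintro rfl
      exact hbc ((distBtw_loop hG).1 h)

theorem CritTail.listBdry_eq_zero {o : Option V} {b : V} {w : List V} (h : G.CritTail o b w) :
    G.listBdry (some b) w = 0 := by
  induction h with
  | nil => rfl
  | @cons o b c w hm h ih =>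
    rw [listBdry, ih, map_zero, sub_zero]
    cases h with
    | nil => simp [headFace, hm.ne]
    | cons hm' _ => exact if_neg hm'.1

theorem TailPair.listBdry_sub_mem (hG : G.Connected) {k : ℕ} {o : Option V} {b : V}
    {u v : List V} (h : G.TailPair k o b u v) : ∃ ε : ℤ, ε * ε = 1 ∧
      G.listBdry (some b) u - ε • Finsupp.single v 1 ∈
        Finsupp.supported ℤ ℤ (G.tailRest k o b) := by
  induction h with
  | @here o b c e w hm hne hb hc =>
    refine ⟨1, rfl, ?_⟩
    rw [listBdry, headFace, if_pos (show G.CtxBtw (some b) c e from hb),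
      one_smul, sub_sub_cancel_left]
    refine neg_mem ?_
    rw [listBdry, map_sub]
    refine sub_mem ?_ ?_
    · cases w with
      | nil => simp [headFace, hne]
      | cons f w =>
        obtain ⟨hef, hfw⟩ := List.isChain_cons_cons.1 hc
        rw [headFace]
        refine consMap_mem (s := {l | l = f :: w ∧ G.DistBtw c e f}) (fun l hl => ?_)
          (ite_single_mem fun h => ⟨rfl, h⟩)
        obtain ⟨rfl, hcef⟩ := hl
        have hcf : c ≠ f := by
          rintro rfl
          exact hne ((distBtw_loop hG).1 hcef)
        by_cases hbf : G.DistBtw b c f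
        · exact Or.inr (Or.inl ⟨_, _, .here hm hcf hbf hfw⟩)
        · rcases tail_total hG (o := some b) (b := c) (w := f :: w)
            (List.isChain_cons_cons.2 ⟨hcf, hfw⟩) (by simpa [CtxBtw] using hbf) with
            h | ⟨k, v, h⟩ | ⟨k, u, h⟩
          · exact Or.inl (.cons hm h)
          · exact Or.inr (Or.inl ⟨_, _, .cons hm h⟩)
          · exact Or.inr (Or.inr ⟨_, _, Nat.succ_pos _, .cons hm h⟩)
    · refine consMap_mem (s := {l | ∃ l', l = e :: l' ∧ (e :: l').IsChain (· ≠ ·)}) ?_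
        (consMap_mem (s := {l | (e :: l).IsChain (· ≠ ·)}) (fun l hl => by exact ⟨l, rfl, hl⟩)
          (listBdry_isChain hG hc))
      rintro _ ⟨l, rfl, hl⟩
      exact Or.inr (Or.inl ⟨_, _, .here hm hne hb hl⟩)
  | @cons k o b c u v hm h ih =>
    obtain ⟨ε, hε, ih⟩ := ih
    refine ⟨-ε, by rw [neg_mul_neg, hε], ?_⟩
    have hu : G.headFace (some b) c u = 0 := by
      cases h with
      | here hm' _ _ _ => exact if_neg hm'.1
      | cons hm' _ => exact if_neg hm'.1
    have heq : G.listBdry (some b) (c :: u) - -ε • Finsupp.single (c :: v) 1 =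
        -consMap c (G.listBdry (some c) u - ε • Finsupp.single v 1) := by
      rw [listBdry, hu, map_sub, map_smul]
      simp [Finsupp.mapDomain_single, neg_add_eq_sub]
    rw [heq]
    refine neg_mem (consMap_mem (fun w hw => ?_) ih)
    rcases hw with hw | ⟨k', v', hw⟩ | ⟨k', u', hk, hw⟩
    · exact Or.inl (.cons hm hw)
    · exact Or.inr (Or.inl ⟨_, _, .cons hm hw⟩)
    · exact Or.inr (Or.inr ⟨_, _, Nat.succ_lt_succ hk, .cons hm hw⟩)

/-- Lists in which the number of leading copies of `x` is even. -/
inductive EvenHead (x : V) : List V → Prop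
  | nil : EvenHead x []
  | ne {y : V} (w : List V) : y ≠ x → EvenHead x (y :: w)
  | step {w : List V} : EvenHead x w → EvenHead x (x :: x :: w)

/-- The matching on tuples with repeated neighbours: the first run of repeated entries is changed
from even to odd length. -/
inductive RepeatPair : List V → List V → Prop
  | here {x : V} {w : List V} : EvenHead x w → RepeatPair (x :: x :: x :: w) (x :: x :: w)
  | cons {p e : V} {u v : List V} : p ≠ e → RepeatPair (e :: u) (e :: v) →
      RepeatPair (p :: e :: u) (p :: e :: v)

theorem evenHead_or (x : V) (w : List V) : EvenHead x w ∨ ∃ w', w = x :: w' ∧ EvenHead x w' := by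
  induction w with
  | nil => exact Or.inl .nil
  | cons y w ih =>
    by_cases hy : y = x
    · subst hy
      rcases ih with h | ⟨w', rfl, h⟩
      · exact Or.inr ⟨w, rfl, h⟩
      · exact Or.inl (.step h)
    · exact Or.inl (.ne w hy)

theorem EvenHead.not_cons {x : V} {w : List V} (h : EvenHead x w) : ¬ EvenHead x (x :: w) := by
  induction h with
  | nil =>
    rintro (_ | ⟨_, h⟩)
    exact h rfl
  | ne w hy =>
    rintro (_ | ⟨_, h⟩ | _)
    · exact h rfl
    · exact hy rfl
  | step h ih =>
    rintro (_ | ⟨_, h'⟩ | h')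
    · exact h' rfl
    · exact ih h'

theorem RepeatPair.exists_cons {u v : List V} (h : RepeatPair u v) :
    ∃ e u' v', u = e :: u' ∧ v = e :: v' := by
  cases h with
  | here => exact ⟨_, _, _, rfl, rfl⟩
  | cons => exact ⟨_, _, _, rfl, rfl⟩

theorem RepeatPair.not_isChain {u v : List V} (h : RepeatPair u v) :
    ¬ u.IsChain (· ≠ ·) ∧ ¬ v.IsChain (· ≠ ·) := by
  induction h with
  | here => simp
  | cons _ _ ih =>
    exact ⟨fun h => ih.1 (List.isChain_cons_cons.1 h).2,
      fun h => ih.2 (List.isChain_cons_cons.1 h).2⟩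

theorem RepeatPair.length {u v : List V} (h : RepeatPair u v) :
    u.length = v.length + 1 ∧ G.listLen u = G.listLen v := by
  induction h with
  | here => simp [listLen]
  | cons _ _ ih => exact ⟨by simpa using ih.1, by simp [listLen, ih.2]⟩

theorem RepeatPair.unique {u u' v : List V} (h : RepeatPair u v) (h' : RepeatPair u' v) :
    u = u' := by
  induction h generalizing u' with
  | here h =>
    cases h' with
    | here => rfl
    | cons hne => exact absurd rfl hne
  | cons hne h ih =>
    cases h' with
    | here => exact absurd rfl hne
    | cons hne' h' => rw [ih h']

theorem RepeatPair.not_repeatPair {u v w : List V} (h : RepeatPair u v) :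
    ¬ RepeatPair v w := by
  induction h generalizing w with
  | here h =>
    intro h'
    cases h' with
    | here h' => exact h'.not_cons h
    | cons hne => exact hne rfl
  | cons hne h ih =>
    intro h'
    cases h' with
    | here => exact hne rfl
    | cons hne' h' => exact ih h'

theorem repeat_total {w : List V} (h : ¬ w.IsChain (· ≠ ·)) :
    (∃ v, RepeatPair w v) ∨ ∃ u, RepeatPair u w := by
  induction w with
  | nil => simp at h
  | cons x w ih =>
    cases w with
    | nil => simp at h
    | cons y w =>
      by_cases hxy : x = y
      · subst hxy
        rcases evenHead_or x w with hw | ⟨w', rfl, hw⟩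
        · exact Or.inr ⟨_, .here hw⟩
        · exact Or.inl ⟨_, .here hw⟩
      · rcases ih (fun hc => h (List.isChain_cons_cons.2 ⟨hxy, hc⟩)) with ⟨v, hv⟩ | ⟨u, hu⟩
        · obtain ⟨e, u', v', h1, rfl⟩ := hv.exists_cons
          obtain ⟨rfl, rfl⟩ := List.cons.inj h1
          exact Or.inl ⟨_, .cons hxy hv⟩
        · obtain ⟨e, u', v', rfl, h1⟩ := hu.exists_cons
          obtain ⟨rfl, rfl⟩ := List.cons.inj h1
          exact Or.inr ⟨_, .cons hxy hu⟩

theorem headFace_self (x : V) (w : List V) :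
    G.headFace (some x) x w = Finsupp.single w 1 := by
  cases w with
  | nil => simp [headFace]
  | cons y w => exact if_pos (distBtw_self_left x y)

theorem listBdry_cons_self (x : V) (w : List V) :
    G.listBdry (some x) (x :: w) = Finsupp.single w 1 - consMap x (G.listBdry (some x) w) := by
  rw [listBdry, headFace_self]

theorem consMap_single (x : V) (w : List V) :
    consMap x (Finsupp.single w 1) = Finsupp.single (x :: w) 1 := by
  simp [Finsupp.mapDomain_single]

theorem EvenHead.listBdry_mem (hG : G.Connected) {x : V} {w : List V} (h : EvenHead x w) :
    G.listBdry (some x) w ∈ Finsupp.supported ℤ ℤ {l | EvenHead x l} := by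
  induction h with
  | nil => exact zero_mem _
  | @ne y w hy =>
    refine sub_mem ?_ (consMap_mem (s := Set.univ) (fun l _ => .ne l hy) (by simp))
    cases w with
    | nil => exact ite_single_mem fun _ => .nil
    | cons z w =>
      refine ite_single_mem fun h => .ne w ?_
      rintro rfl
      exact hy ((distBtw_loop hG).1 h).symm
  | @step w h ih =>
    rw [listBdry_cons_self, listBdry_cons_self, map_sub, consMap_single, sub_sub_cancel]
    refine consMap_mem (s := {l | ∃ l', l = x :: l' ∧ EvenHead x l'}) ?_
      (consMap_mem (s := {l | EvenHead x l}) (fun l hl => by exact ⟨l, rfl, hl⟩) ih)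
    rintro _ ⟨l, rfl, hl⟩
    exact EvenHead.step hl

theorem listBdry_head_ne (hG : G.Connected) {p : V} {w : List V} (h : w.head? ≠ some p) :
    G.listBdry (some p) w ∈ Finsupp.supported ℤ ℤ {l | l.head? ≠ some p} := by
  cases w with
  | nil => exact zero_mem _
  | cons e w =>
    refine sub_mem ?_ (consMap_mem (s := Set.univ) (fun l _ => by simpa using h) (by simp))
    cases w with
    | nil => exact ite_single_mem fun _ => by simp
    | cons f w =>
      refine ite_single_mem fun hb => ?_
      simp only [List.head?_cons, ne_eq, Option.some.injEq, Set.mem_ofPred_eq] at h ⊢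
      rintro rfl
      exact h ((distBtw_loop hG).1 hb).symm

theorem RepeatPair.listBdry_sub_mem (hG : G.Connected) {u v : List V} (h : RepeatPair u v)
    (o : Option V) (ho : ∀ p ∈ o, u.head? ≠ some p) : ∃ ε : ℤ, ε * ε = 1 ∧
      G.listBdry o u - ε • Finsupp.single v 1 ∈
        Finsupp.supported ℤ ℤ {w | ∃ v', RepeatPair w v'} := by
  induction h generalizing o with
  | @here x w h =>
    refine ⟨1, rfl, ?_⟩
    rw [listBdry, headFace, if_pos (ctxBtw_self o x), listBdry_cons_self, listBdry_cons_self,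
      map_sub, consMap_single, sub_sub_cancel, one_smul, map_sub, map_sub, consMap_single,
      consMap_single, sub_sub_cancel_left]
    refine neg_mem (consMap_mem (s := {l | ∃ l', l = x :: x :: l' ∧ EvenHead x l'}) ?_
      (consMap_mem (s := {l | ∃ l', l = x :: l' ∧ EvenHead x l'}) ?_
      (consMap_mem (s := {l | EvenHead x l}) (fun l hl => by exact ⟨l, rfl, hl⟩)
        (h.listBdry_mem hG))))
    · rintro _ ⟨l, rfl, hl⟩
      exact ⟨_, .here hl⟩
    · rintro _ ⟨l, rfl, hl⟩
      exact ⟨_, rfl, hl⟩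
  | @cons p e u v hne h ih =>
    have hhead : (e :: u).head? ≠ some p := by simpa using hne.symm
    obtain ⟨ε, hε, ih⟩ := ih (some p) (by simpa using hne.symm)
    refine ⟨-ε, by rw [neg_mul_neg, hε], ?_⟩
    have heq : G.listBdry o (p :: e :: u) - -ε • Finsupp.single (p :: e :: v) 1 =
        G.headFace o p (e :: u) -
          consMap p (G.listBdry (some p) (e :: u) - ε • Finsupp.single (e :: v) 1) := by
      rw [listBdry, map_sub, map_smul, consMap_single, neg_smul, sub_neg_eq_add]
      abel
    rw [heq]
    refine sub_mem (ite_single_mem fun _ => ⟨_, h⟩) ?_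
    have hmem : G.listBdry (some p) (e :: u) - ε • Finsupp.single (e :: v) 1 ∈
        Finsupp.supported ℤ ℤ {l | l.head? ≠ some p} :=
      sub_mem (listBdry_head_ne hG hhead) (Submodule.smul_mem _ _
        (Finsupp.single_mem_supported ℤ _ (by simpa using hne.symm)))
    refine consMap_mem (s := {l | (∃ v', RepeatPair l v') ∧ l.head? ≠ some p}) ?_
      fun l hl => ⟨ih hl, hmem hl⟩
    rintro l ⟨⟨v', hl⟩, hp⟩
    obtain ⟨e', u', v', rfl, rfl⟩ := hl.exists_cons
    exact ⟨_, .cons (by simpa [eq_comm] using hp) hl⟩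

variable (G)

/-- The matching of all nonempty tuples. -/
def ListPair (k : ℕ) (s t : List V) : Prop :=
  (∃ x u v, s = x :: u ∧ t = x :: v ∧ G.TailPair k none x u v) ∨ (k = 0 ∧ RepeatPair s t)

/-- The critical tuples. -/
def ListCrit : Set (List V) := {s | ∃ x w, s = x :: w ∧ G.CritTail none x w}

/-- The tuples of degree `n` and length `ℓ`. -/
def listCells (ℓ n : ℕ) : Set (List V) := {s | s.length = n + 1 ∧ G.listLen s = ℓ}

variable {G}

theorem ListPair.length {k : ℕ} {s t : List V} (h : G.ListPair k s t) :
    s.length = t.length + 1 ∧ G.listLen s = G.listLen t := by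
  rcases h with ⟨x, u, v, rfl, rfl, h⟩ | ⟨rfl, h⟩
  · exact ⟨by simp [h.length.1], h.length.2⟩
  · exact h.length

/-- The matching on the tuples of length `ℓ` in a geodetic graph. -/
noncomputable def listMatching (hG : G.Connected) (hgeo : G.IsGeodetic) (ℓ : ℕ) :
    LevelMatching (G.listBdryMap none) (G.listCells ℓ) where
  crit := G.ListCrit
  pair := G.ListPair
  pair_unique := by
    rintro k k' s s' t (⟨x, u, v, rfl, rfl, h⟩ | ⟨rfl, h⟩) (⟨x', u', v', rfl, h1, h'⟩ | ⟨rfl, h'⟩)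
    · obtain ⟨rfl, rfl⟩ := List.cons.inj h1
      obtain ⟨rfl, rfl⟩ := h.unique hgeo h'
      exact ⟨rfl, rfl⟩
    · exact absurd (h.isChain hG).2 h'.not_isChain.2
    · subst h1
      exact absurd (h'.isChain hG).2 h.not_isChain.2
    · exact ⟨h.unique h', rfl⟩
  not_crit := by
    rintro k s t (⟨x, u, v, rfl, rfl, h⟩ | ⟨rfl, h⟩) ⟨x', w, h1, hc⟩
    · obtain ⟨rfl, rfl⟩ := List.cons.inj h1
      exact h.not_critTail hc
    · subst h1
      exact h.not_isChain.2 hc.isChain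
  not_pair := by
    rintro k k' s t r (⟨x, u, v, rfl, rfl, h⟩ | ⟨rfl, h⟩) (⟨x', u', v', h1, rfl, h'⟩ | ⟨rfl, h'⟩)
    · obtain ⟨rfl, rfl⟩ := List.cons.inj h1
      exact h.not_tailPair hG h'
    · exact (h'.not_isChain).1 (h.isChain hG).2
    · subst h1
      exact h.not_isChain.2 (h'.isChain hG).1
    · exact h.not_repeatPair h'
  total := by
    rintro n s ⟨hs, -⟩
    by_cases hc : s.IsChain (· ≠ ·)
    · cases s with
      | nil => simp at hs
      | cons x w =>
        rcases tail_total hG (o := none) hc (by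
          intro c hcw
          cases w with
          | nil => simp at hcw
          | cons c' w =>
            obtain rfl : c' = c := by simpa using hcw
            exact (List.isChain_cons_cons.1 hc).1) with h | ⟨k, v, h⟩ | ⟨k, u, h⟩
        · exact Or.inl ⟨_, _, rfl, h⟩
        · exact Or.inr (Or.inl ⟨_, _, Or.inl ⟨_, _, _, rfl, rfl, h⟩⟩)
        · exact Or.inr (Or.inr ⟨_, _, Or.inl ⟨_, _, _, rfl, rfl, h⟩⟩)
    · rcases repeat_total hc with ⟨v, h⟩ | ⟨u, h⟩
      · exact Or.inr (Or.inl ⟨_, _, Or.inr ⟨rfl, h⟩⟩)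
      · exact Or.inr (Or.inr ⟨_, _, Or.inr ⟨rfl, h⟩⟩)
  d_d := listBdryMap_listBdryMap hG none
  d_crit := by
    rintro _ ⟨x, w, rfl, h⟩
    rw [listBdryMap_single, listBdry, h.listBdry_eq_zero, map_zero, sub_zero]
    cases h with
    | nil => simp [headFace]
    | cons hm _ => exact if_neg hm.1
  d_pair := by
    rintro k s t (⟨x, u, v, rfl, rfl, h⟩ | ⟨rfl, h⟩)
    · obtain ⟨ε, hε, hmem⟩ := h.listBdry_sub_mem hG
      refine ⟨-ε, by rw [neg_mul_neg, hε], ?_⟩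
      have hu : G.headFace none x u = 0 := by
        cases h with
        | here hm' _ _ _ => exact if_neg hm'.1
        | cons hm' _ => exact if_neg hm'.1
      have heq : G.listBdryMap none (Finsupp.single (x :: u) 1) -
          -ε • Finsupp.single (x :: v) 1 =
          -consMap x (G.listBdry (some x) u - ε • Finsupp.single v 1) := by
        rw [listBdryMap_single, listBdry, hu, map_sub, map_smul, consMap_single]
        simp [neg_add_eq_sub]
      rw [heq]
      refine neg_mem (consMap_mem (fun w hw => ?_) hmem)
      rcases hw with hw | ⟨k', v', hw⟩ | ⟨k', u', hk, hw⟩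
      · exact Or.inl ⟨_, _, rfl, hw⟩
      · exact Or.inr (Or.inl ⟨_, _, Or.inl ⟨_, _, _, rfl, rfl, hw⟩⟩)
      · exact Or.inr (Or.inr ⟨_, _, hk, Or.inl ⟨_, _, _, rfl, rfl, hw⟩⟩)
    · obtain ⟨ε, hε, hmem⟩ := h.listBdry_sub_mem hG none (by simp)
      refine ⟨ε, hε, ?_⟩
      rw [listBdryMap_single]
      refine Finsupp.supported_mono ?_ hmem
      rintro w ⟨v', hw⟩
      exact Or.inr (Or.inl ⟨_, _, Or.inr ⟨rfl, hw⟩⟩)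
  d_mem := by
    rintro n s ⟨hs, hl⟩
    rw [listBdryMap_single]
    refine Finsupp.supported_mono ?_ (listBdry_mem none s)
    rintro w ⟨h1, h2⟩
    exact ⟨by omega, h2.trans hl⟩
  pair_mem := by
    rintro n k s t h ⟨h1, h2⟩
    exact ⟨by rw [h.length.1, h1], by rw [h.length.2, h2]⟩
  level_le := by
    rintro n k s t (⟨x, u, v, rfl, rfl, h⟩ | ⟨rfl, h⟩) ⟨ht, -⟩
    · have := h.level_le
      simp only [List.length_cons, add_left_inj] at ht
      omega
    · exact Nat.zero_le _

theorem toQuasiMetric_btw (hG : G.Connected) {x y z : V} :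
    (G.toQuasiMetric hG).Btw x y z ↔ G.DistBtw x y z := by
  simp only [QuasiMetric.Btw, toQuasiMetric, DistBtw]
  exact_mod_cast Iff.rfl

theorem toQuasiMetric_len (hG : G.Connected) {n : ℕ} (t : Fin (n + 1) → V) :
    (G.toQuasiMetric hG).len t = (G.listLen (List.ofFn t) : ℝ≥0∞) := by
  induction n with
  | zero => simp [QuasiMetric.len, listLen]
  | succ n ih =>
    have h := ih (Fin.tail t)
    rw [QuasiMetric.len] at h ⊢
    rw [Fin.sum_univ_succ, List.ofFn_succ, List.ofFn_succ, listLen, Nat.cast_add]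
    rw [List.ofFn_succ] at h
    exact congrArg _ h

theorem delCond_tail (hG : G.Connected) {n : ℕ} (t : Fin (n + 3) → V) (i : Fin (n + 1)) :
    (G.toQuasiMetric hG).delCond t i.succ.succ ↔
      (G.toQuasiMetric hG).delCond (Fin.tail t) i.succ := by
  simp [QuasiMetric.delCond, Fin.tail, Fin.succ, Nat.add_right_cancel_iff]

theorem sum_delCond_succ (hG : G.Connected) {n : ℕ} (t : Fin (n + 2) → V) :
    (∑ i : Fin (n + 1), if (G.toQuasiMetric hG).delCond t i.succ then
      ((-1 : ℤ) ^ (i : ℕ)) • Finsupp.single (List.ofFn (Fin.tail t ∘ i.succAbove)) (1 : ℤ) else 0) =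
      G.listBdry (some (t 0)) (List.ofFn (Fin.tail t)) := by
  induction n with
  | zero =>
    simp only [QuasiMetric.delCond, toQuasiMetric_btw]
    simp [listBdry, headFace, Fin.tail, distBtw_loop hG]
  | succ n ih =>
    rw [Fin.sum_univ_succ, List.ofFn_succ (f := Fin.tail t), listBdry, sub_eq_add_neg]
    congr 1
    · rw [List.ofFn_succ (f := fun i : Fin (n + 1) => Fin.tail t i.succ), headFace]
      simp only [QuasiMetric.delCond, toQuasiMetric_btw]
      simp [Fin.tail, CtxBtw, Function.comp_def]
      congr
    · have h := ih (Fin.tail t)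
      rw [show Fin.tail t 0 = t 1 from rfl] at h
      rw [show (fun i : Fin (n + 1) => Fin.tail t i.succ) = Fin.tail (Fin.tail t) from rfl,
        show Fin.tail t 0 = t 1 from rfl, ← h, map_sum, ← Finset.sum_neg_distrib]
      refine Finset.sum_congr rfl fun i _ => ?_
      rw [← if_congr (delCond_tail hG t i) rfl rfl]
      split_ifs
      · rw [map_smul, consMap_single, Fin.val_succ, pow_succ, mul_neg_one, neg_smul,
          List.ofFn_succ]
        simp [Function.comp_def, Fin.tail]
      · simp

/-- Tuples as lists. -/
noncomputable abbrev ofFnMap (V : Type) (n : ℕ) : MC V n →ₗ[ℤ] (List V →₀ ℤ) :=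
  Finsupp.lmapDomain ℤ ℤ List.ofFn

theorem ofFnMap_injective (n : ℕ) : Function.Injective (ofFnMap V n) :=
  Finsupp.mapDomain_injective List.ofFn_injective

theorem ofFnMap_bdry (hG : G.Connected) {n : ℕ} (x : MC V (n + 1)) :
    ofFnMap V n ((G.toQuasiMetric hG).bdry n x) = G.listBdryMap none (ofFnMap V (n + 1) x) := by
  have h : ofFnMap V n ∘ₗ (G.toQuasiMetric hG).bdry n =
      G.listBdryMap none ∘ₗ ofFnMap V (n + 1) := by
    refine Finsupp.lhom_ext' fun t => LinearMap.ext_ring ?_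
    have hb : (G.toQuasiMetric hG).bdry n (Finsupp.single t 1) = ∑ i : Fin (n + 2),
        if (G.toQuasiMetric hG).delCond t i then
          ((-1 : ℤ) ^ (i : ℕ)) • Finsupp.single (t ∘ i.succAbove) (1 : ℤ) else 0 := by
      simp [QuasiMetric.bdry]
    have he : ofFnMap V (n + 1) (Finsupp.single t 1) = Finsupp.single (List.ofFn t) 1 := by
      simp [Finsupp.mapDomain_single]
    simp only [LinearMap.comp_apply, Finsupp.lsingle_apply]
    rw [hb, he, listBdryMap_single, map_sum, Fin.sum_univ_succ, List.ofFn_succ, listBdry,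
      sub_eq_add_neg]
    congr 1
    · rw [List.ofFn_succ, headFace]
      simp only [QuasiMetric.delCond, toQuasiMetric_btw]
      simp [CtxBtw, Function.comp_def, distBtw_loop hG, apply_ite (ofFnMap V n),
        Finsupp.mapDomain_single, eq_comm]
      congr
    · rw [show (fun i : Fin (n + 1) => t i.succ) = Fin.tail t from rfl, ← sum_delCond_succ hG,
        map_sum, ← Finset.sum_neg_distrib]
      refine Finset.sum_congr rfl fun i _ => ?_
      split_ifs
      · rw [map_smul, map_smul, consMap_single, Fin.val_succ, pow_succ, mul_neg_one, neg_smul]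
        simp [Function.comp_def, Fin.tail, Finsupp.mapDomain_single, List.ofFn_succ]
      · simp
  exact LinearMap.congr_fun h x

variable (G) in
/-- The critical tuples of degree `n` and length `ℓ`. -/
def critTuples (n ℓ : ℕ) : Set (Fin (n + 1) → V) :=
  List.ofFn ⁻¹' (G.ListCrit ∩ G.listCells ℓ n)

theorem grMC_eq (hG : G.Connected) (n ℓ : ℕ) : (G.toQuasiMetric hG).grMC n ℓ =
    Finsupp.supported ℤ ℤ (List.ofFn ⁻¹' G.listCells ℓ n) := by
  rw [QuasiMetric.grMC, Finsupp.supported_eq_span_single]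
  congr 1
  ext c
  simp [toQuasiMetric_len, listCells, eq_comm]

theorem ofFnMap_mem {n : ℕ} {s : Set (List V)} {x : MC V n} :
    ofFnMap V n x ∈ Finsupp.supported ℤ ℤ s ↔ x ∈ Finsupp.supported ℤ ℤ (List.ofFn ⁻¹' s) := by
  constructor
  · intro h t ht
    refine h ?_
    simp only [Finset.mem_coe, Finsupp.mem_support_iff] at ht ⊢
    rwa [Finsupp.lmapDomain_apply, Finsupp.mapDomain_apply List.ofFn_injective]
  · intro h
    have := Submodule.mem_map_of_mem (f := ofFnMap V n) h
    rw [Finsupp.lmapDomain_supported] at this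
    exact Finsupp.supported_mono (Set.image_preimage_subset _ _) this

theorem exists_ofFnMap_eq {n ℓ : ℕ} {y : List V →₀ ℤ}
    (hy : y ∈ Finsupp.supported ℤ ℤ (G.listCells ℓ n)) : ∃ x, ofFnMap V n x = y := by
  have h : y ∈ Finsupp.supported ℤ ℤ ((List.ofFn : (Fin (n + 1) → V) → List V) '' Set.univ) := by
    refine Finsupp.supported_mono ?_ hy
    rintro l ⟨hl, -⟩
    exact ⟨fun i => l.get (i.cast hl.symm), trivial, by
      apply List.ext_get <;> simp [hl, -List.ofFn_succ]⟩
  rw [← Finsupp.lmapDomain_supported] at h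
  obtain ⟨x, -, hx⟩ := h
  exact ⟨x, hx⟩

theorem listBdryMap_eq_zero_of_cells {ℓ : ℕ} {x : List V →₀ ℤ}
    (hx : x ∈ Finsupp.supported ℤ ℤ (G.listCells ℓ 0)) : G.listBdryMap none x = 0 := by
  have h : Finsupp.supported ℤ ℤ (G.listCells ℓ 0) ≤ LinearMap.ker (G.listBdryMap none) := by
    rw [Finsupp.supported_eq_span_single, Submodule.span_le]
    rintro _ ⟨s, ⟨hs, -⟩, rfl⟩
    obtain ⟨v, rfl⟩ := List.length_eq_one_iff.1 hs
    simp [listBdry, headFace]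
  exact h hx

theorem mem_grZ (hG : G.Connected) {n ℓ : ℕ} {x : MC V n} :
    x ∈ (G.toQuasiMetric hG).grZ n ℓ ↔ ofFnMap V n x ∈ Finsupp.supported ℤ ℤ (G.listCells ℓ n) ∧
      G.listBdryMap none (ofFnMap V n x) = 0 := by
  rw [ofFnMap_mem, ← grMC_eq hG]
  cases n with
  | zero =>
    refine ⟨fun h => ⟨h, ?_⟩, fun h => h.1⟩
    rw [QuasiMetric.grZ, grMC_eq, ← ofFnMap_mem] at h
    exact listBdryMap_eq_zero_of_cells h
  | succ n =>
    rw [QuasiMetric.grZ, Submodule.mem_inf, LinearMap.mem_ker, ← ofFnMap_bdry hG,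
      map_eq_zero_iff _ (ofFnMap_injective n)]

theorem mem_grB (hG : G.Connected) {n ℓ : ℕ} {x : MC V n} :
    x ∈ (G.toQuasiMetric hG).grB n ℓ ↔ ∃ y ∈ Finsupp.supported ℤ ℤ (G.listCells ℓ (n + 1)),
      G.listBdryMap none y = ofFnMap V n x := by
  rw [QuasiMetric.grB, grMC_eq]
  constructor
  · rintro ⟨y, hy, rfl⟩
    exact ⟨_, ofFnMap_mem.2 hy, (ofFnMap_bdry hG y).symm⟩
  · rintro ⟨y, hy, hyx⟩
    obtain ⟨y, rfl⟩ := exists_ofFnMap_eq hy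
    exact ⟨y, ofFnMap_mem.1 hy, ofFnMap_injective n (by rw [ofFnMap_bdry, hyx])⟩

/-- The magnitude homology of a geodetic graph is free on the critical tuples. -/
theorem nonempty_grMH_equiv (hG : G.Connected) (hgeo : G.IsGeodetic) (n ℓ : ℕ) :
    Nonempty ((G.toQuasiMetric hG).grMH n ℓ ≃ₗ[ℤ] (G.critTuples n ℓ →₀ ℤ)) := by
  have hC : Finsupp.supported ℤ ℤ (G.critTuples n ℓ) ≤ (G.toQuasiMetric hG).grZ n ℓ := by
    intro x hx
    rw [critTuples, ← ofFnMap_mem] at hx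
    exact (mem_grZ hG).2 ⟨fun w hw => (hx hw).2,
      (listMatching hG hgeo ℓ).d_eq_zero_of_mem_crit fun w hw => (hx hw).1⟩
  have hcompl : IsCompl
      (Submodule.comap ((G.toQuasiMetric hG).grZ n ℓ).subtype ((G.toQuasiMetric hG).grB n ℓ))
      (Submodule.comap ((G.toQuasiMetric hG).grZ n ℓ).subtype
        (Finsupp.supported ℤ ℤ (G.critTuples n ℓ))) := by
    constructor
    · rw [Submodule.disjoint_def]
      rintro ⟨x, hx⟩ hB hxC
      obtain ⟨y, hy, hyx⟩ := (mem_grB hG).1 hB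
      replace hxC : x ∈ Finsupp.supported ℤ ℤ (G.critTuples n ℓ) := hxC
      rw [critTuples, ← ofFnMap_mem] at hxC
      have := (listMatching hG hgeo ℓ).eq_zero_of_crit_eq_d (fun w hw => (hxC hw).1) hy hyx
      exact Subtype.ext ((map_eq_zero_iff _ (ofFnMap_injective n)).1 this)
    · rw [codisjoint_iff_le_sup]
      rintro ⟨x, hx⟩ -
      obtain ⟨hx1, hx2⟩ := (mem_grZ hG).1 hx
      obtain ⟨c, hc, y, hy, hcy⟩ := (listMatching hG hgeo ℓ).exists_crit_add_d hx1 hx2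
      obtain ⟨c, rfl⟩ := exists_ofFnMap_eq fun w hw => (hc hw).2
      have hc' : c ∈ Finsupp.supported ℤ ℤ (G.critTuples n ℓ) := ofFnMap_mem.1 hc
      have hB : x - c ∈ (G.toQuasiMetric hG).grB n ℓ :=
        (mem_grB hG).2 ⟨y, hy, by rw [map_sub, hcy, add_sub_cancel_left]⟩
      exact Submodule.mem_sup.2 ⟨⟨x - c, sub_mem hx (hC hc')⟩, hB, ⟨c, hC hc'⟩, hc',
        Subtype.ext (sub_add_cancel x c)⟩
  exact ⟨(Submodule.quotientEquivOfIsCompl _ _ hcompl).trans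
    ((Submodule.comapSubtypeEquivOfLe hC).trans (Finsupp.supportedEquivFinsupp _))⟩

theorem IsPath.eq_of_length_add_lt_girth {u v : V} {p q : G.Walk u v} (hp : p.IsPath)
    (hq : q.IsPath) (h : p.length + q.length < G.girth) : p = q := by
  let H : SimpleGraph V := fromEdgeSet {e | e ∈ p.edges ∨ e ∈ q.edges}
  have hH : H.edgeSet ⊆ {e | e ∈ p.edges ∨ e ∈ q.edges} := by
    rw [edgeSet_fromEdgeSet]
    exact Set.sdiff_subset
  have hHG : H ≤ G := by
    intro a b hab
    rcases ((fromEdgeSet_adj _).1 hab).1 with h | h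
    · exact p.adj_of_mem_edges h
    · exact q.adj_of_mem_edges h
  have hpH : ∀ e ∈ p.edges, e ∈ H.edgeSet := fun e he => by
    rw [edgeSet_fromEdgeSet]
    exact ⟨Or.inl he, G.not_isDiag_of_mem_edgeSet (p.edges_subset_edgeSet he)⟩
  have hqH : ∀ e ∈ q.edges, e ∈ H.edgeSet := fun e he => by
    rw [edgeSet_fromEdgeSet]
    exact ⟨Or.inr he, G.not_isDiag_of_mem_edgeSet (q.edges_subset_edgeSet he)⟩
  have hac : H.IsAcyclic := by
    intro a c hc
    have h1 := girth_le_length (hc.mapLe hHG)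
    simp only [Walk.length_map] at h1
    have h2 : c.edges.length ≤ (p.edges ++ q.edges).length :=
      (List.subperm_of_subset hc.edges_nodup fun e he => List.mem_append.2
        (hH (c.edges_subset_edgeSet he))).length_le
    simp only [List.length_append, Walk.length_edges] at h2
    omega
  have heq := congrArg (fun r : H.Path u v => r.1.support) ((hac.subsingleton_path u v).elim
    ⟨p.transfer H hpH, hp.transfer hpH⟩ ⟨q.transfer H hqH, hq.transfer hqH⟩)
  exact Walk.ext_support (by simpa using heq)

theorem exists_adj_dist_eq (hG : G.Connected) {x c : V} {k : ℕ} (h : G.dist x c = k + 1) :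
    ∃ y, G.Adj x y ∧ G.dist y c = k := by
  obtain ⟨p, hp⟩ := hG.exists_walk_length_eq_dist x c
  cases p with
  | nil => simp at h
  | @cons _ y _ hxy p =>
    have h1 := dist_le p
    have h2 : G.dist x c ≤ G.dist x y + G.dist y c := hG.dist_triangle
    rw [dist_eq_one_iff_adj.2 hxy] at h2
    rw [Walk.length_cons] at hp
    exact ⟨y, hxy, by omega⟩

theorem Adj.dist_le_add_one (hG : G.Connected) {x y : V} (h : G.Adj x y) (c : V) :
    G.dist x c ≤ G.dist y c + 1 := by
  have h2 : G.dist x c ≤ G.dist x y + G.dist y c := hG.dist_triangle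
  rw [dist_eq_one_iff_adj.2 h] at h2
  omega

theorem adj_eq_of_dist_eq (hG : G.Connected) {m k : ℕ} (hg : 2 * m < G.girth) {x y y' c : V}
    (hxy : G.Adj x y) (hxy' : G.Adj x y') (hx : G.dist x c = k + 1) (hk : k < m)
    (hy : G.dist y c = k) (hy' : G.dist y' c = k) : y = y' := by
  obtain ⟨p, hp⟩ := hG.exists_walk_length_eq_dist y c
  obtain ⟨q, hq⟩ := hG.exists_walk_length_eq_dist y' c
  have h := IsPath.eq_of_length_add_lt_girth
    ((Walk.cons hxy p).isPath_of_length_eq_dist (by simp [hp, hx, hy]))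
    ((Walk.cons hxy' q).isPath_of_length_eq_dist (by simp [hq, hx, hy']))
    (by simp only [Walk.length_cons]; omega)
  simpa using congrArg Walk.snd h

theorem Adj.le_of_dist_eq (hG : G.Connected) {m : ℕ} (hg : 2 * m < G.girth) {a b c : V}
    (hab : G.Adj a b) (h : G.dist a c = G.dist b c) : m ≤ G.dist b c := by
  by_contra! hlt
  obtain ⟨p, hp, hpl⟩ := hG.exists_path_of_dist a c
  obtain ⟨q, hq, hql⟩ := hG.exists_path_of_dist b c
  have ha : a ∉ q.support := by
    intro ha
    have h1 := congrArg Walk.length (q.take_spec ha)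
    rw [Walk.length_append] at h1
    have h2 := dist_le (q.takeUntil a ha)
    have h3 := dist_le (q.dropUntil a ha)
    rw [dist_eq_one_iff_adj.2 hab.symm] at h2
    omega
  have heq := congrArg Walk.length (IsPath.eq_of_length_add_lt_girth hp
    (Walk.IsPath.cons hq ha : (Walk.cons hab q).IsPath)
    (by simp only [Walk.length_cons]; omega))
  rw [Walk.length_cons] at heq
  omega

theorem isGeodetic_of_lt_girth (hG : G.Connected) {m : ℕ} (hg : 2 * m < G.girth)
    (hdiam : ∀ x y : V, G.dist x y ≤ m) : G.IsGeodetic := by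
  intro a b x y hx hy
  induction hk : G.dist a x generalizing a with
  | zero =>
    obtain rfl := hG.dist_eq_zero_iff.1 hk
    exact Or.inl (distBtw_self_left _ _)
  | succ k ih =>
    by_cases hay : a = y
    · subst hay
      exact Or.inr (distBtw_self_left _ _)
    obtain ⟨l, hl⟩ := Nat.exists_eq_succ_of_ne_zero (mt hG.dist_eq_zero_iff.1 hay)
    obtain ⟨a', haa', hax⟩ := exists_adj_dist_eq hG hk
    obtain ⟨a'', haa'', hay'⟩ := exists_adj_dist_eq hG hl
    have hm := hdiam a b
    unfold DistBtw at *
    have h1 : G.dist a' b ≤ G.dist a' x + G.dist x b := hG.dist_triangle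
    have h2 : G.dist a'' b ≤ G.dist a'' y + G.dist y b := hG.dist_triangle
    have h3 := haa'.dist_le_add_one hG b
    have h4 := haa''.dist_le_add_one hG b
    obtain rfl : a' = a'' := adj_eq_of_dist_eq hG hg (k := G.dist a b - 1) (c := b) haa' haa''
      (by omega) (by omega) (by omega) (by omega)
    have h5 := haa'.dist_le_add_one hG y
    have h6 := haa'.dist_le_add_one hG x
    have h7 : G.dist a y ≤ G.dist a x + G.dist x y := hG.dist_triangle
    have h8 : G.dist a x ≤ G.dist a y + G.dist y x := hG.dist_triangle
    rcases ih a' (by omega) (by omega) hax with h | h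
    · left; omega
    · right; omega

theorem minSing_iff_adj (hG : G.Connected) {o : Option V} {b : V}
    (h : ∀ z, G.CtxBtw o b z → b = z) {c : V} : G.MinSing o b c ↔ G.Adj b c := by
  constructor
  · rintro ⟨h1, h2⟩
    have hbc : b ≠ c := by
      rintro rfl
      exact h1 (ctxBtw_self o b)
    obtain ⟨k, hk⟩ := Nat.exists_eq_succ_of_ne_zero (mt hG.dist_eq_zero_iff.1 hbc)
    obtain ⟨y, hy, hyc⟩ := exists_adj_dist_eq hG hk
    obtain rfl := h2 y (by rw [DistBtw, dist_eq_one_iff_adj.2 hy]; omega)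
      fun hb => hy.ne (h y hb)
    exact hy
  · refine fun hbc => ⟨fun hb => hbc.ne (h c hb), fun z hz hbz => ?_⟩
    rw [DistBtw, dist_eq_one_iff_adj.2 hbc] at hz
    have h0 : G.dist b z ≠ 0 := by
      rw [Ne, hG.dist_eq_zero_iff]
      rintro rfl
      exact hbz (ctxBtw_self o b)
    exact hG.dist_eq_zero_iff.1 (by omega)

theorem minSing_none_iff (hG : G.Connected) {b c : V} : G.MinSing none b c ↔ G.Adj b c :=
  minSing_iff_adj (o := none) hG fun _ h => h

theorem minSing_iff_of_dist_eq (hG : G.Connected) {m : ℕ} (hdiam : ∀ x y : V, G.dist x y ≤ m)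
    {a b c : V} (hab : G.dist a b = m) : G.MinSing (some a) b c ↔ G.Adj b c := by
  refine minSing_iff_adj hG fun z h => ?_
  replace h : G.dist a b + G.dist b z = G.dist a z := h
  have := hdiam a z
  exact hG.dist_eq_zero_iff.1 (by omega)

theorem minSing_iff_of_adj (hG : G.Connected) {m : ℕ} (hg : 2 * m < G.girth)
    (hdiam : ∀ x y : V, G.dist x y ≤ m) {a b c : V} (hab : G.Adj a b) :
    G.MinSing (some a) b c ↔ c = a ∨ (G.dist b c = m ∧ m ≤ G.dist a c) := by
  have h1 : G.dist a b = 1 := dist_eq_one_iff_adj.2 hab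
  have h1' : G.dist b a = 1 := dist_eq_one_iff_adj.2 hab.symm
  simp only [MinSing, CtxBtw, DistBtw, h1]
  constructor
  · rintro ⟨h2, h3⟩
    have h4 := hab.dist_le_add_one hG c
    have h5 := hab.symm.dist_le_add_one hG c
    by_cases h6 : G.dist a c = G.dist b c
    · have := hab.le_of_dist_eq hG hg h6
      have := hdiam b c
      right
      omega
    · left
      refine (h3 a (by omega) ?_).symm
      rw [h1', dist_self]
      omega
  · rintro (rfl | ⟨h2, h3⟩)
    · refine ⟨by rw [dist_self]; omega, fun z hz h2 => ?_⟩
      rw [h1'] at hz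
      by_cases h0 : G.dist b z = 0
      · obtain rfl := hG.dist_eq_zero_iff.1 h0
        rw [dist_self, h1] at h2
        omega
      · exact hG.dist_eq_zero_iff.1 (by omega)
    · have := hdiam a c
      refine ⟨by omega, fun z hz h4 => ?_⟩
      have h5 := hab.dist_le_add_one hG z
      have h6 : G.dist a c ≤ G.dist a z + G.dist z c := hG.dist_triangle
      have h7 := fun h => hab.le_of_dist_eq hG hg (c := z) h
      exact hG.dist_eq_zero_iff.1 (by omega)

variable [Fintype V]

theorem card_shell (hG : G.Connected) {D m : ℕ} (hg : 2 * m < G.girth)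
    (hreg : ∀ x, (Finset.univ.filter (G.Adj x)).card = D) {k : ℕ} (hk : k ≤ m) {a b : V}
    (hab : G.Adj a b) :
    (Finset.univ.filter fun c => G.dist b c = k ∧ k ≤ G.dist a c).card = (D - 1) ^ k := by
  induction k generalizing a b with
  | zero =>
    rw [pow_zero, Finset.card_eq_one]
    exact ⟨b, by ext c; simp [hG.dist_eq_zero_iff, eq_comm]⟩
  | succ k ih =>
    have heq : (Finset.univ.filter fun c => G.dist b c = k + 1 ∧ k + 1 ≤ G.dist a c) =
        ((Finset.univ.filter (G.Adj b)).erase a).biUnion fun b' =>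
          Finset.univ.filter fun c => G.dist b' c = k ∧ k ≤ G.dist b c := by
      ext c
      simp only [Finset.mem_filter_univ, Finset.mem_biUnion, Finset.mem_erase]
      constructor
      · rintro ⟨h1, h2⟩
        obtain ⟨b', hb, hc⟩ := exists_adj_dist_eq hG h1
        refine ⟨b', ⟨?_, hb⟩, hc, by omega⟩
        rintro rfl
        omega
      · rintro ⟨b', ⟨hne, hb⟩, hc, h1⟩
        have h2 := hb.dist_le_add_one hG c
        have h3 := fun h => hb.le_of_dist_eq hG hg (c := c) h
        have h4 := hab.symm.dist_le_add_one hG c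
        have h5 := fun h => adj_eq_of_dist_eq hG hg (k := k) (c := c) hab.symm hb
          (by omega) (by omega) h hc
        have h6 : G.dist a c ≠ k := fun h => hne (h5 h).symm
        omega
    rw [heq, Finset.card_biUnion]
    · rw [Finset.sum_congr rfl fun b' hb' => ih (by omega)
        ((Finset.mem_filter_univ _).1 (Finset.mem_of_mem_erase hb')), Finset.sum_const,
        Finset.card_erase_of_mem ((Finset.mem_filter_univ _).2 hab.symm), hreg, smul_eq_mul,
        pow_succ, mul_comm]
    · intro b' hb' b'' hb'' hne
      rw [Function.onFun, Finset.disjoint_left]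
      intro c hc hc'
      rw [Finset.mem_filter_univ] at hc hc'
      rw [Finset.mem_coe, Finset.mem_erase, Finset.mem_filter_univ] at hb' hb''
      have h1 := hb'.2.dist_le_add_one hG c
      have h2 := fun h => hb'.2.le_of_dist_eq hG hg (c := c) h
      exact hne (adj_eq_of_dist_eq hG hg hb'.2 hb''.2 (by omega) (by omega) hc.1 hc'.1)

variable (G) in
/-- The critical tails of degree `n` and length `ℓ` following `b`, whose left neighbour is `o`. -/
noncomputable def critTails : ℕ → Option V → V → ℕ → Finset (List V)
  | 0, _, _, ℓ => if ℓ = 0 then {[]} else ∅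
  | n + 1, o, b, ℓ => (Finset.univ.filter (G.MinSing o b)).biUnion fun c =>
      if G.dist b c ≤ ℓ then (critTails n (some b) c (ℓ - G.dist b c)).image (List.cons c) else ∅

theorem mem_critTails {n : ℕ} {o : Option V} {b : V} {ℓ : ℕ} {w : List V} :
    w ∈ G.critTails n o b ℓ ↔ G.CritTail o b w ∧ w.length = n ∧ G.listLen (b :: w) = ℓ := by
  induction n generalizing o b ℓ w with
  | zero =>
    rw [critTails]
    constructor
    · intro h
      split_ifs at h with hℓ
      · obtain rfl := Finset.mem_singleton.1 h
        exact ⟨.nil o b, rfl, hℓ.symm⟩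
      · simp at h
    · rintro ⟨-, hw, hℓ⟩
      obtain rfl := List.length_eq_zero_iff.1 hw
      rw [if_pos (show ℓ = 0 from hℓ.symm), Finset.mem_singleton]
  | succ n ih =>
    simp only [critTails, Finset.mem_biUnion, Finset.mem_filter_univ]
    constructor
    · rintro ⟨c, hc, hw⟩
      split_ifs at hw with hle
      · obtain ⟨w, hw', rfl⟩ := Finset.mem_image.1 hw
        obtain ⟨h1, h2, h3⟩ := ih.1 hw'
        refine ⟨.cons hc h1, by simp [h2], ?_⟩
        rw [listLen]
        omega
      · simp at hw
    · rintro ⟨h1, h2, h3⟩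
      cases h1 with
      | nil => simp at h2
      | @cons _ _ c w hc h1 =>
        rw [listLen] at h3
        refine ⟨c, hc, ?_⟩
        rw [if_pos (by omega)]
        exact Finset.mem_image_of_mem _ (ih.2 ⟨h1, by simpa using h2, by omega⟩)

theorem card_critTails_succ (n : ℕ) (o : Option V) (b : V) (ℓ : ℕ) :
    (G.critTails (n + 1) o b ℓ).card = ∑ c ∈ Finset.univ.filter (G.MinSing o b),
      if G.dist b c ≤ ℓ then (G.critTails n (some b) c (ℓ - G.dist b c)).card else 0 := by
  rw [critTails, Finset.card_biUnion]
  · refine Finset.sum_congr rfl fun c _ => ?_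
    split_ifs
    · exact Finset.card_image_of_injective _ List.cons_injective
    · rfl
  · intro c _ c' _ hne
    rw [Function.onFun, Finset.disjoint_left]
    intro w hw hw'
    split_ifs at hw hw' <;> simp only [Finset.notMem_empty, Finset.mem_image] at hw hw'
    obtain ⟨_, _, rfl⟩ := hw
    obtain ⟨_, _, h⟩ := hw'
    exact hne (List.cons.inj h).1.symm

/-- The number of critical tails of degree `n` and length `ℓ` in a Moore graph; the flag tells
whether the next entry is an arbitrary neighbour of the current one. -/
def tailCount (D m : ℕ) : ℕ → Bool → ℕ → ℕ
  | 0, _, ℓ => if ℓ = 0 then 1 else 0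
  | n + 1, true, ℓ => if 1 ≤ ℓ then D * tailCount D m n false (ℓ - 1) else 0
  | n + 1, false, ℓ => (if 1 ≤ ℓ then tailCount D m n false (ℓ - 1) else 0) +
      if m ≤ ℓ then (D - 1) ^ m * tailCount D m n true (ℓ - m) else 0

theorem card_critTails (hG : G.Connected) {D m : ℕ} (hm : 1 < m) (hg : 2 * m < G.girth)
    (hdiam : ∀ x y : V, G.dist x y ≤ m)
    (hreg : ∀ x, (Finset.univ.filter (G.Adj x)).card = D) (n ℓ : ℕ) :
    (∀ o b, (∀ c, G.MinSing o b c ↔ G.Adj b c) →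
      (G.critTails n o b ℓ).card = tailCount D m n true ℓ) ∧
    (∀ a b, G.Adj a b → (G.critTails n (some a) b ℓ).card = tailCount D m n false ℓ) := by
  induction n generalizing ℓ with
  | zero =>
    simp only [critTails, tailCount]
    split_ifs <;> simp
  | succ n ih =>
    constructor
    · intro o b h
      rw [card_critTails_succ, Finset.filter_congr fun c _ => h c, tailCount,
        Finset.sum_congr rfl (g := fun _ => if 1 ≤ ℓ then tailCount D m n false (ℓ - 1) else 0),
        Finset.sum_const, hreg, smul_eq_mul, mul_ite, mul_zero]
      intro c hc
      rw [Finset.mem_filter_univ] at hc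
      rw [dist_eq_one_iff_adj.2 hc, (ih (ℓ - 1)).2 b c hc]
    · intro a b hab
      have hba : G.dist b a = 1 := dist_eq_one_iff_adj.2 hab.symm
      have hfilter : Finset.univ.filter (G.MinSing (some a) b) =
          insert a (Finset.univ.filter fun c => G.dist b c = m ∧ m ≤ G.dist a c) := by
        ext c
        rw [Finset.mem_filter_univ, Finset.mem_insert, Finset.mem_filter_univ,
          minSing_iff_of_adj hG hg hdiam hab]
      rw [card_critTails_succ, hfilter, Finset.sum_insert (by simp [hba]; omega), hba,
        (ih (ℓ - 1)).2 b a hab.symm, tailCount,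
        Finset.sum_congr rfl (g := fun _ => if m ≤ ℓ then tailCount D m n true (ℓ - m) else 0),
        Finset.sum_const, card_shell hG hg hreg le_rfl hab, smul_eq_mul, mul_ite, mul_zero]
      intro c hc
      rw [Finset.mem_filter_univ] at hc
      rw [hc.1, (ih (ℓ - m)).1 (some b) c fun e => minSing_iff_of_dist_eq hG hdiam hc.1]

theorem card_critTuples (hG : G.Connected) {D m : ℕ} (hm : 1 < m) (hg : 2 * m < G.girth)
    (hdiam : ∀ x y : V, G.dist x y ≤ m)
    (hreg : ∀ x, (Finset.univ.filter (G.Adj x)).card = D) (n ℓ : ℕ) :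
    (G.critTuples n ℓ).ncard = Fintype.card V * tailCount D m n true ℓ := by
  have hset : G.ListCrit ∩ G.listCells ℓ n = (Finset.univ.biUnion fun b =>
      (G.critTails n none b ℓ).image (List.cons b) : Finset (List V)) := by
    ext s
    simp only [Finset.coe_biUnion, Finset.coe_univ, Set.mem_univ, Set.iUnion_true, Set.mem_iUnion,
      Finset.coe_image, Set.mem_image, Finset.mem_coe, mem_critTails]
    constructor
    · rintro ⟨⟨x, w, rfl, h⟩, h1, h2⟩
      exact ⟨x, w, ⟨h, by simpa using h1, h2⟩, rfl⟩
    · rintro ⟨x, w, ⟨h, h1, h2⟩, rfl⟩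
      exact ⟨⟨x, w, rfl, h⟩, by simp [h1], h2⟩
  have himage : (List.ofFn : (Fin (n + 1) → V) → List V) '' G.critTuples n ℓ =
      G.ListCrit ∩ G.listCells ℓ n := by
    refine Set.image_preimage_eq_of_subset ?_
    rintro l ⟨-, hl, -⟩
    exact ⟨fun i => l.get (i.cast hl.symm), by
      apply List.ext_get <;> simp [hl, -List.ofFn_succ]⟩
  rw [← Set.ncard_image_of_injective _ List.ofFn_injective, himage, hset, Set.ncard_coe_finset,
    Finset.card_biUnion]
  · rw [Finset.sum_congr rfl fun b _ => (Finset.card_image_of_injective _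
      List.cons_injective).trans ((card_critTails hG hm hg hdiam hreg n ℓ).1 none b fun c =>
        minSing_none_iff hG), Finset.sum_const, smul_eq_mul, Finset.card_univ]
  · intro c _ c' _ hne
    rw [Function.onFun, Finset.disjoint_left]
    intro w hw hw'
    obtain ⟨_, _, rfl⟩ := Finset.mem_image.1 hw
    obtain ⟨_, _, h⟩ := Finset.mem_image.1 hw'
    exact hne (List.cons.inj h).1.symm

theorem free_and_finrank_grMH (hG : G.Connected) {D m : ℕ} (hm : 1 < m) (hg : 2 * m < G.girth)
    (hdiam : ∀ x y : V, G.dist x y ≤ m)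
    (hreg : ∀ x, (Finset.univ.filter (G.Adj x)).card = D) (n ℓ : ℕ) :
    Module.Free ℤ ((G.toQuasiMetric hG).grMH n ℓ) ∧
      Module.Finite ℤ ((G.toQuasiMetric hG).grMH n ℓ) ∧
      Module.finrank ℤ ((G.toQuasiMetric hG).grMH n ℓ) =
        Fintype.card V * tailCount D m n true ℓ := by
  obtain ⟨e⟩ := nonempty_grMH_equiv hG (isGeodetic_of_lt_girth hG hg hdiam) n ℓ
  refine ⟨Module.Free.of_equiv e.symm, Module.Finite.equiv e.symm, ?_⟩
  rw [e.finrank_eq, Module.finrank_finsupp_self, ← card_critTuples hG hm hg hdiam hreg,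
    ← Nat.card_eq_fintype_card, Nat.card_coe_set_eq]

theorem tailCount_succ_succ (D m n ℓ : ℕ) : tailCount D m (n + 2) true (ℓ + 1) =
    tailCount D m (n + 1) true ℓ +
      if m ≤ ℓ then D * (D - 1) ^ m * tailCount D m n true (ℓ - m) else 0 := by
  simp only [tailCount, Nat.le_add_left, if_true, Nat.add_sub_cancel, mul_add, mul_ite, mul_zero,
    mul_assoc]

theorem tailCount_add_two_zero (D m n : ℕ) : tailCount D m (n + 2) true 0 = 0 := by
  simp [tailCount]

theorem tailCount_one (D m ℓ : ℕ) : tailCount D m 1 true ℓ = if ℓ = 1 then D else 0 := by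
  rcases ℓ with _ | _ | ℓ <;> simp [tailCount]

theorem tailCount_eq_zero {D m n ℓ : ℕ}
    (h : ¬ ∃ i j : ℕ, n = 2 * i + j ∧ ℓ = (m + 1) * i + j) : tailCount D m n true ℓ = 0 := by
  induction n using Nat.strong_induction_on generalizing ℓ with
  | _ n ih =>
    match n, ℓ with
    | 0, ℓ =>
      refine if_neg ?_
      rintro rfl
      exact h ⟨0, 0, by simp, by simp⟩
    | 1, ℓ =>
      rw [tailCount_one, if_neg]
      rintro rfl
      exact h ⟨0, 1, by simp, by simp⟩
    | n + 2, 0 => exact tailCount_add_two_zero D m n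
    | n + 2, ℓ + 1 =>
      rw [tailCount_succ_succ, ih (n + 1) (by omega), zero_add]
      · split_ifs with hm
        · rw [ih n (by omega), mul_zero]
          rintro ⟨i, j, rfl, h2⟩
          exact h ⟨i + 1, j, by ring, by rw [mul_add, mul_one]; omega⟩
        · rfl
      · rintro ⟨i, j, h1, rfl⟩
        exact h ⟨i, j + 1, by omega, by ring⟩

/-- The coefficients of the rank formula. -/
def rankCoeff (D : ℕ) : ℕ → ℕ → ℕ
  | 0, 0 => 1
  | 0, _ + 1 => D
  | i + 1, j => (i + j).choose i + D * (i + j).choose (i + 1)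

theorem rankCoeff_succ_zero (D i : ℕ) : rankCoeff D (i + 1) 0 = rankCoeff D i 0 := by
  cases i <;> simp [rankCoeff]

theorem rankCoeff_succ_succ (D i j : ℕ) :
    rankCoeff D (i + 1) (j + 1) = rankCoeff D (i + 1) j + rankCoeff D i (j + 1) := by
  cases i with
  | zero =>
    simp [rankCoeff]
    ring
  | succ i =>
    simp only [rankCoeff]
    rw [show i + 1 + (j + 1) = i + j + 1 + 1 by ring, Nat.choose_succ_succ (i + j + 1) i,
      Nat.choose_succ_succ (i + j + 1) (i + 1), show i + 1 + j = i + j + 1 by ring,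
      show i + (j + 1) = i + j + 1 by ring]
    ring

theorem tailCount_eq {D m : ℕ} (hm : 1 < m) (i j : ℕ) :
    tailCount D m (2 * i + j) true ((m + 1) * i + j) =
      (D * (D - 1) ^ m) ^ i * rankCoeff D i j := by
  induction i generalizing j with
  | zero =>
    simp only [mul_zero, zero_add, pow_zero, one_mul]
    induction j with
    | zero => simp [tailCount, rankCoeff]
    | succ j ih =>
      cases j with
      | zero => simp [tailCount_one, rankCoeff]
      | succ j =>
        rw [tailCount_succ_succ, ih]
        split_ifs
        · rw [tailCount_eq_zero, mul_zero, add_zero]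
          · rfl
          · rintro ⟨i', j', h1, h2⟩
            have : 2 * i' ≤ (m + 1) * i' := Nat.mul_le_mul_right _ (by omega)
            omega
        · rfl
  | succ i ih =>
    have key (j : ℕ) : tailCount D m (2 * (i + 1) + j) true ((m + 1) * (i + 1) + j) =
        tailCount D m (2 * i + 1 + j) true ((m + 1) * i + m + j) +
          (D * (D - 1) ^ m) ^ (i + 1) * rankCoeff D i j := by
      rw [show 2 * (i + 1) + j = 2 * i + j + 2 by ring,
        show (m + 1) * (i + 1) + j = (m + 1) * i + m + j + 1 by ring, tailCount_succ_succ,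
        if_pos (by omega), show (m + 1) * i + m + j - m = (m + 1) * i + j by omega, ih,
        show 2 * i + j + 1 = 2 * i + 1 + j by ring, pow_succ]
      ring
    induction j with
    | zero =>
      rw [key, tailCount_eq_zero, zero_add, rankCoeff_succ_zero]
      rintro ⟨i', j', h1, h2⟩
      have h3 : i' ≤ i := by omega
      obtain ⟨r, rfl⟩ := Nat.exists_eq_add_of_le h3
      have h4 : 2 * r ≤ (m + 1) * r := Nat.mul_le_mul_right _ (by omega)
      rw [mul_add] at h2
      omega
    | succ j ihj =>
      rw [key, show 2 * i + 1 + (j + 1) = 2 * (i + 1) + j by ring,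
        show (m + 1) * i + m + (j + 1) = (m + 1) * (i + 1) + j by ring, ihj, rankCoeff_succ_succ]
      ring

theorem rankCoeff_eq_intC (D i j : ℕ) : (rankCoeff D i j : ℤ) =
    intC ((i : ℤ) + j - 1) ((i : ℤ) - 1) + D * intC ((i : ℤ) + j - 1) (i : ℤ) := by
  match i, j with
  | 0, 0 => simp [rankCoeff, intC]
  | 0, j + 1 => simp [rankCoeff, intC]
  | i + 1, j =>
    have h1 : ((i + 1 : ℕ) : ℤ) + j - 1 = ((i + j : ℕ) : ℤ) := by push_cast; ring
    have h2 : ((i + 1 : ℕ) : ℤ) - 1 = (i : ℤ) := by push_cast; ring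
    have h (s t : ℕ) : intC (s : ℤ) (t : ℤ) = s.choose t := by
      rw [intC]
      by_cases h3 : s < t
      · rw [if_pos (by omega), if_neg (by omega), Nat.choose_eq_zero_of_lt h3, Nat.cast_zero]
      · rw [if_neg (by omega), Int.toNat_natCast, Int.toNat_natCast]
    rw [h1, h2, h, h, rankCoeff]
    push_cast
    ring

end SimpleGraph

/-- **Statement 13.** Let `G` be a Moore graph of degree `D` and diameter `m > 1`
(connected, `D`-regular, diameter `m`, girth `2m+1`) on `N` vertices, regarded as a metric
space via the shortest path metric. Then every magnitude homology group `MH_n^ℓ(G)` is a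
free `ℤ`-module, it vanishes unless `(n, ℓ) = (2i+j, (m+1)i+j)` for some `i, j ≥ 0`, in
which case its rank is `N·(D(D-1)^m)^i·(C(i+j-1, i-1) + D·C(i+j-1, i))`; equivalently, the
rank function satisfies the recurrence
`R(n,ℓ) = R(n-1,ℓ-1) + D(D-1)^m·R(n-2,ℓ-m-1)` with `R(0,0) = N`, `R(1,1) = ND`,
and `R(n,ℓ) = 0` for `n < 0` or `ℓ < 0`. -/
theorem magnitude_homology_mooreGraph
    {V : Type} [Fintype V] [DecidableEq V] (G : SimpleGraph V) [DecidableRel G.Adj]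
    (hconn : G.Connected) (D m : ℕ) (hm : 1 < m)
    (hreg : G.IsRegularOfDegree D)
    (hdiam_le : ∀ x y : V, G.dist x y ≤ m) (hdiam : ∃ x y : V, G.dist x y = m)
    (hgirth : G.girth = 2 * m + 1) :
    (∀ n ℓ : ℕ, Module.Free ℤ ((G.toQuasiMetric hconn).grMH n (ℓ : ℝ≥0∞))) ∧
    (∀ n ℓ : ℕ, (¬ ∃ i j : ℕ, n = 2 * i + j ∧ ℓ = (m + 1) * i + j) →
      Subsingleton ((G.toQuasiMetric hconn).grMH n (ℓ : ℝ≥0∞))) ∧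
    (∀ i j : ℕ,
      (Module.finrank ℤ
          ((G.toQuasiMetric hconn).grMH (2 * i + j) (((m + 1) * i + j : ℕ) : ℝ≥0∞)) : ℤ) =
        (Fintype.card V : ℤ) * ((D : ℤ) * ((D : ℤ) - 1) ^ m) ^ i *
          (intC ((i : ℤ) + j - 1) ((i : ℤ) - 1) + (D : ℤ) * intC ((i : ℤ) + j - 1) (i : ℤ))) ∧
    (∃ R : ℤ → ℤ → ℤ,
      (∀ n ℓ : ℕ,
        R n ℓ = Module.finrank ℤ ((G.toQuasiMetric hconn).grMH n (ℓ : ℝ≥0∞))) ∧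
      (∀ n ℓ : ℤ, n < 0 ∨ ℓ < 0 → R n ℓ = 0) ∧
      R 0 0 = (Fintype.card V : ℤ) ∧
      R 1 1 = (Fintype.card V : ℤ) * D ∧
      (∀ n ℓ : ℤ, 0 ≤ n → 0 ≤ ℓ → ¬(n = 0 ∧ ℓ = 0) → ¬(n = 1 ∧ ℓ = 1) →
        R n ℓ = R (n - 1) (ℓ - 1) +
          (D : ℤ) * ((D : ℤ) - 1) ^ m * R (n - 2) (ℓ - (m : ℤ) - 1))) := by
  have hg : 2 * m < G.girth := by omega
  have hcard (x : V) : (@Finset.filter V (G.Adj x)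
      (fun _ => Classical.propDecidable _) Finset.univ).card = D := by
    rw [← hreg x, ← SimpleGraph.card_neighborFinset_eq_degree]
    congr 1
    ext y
    simp
  have hD : 1 ≤ D := by
    obtain ⟨x, y, hxy⟩ := hdiam
    obtain ⟨z, hz, -⟩ := SimpleGraph.exists_adj_dist_eq hconn
      (show G.dist x y = (m - 1) + 1 by omega)
    rw [← hcard x]
    exact Finset.card_pos.2 ⟨z, by simpa using hz⟩
  have hmain := SimpleGraph.free_and_finrank_grMH hconn hm hg hdiam_le hcard
  have hDcast : (((D - 1 : ℕ)) : ℤ) = (D : ℤ) - 1 := by push_cast [hD]; rfl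
  refine ⟨fun n ℓ => (hmain n ℓ).1, fun n ℓ h => ?_, fun i j => ?_, ?_⟩
  · obtain ⟨_, _, h3⟩ := hmain n ℓ
    rw [SimpleGraph.tailCount_eq_zero h, mul_zero] at h3
    exact Module.finrank_zero_iff.1 h3
  · rw [(hmain _ _).2.2, SimpleGraph.tailCount_eq hm]
    push_cast
    rw [hDcast, SimpleGraph.rankCoeff_eq_intC]
    ring
  · let R : ℤ → ℤ → ℤ := fun n ℓ => if n < 0 ∨ ℓ < 0 then 0 else
      Fintype.card V * SimpleGraph.tailCount D m n.toNat true ℓ.toNat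
    have hR (n ℓ : ℕ) : R n ℓ = Fintype.card V * SimpleGraph.tailCount D m n true ℓ := by
      simp only [R]
      rw [if_neg (by omega), Int.toNat_natCast, Int.toNat_natCast]
    have hneg (n ℓ : ℤ) (h : n < 0 ∨ ℓ < 0) : R n ℓ = 0 := if_pos h
    refine ⟨R, fun n ℓ => ?_, hneg, ?_, ?_, fun n ℓ hn hℓ h0 h1 => ?_⟩
    · rw [hR, (hmain n ℓ).2.2, Nat.cast_mul]
    · simpa [SimpleGraph.tailCount] using hR 0 0
    · simpa [SimpleGraph.tailCount_one] using hR 1 1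
    · lift n to ℕ using hn
      lift ℓ to ℕ using hℓ
      match n, ℓ with
      | 0, 0 => simp at h0
      | 0, ℓ + 1 =>
        rw [hR, hneg (_ - 1) _ (Or.inl (by omega)), hneg (_ - 2) _ (Or.inl (by omega))]
        simp [SimpleGraph.tailCount]
      | n + 1, 0 =>
        rw [hR, hneg _ (_ - 1) (Or.inr (by omega)), hneg _ (_ - _ - 1) (Or.inr (by omega))]
        simp [SimpleGraph.tailCount]
      | 1, ℓ + 1 =>
        have hl : ℓ ≠ 0 := by
          rintro rfl
          simp at h1
        rw [hneg (_ - 2) _ (Or.inl (by simp)), hR, SimpleGraph.tailCount_one, if_neg (by omega),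
          show (((1 : ℕ) : ℤ) - 1) = ((0 : ℕ) : ℤ) by simp,
          show (((ℓ + 1 : ℕ) : ℤ) - 1) = (ℓ : ℤ) by simp, hR]
        simp [SimpleGraph.tailCount, hl]
      | n + 2, ℓ + 1 =>
        rw [hR, SimpleGraph.tailCount_succ_succ,
          show (((n + 2 : ℕ) : ℤ) - 1) = ((n + 1 : ℕ) : ℤ) by push_cast; ring,
          show (((n + 2 : ℕ) : ℤ) - 2) = (n : ℤ) by push_cast; ring,
          show (((ℓ + 1 : ℕ) : ℤ) - 1) = (ℓ : ℤ) by simp, hR]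
        split_ifs with hle
        · rw [show (((ℓ + 1 : ℕ) : ℤ) - m - 1) = ((ℓ - m : ℕ) : ℤ) by omega, hR]
          push_cast
          rw [hDcast]
          ring
        · rw [hneg _ _ (Or.inr (by omega))]
          simp
end

section
/- Let G be a finite connected simple graph with vertex set V(G), of diameter k, that is distance regular in the sense that for every ℓ ≥ 0 the number D_ℓ = |{y ∈ V(G) : d(x,y) = ℓ}| is independent of the vertex x. Let q be the variable of the field ℚ(q) of rational functions over ℚ. If w : V(G) → ℚ(q) satisfies Σ_{i ∈ V(G)} q^{d(j,i)}·w(i) = 1 for every vertex j, then for every vertex x, Σ_{i ∈ V(G)} w(i) = |V(G)| / Σ_{y ∈ V(G)} q^{d(x,y)} = |V(G)| / Σ_{ℓ=0}^{k} D_ℓ·q^ℓ. -/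
open scoped Classical

theorem SimpleGraph.sum_pow_dist_eq_sum_range {V R : Type*} [Fintype V] [CommSemiring R]
    (G : SimpleGraph V) (k : ℕ) (D : ℕ → ℕ) (x : V) (hk : ∀ y : V, G.dist x y ≤ k)
    (hD : ∀ ℓ : ℕ, (Finset.univ.filter fun y : V => G.dist x y = ℓ).card = D ℓ) (q : R) :
    ∑ y : V, q ^ G.dist x y = ∑ ℓ ∈ Finset.range (k + 1), (D ℓ : R) * q ^ ℓ := by
  rw [← Finset.sum_fiberwise_of_maps_to (t := Finset.range (k + 1)) (g := G.dist x)
    fun y _ => Finset.mem_range_succ_iff.2 (hk y)]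
  refine Finset.sum_congr rfl fun ℓ _ => ?_
  rw [← hD ℓ, ← nsmul_eq_mul]
  exact Finset.sum_eq_card_nsmul fun y hy => by rw [(Finset.mem_filter.1 hy).2]

/-- Summing the weighting equations over all vertices when the row sums are constant. -/
theorem SimpleGraph.sum_weighting_mul_eq_card {V R : Type*} [Fintype V] [CommSemiring R]
    (G : SimpleGraph V) (q S : R) (hS : ∀ x : V, ∑ y : V, q ^ G.dist x y = S)
    (w : V → R) (hw : ∀ j : V, ∑ i : V, q ^ G.dist j i * w i = 1) :
    (∑ i : V, w i) * S = Fintype.card V := by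
  calc (∑ i : V, w i) * S = ∑ i : V, ∑ j : V, q ^ G.dist j i * w i := by
        rw [Finset.sum_mul]
        refine Finset.sum_congr rfl fun i _ => ?_
        simp_rw [← Finset.sum_mul, G.dist_comm (v := i), hS, mul_comm]
    _ = ∑ j : V, ∑ i : V, q ^ G.dist j i * w i := Finset.sum_comm
    _ = Fintype.card V := by simp [hw]

/-- **Statement 15.** Let `G` be a finite connected simple graph of diameter `k` that is
distance regular: the number `D ℓ` of vertices at distance `ℓ` from a vertex does not
depend on the vertex. If `w : V(G) → ℚ(q)` is a magnitude weighting, i.e.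
`Σ_i q^{d(j,i)}·w(i) = 1` for every vertex `j`, then for every vertex `x`,
`Σ_i w(i) = |V(G)| / Σ_y q^{d(x,y)} = |V(G)| / Σ_{ℓ=0}^k D_ℓ q^ℓ`. -/
theorem magnitude_of_distance_regular_graph
    {V : Type} [Fintype V] (G : SimpleGraph V) (hconn : G.Connected)
    (k : ℕ) (hdiam_le : ∀ x y : V, G.dist x y ≤ k) (hdiam : ∃ x y : V, G.dist x y = k)
    (D : ℕ → ℕ)
    (hdr : ∀ (x : V) (ℓ : ℕ), (Finset.univ.filter fun y : V => G.dist x y = ℓ).card = D ℓ)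
    (w : V → RatFunc ℚ)
    (hw : ∀ j : V, ∑ i : V, (RatFunc.X : RatFunc ℚ) ^ (G.dist j i) * w i = 1) :
    ∀ x : V,
      (∑ i : V, w i) =
        (Fintype.card V : RatFunc ℚ) / (∑ y : V, (RatFunc.X : RatFunc ℚ) ^ (G.dist x y)) ∧
      (∑ i : V, w i) =
        (Fintype.card V : RatFunc ℚ) /
          (∑ ℓ ∈ Finset.range (k + 1), (D ℓ : RatFunc ℚ) * (RatFunc.X : RatFunc ℚ) ^ ℓ) := by
  intro x
  have hS := fun z => G.sum_pow_dist_eq_sum_range k D z (hdiam_le z) (hdr z) (RatFunc.X : RatFunc ℚ)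
  have hmul := G.sum_weighting_mul_eq_card _ _ hS w hw
  have : Nonempty V := ⟨x⟩
  have hcard : (Fintype.card V : RatFunc ℚ) ≠ 0 := Nat.cast_ne_zero.2 Fintype.card_ne_zero
  have hne := right_ne_zero_of_mul (hmul ▸ hcard)
  rw [hS x, and_self]
  exact eq_div_of_mul_eq hne hmul
end

section
/- Let m ≥ 3, N = 2m, and let C_N be the cycle graph with N vertices, regarded as a metric space with the shortest path metric. Then: (1) MH_n^ℓ(C_N) ≠ 0 if and only if (n, ℓ) = (2i + j, mi + j) for some integers i, j ≥ 0; (2) for each i ≥ 0, MH_{2i}^{mi}(C_N) is a free ℤ-module of rank N; (3) for each i ≥ 0 and j > 0, MH_{2i+j}^{mi+j}(C_N) is a free ℤ-module of rank 2N. -/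
open scoped ENNReal NNReal

attribute [local instance] Classical.propDecidable

lemma cycleGraph_connected_of_pos (N : ℕ) (hN : 0 < N) :
    (SimpleGraph.cycleGraph N).Connected := by
  obtain ⟨k, hk⟩ : ∃ k, N = k + 1 := ⟨N - 1, by omega⟩
  rw [hk]
  exact SimpleGraph.cycleGraph_connected

/-- The cycle graph `C_N` as a quasi metric space (shortest path metric). -/
noncomputable def cycleQM (N : ℕ) (hN : 0 < N) : QuasiMetric (Fin N) :=
  (SimpleGraph.cycleGraph N).toQuasiMetric (cycleGraph_connected_of_pos N hN)


namespace EvenCycle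

/-- Chains of step words. -/
abbrev WChain : Type := List ℤ →₀ ℤ

/-- Prepending a letter. -/
noncomputable def consL (a : ℤ) : WChain →ₗ[ℤ] WChain := Finsupp.lmapDomain ℤ ℤ (List.cons a)

/-- Two nonzero steps along a common geodesic. -/
def Mrg (m a b : ℤ) : Prop := (0 < a ∧ 0 < b ∧ a + b ≤ m) ∨ (a < 0 ∧ b < 0 ∧ -m ≤ a + b)

/-- The composite of two mergeable steps, normalized to `[-m, m)`. -/
noncomputable def mu (m a b : ℤ) : ℤ := if a + b = m then -m else a + b

/-- Signed contraction of a letter with the head of a word. -/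
noncomputable def nuW (m a : ℤ) : List ℤ → WChain
  | [] => 0
  | b :: w => if Mrg m a b then -Finsupp.single (mu m a b :: w) 1
      else if a = 0 ∧ b = 0 then Finsupp.single (0 :: w) 1 else 0

/-- Linear extension of `nuW`. -/
noncomputable def nu (m a : ℤ) : WChain →ₗ[ℤ] WChain := Finsupp.linearCombination ℤ (nuW m a)

/-- The magnitude boundary of a step word. -/
noncomputable def gamW (m : ℤ) : List ℤ → WChain
  | [] => 0
  | a :: w => nuW m a w - consL a (gamW m w)

/-- Linear extension of `gamW`. -/
noncomputable def gam (m : ℤ) : WChain →ₗ[ℤ] WChain := Finsupp.linearCombination ℤ (gamW m)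

/-- Chains supported on words satisfying `P`. -/
noncomputable def supp (P : List ℤ → Prop) : Submodule ℤ WChain := Finsupp.supported ℤ ℤ {w | P w}

lemma mem_supp {P : List ℤ → Prop} {x : WChain} : x ∈ supp P ↔ ∀ w, x w ≠ 0 → P w := by
  simp [supp, Finsupp.mem_supported, Set.subset_def]

lemma single_mem_supp {P : List ℤ → Prop} {w : List ℤ} (h : P w) (c : ℤ) :
    Finsupp.single w c ∈ supp P := Finsupp.single_mem_supported ℤ c h

lemma supp_eq_span (P : List ℤ → Prop) :
    supp P = Submodule.span ℤ ((fun w => Finsupp.single w (1 : ℤ)) '' {w | P w}) :=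
  Finsupp.supported_eq_span_single ℤ _

lemma supp_mono {P Q : List ℤ → Prop} (h : ∀ w, P w → Q w) : supp P ≤ supp Q :=
  Finsupp.supported_mono h

lemma map_mem_supp {P : List ℤ → Prop} {N : Submodule ℤ WChain} (f : WChain →ₗ[ℤ] WChain)
    (h : ∀ w, P w → f (Finsupp.single w 1) ∈ N) {x : WChain} (hx : x ∈ supp P) : f x ∈ N := by
  rw [supp_eq_span] at hx
  refine (Submodule.span_le (p := N.comap f)).2 ?_ hx
  rintro _ ⟨w, hw, rfl⟩
  exact h w hw

lemma eq_on_supp {P : List ℤ → Prop} (f g : WChain →ₗ[ℤ] WChain)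
    (h : ∀ w, P w → f (Finsupp.single w 1) = g (Finsupp.single w 1)) {x : WChain}
    (hx : x ∈ supp P) : f x = g x := by
  rw [supp_eq_span] at hx
  refine LinearMap.eqOn_span (f := f) (g := g) ?_ hx
  rintro _ ⟨w, hw, rfl⟩
  exact h w hw

lemma mem_supp_true (x : WChain) : x ∈ supp fun _ => True := mem_supp.2 fun _ _ => trivial

@[simp] lemma consL_single (a : ℤ) (w : List ℤ) (c : ℤ) :
    consL a (Finsupp.single w c) = Finsupp.single (a :: w) c := by
  simp [consL]

@[simp] lemma nu_single (m a : ℤ) (w : List ℤ) : nu m a (Finsupp.single w 1) = nuW m a w := by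
  simp [nu]

@[simp] lemma gam_single (m : ℤ) (w : List ℤ) : gam m (Finsupp.single w 1) = gamW m w := by
  simp [gam]

lemma consL_mem {P Q : List ℤ → Prop} {a : ℤ} (h : ∀ w, P w → Q (a :: w)) {x : WChain}
    (hx : x ∈ supp P) : consL a x ∈ supp Q :=
  map_mem_supp _ (fun w hw => by simpa using single_mem_supp (h w hw) 1) hx

lemma gam_consL (m a : ℤ) (x : WChain) : gam m (consL a x) = nu m a x - consL a (gam m x) := by
  refine eq_on_supp (gam m ∘ₗ consL a) (nu m a - consL a ∘ₗ gam m) (fun w _ => ?_)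
    (mem_supp_true x)
  simp [gamW]

lemma nu_consL_eq (m a b : ℤ) (x : WChain) :
    nu m a (consL b x) = if Mrg m a b then -consL (mu m a b) x
      else if a = 0 ∧ b = 0 then consL 0 x else 0 := by
  refine eq_on_supp (nu m a ∘ₗ consL b) (if Mrg m a b then -consL (mu m a b)
      else if a = 0 ∧ b = 0 then consL 0 else 0) (fun w _ => ?_)
    (mem_supp_true x) |>.trans ?_
  · simp only [LinearMap.comp_apply, consL_single, nu_single, nuW]
    split_ifs <;> simp
  · split_ifs <;> simp

lemma nu_nuW (m : ℤ) (hm : 3 ≤ m) (a b : ℤ) (w : List ℤ) :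
    nu m a (nuW m b w) = if Mrg m a b then -nuW m (mu m a b) w
      else if a = 0 ∧ b = 0 then nuW m 0 w else 0 := by
  cases w with
  | nil => simp [nuW]
  | cons c w =>
    simp only [nuW]
    by_cases hbc : Mrg m b c
    · have h0 : ¬ (a = 0 ∧ b = 0) := by unfold Mrg at hbc; omega
      rw [if_pos hbc, map_neg, nu_single, if_neg h0]
      simp only [nuW]
      by_cases hab : Mrg m a b
      · have e1 : Mrg m (mu m a b) c ↔ Mrg m a (mu m b c) := by
          unfold Mrg mu at *; split_ifs <;> omega
        have e2 : Mrg m a (mu m b c) → mu m (mu m a b) c = mu m a (mu m b c) := by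
          unfold Mrg mu at *; split_ifs <;> omega
        have e3 : ¬ (a = 0 ∧ mu m b c = 0) := by unfold Mrg at hab; omega
        have e4 : ¬ (mu m a b = 0 ∧ c = 0) := by unfold Mrg at hbc; omega
        rw [if_pos hab]
        by_cases h : Mrg m a (mu m b c)
        · rw [if_pos h, if_pos (e1.2 h), e2 h]
        · rw [if_neg h, if_neg (fun h' => h (e1.1 h')), if_neg e3, if_neg e4]
      · have e1 : ¬ Mrg m a (mu m b c) := by
          unfold Mrg mu at *; split_ifs <;> omega
        have e3 : ¬ (a = 0 ∧ mu m b c = 0) := by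
          unfold Mrg mu at *; split_ifs <;> omega
        rw [if_neg hab, if_neg e1, if_neg e3, neg_zero]
    · rw [if_neg hbc]
      by_cases h0 : b = 0 ∧ c = 0
      · obtain ⟨rfl, rfl⟩ := h0
        have e1 : ¬ Mrg m a 0 := by unfold Mrg; omega
        have e2 : ¬ Mrg m 0 0 := by unfold Mrg; omega
        simp [e1, e2, nuW]
      · rw [if_neg h0, map_zero]
        by_cases hab : Mrg m a b
        · have e1 : ¬ Mrg m (mu m a b) c := by
            unfold Mrg mu at *; split_ifs <;> omega
          have e4 : ¬ (mu m a b = 0 ∧ c = 0) := by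
            unfold Mrg mu at *; split_ifs <;> omega
          rw [if_pos hab, if_neg e1, if_neg e4, neg_zero]
        · rw [if_neg hab]
          by_cases h1 : a = 0 ∧ b = 0
          · obtain ⟨rfl, rfl⟩ := h1
            have e2 : ¬ Mrg m 0 c := by unfold Mrg; omega
            have e3 : c ≠ 0 := by simpa using h0
            simp [e2, e3]
          · rw [if_neg h1]

lemma gam_gamW (m : ℤ) (hm : 3 ≤ m) (w : List ℤ) : gam m (gamW m w) = 0 := by
  induction w with
  | nil => simp [gamW]
  | cons a w ih =>
    rw [gamW, map_sub, gam_consL, ih, map_zero, sub_zero, sub_eq_zero]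
    cases w with
    | nil => simp [nuW, gamW]
    | cons b v =>
      rw [gamW, map_sub, nu_nuW m hm, nu_consL_eq, nuW]
      split_ifs <;> simp [gamW]
      abel

lemma gam_gam (m : ℤ) (hm : 3 ≤ m) (x : WChain) : gam m (gam m x) = 0 :=
  eq_on_supp (gam m ∘ₗ gam m) 0 (fun w _ => by simpa using gam_gamW m hm w) (mem_supp_true x)


/-- States of the automaton reading step words: `s` is the initial state, `n` and `p` follow a
positive resp. negative step of an alternating word, and `q` follows a first positive step. -/
inductive St
  | s | n | p | q

/-- The three classes of cells of the matching: lower cells, upper cells, critical cells. -/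
inductive Cls
  | u | d | k

/-- Transitions along critical letters. -/
noncomputable def tr (m : ℤ) : St → ℤ → Option St
  | .s, a => if a = -1 then some .p else if a = 1 then some .q else none
  | .n, a => if a = -1 then some .p else none
  | .p, a => if a = 1 then some .n else none
  | .q, a => if a = -1 then some .p else if a = m - 1 then some .s else none

/-- Letters that the matching splits into two. -/
def Up (m : ℤ) : St → ℤ → Prop
  | .s, a => (-m ≤ a ∧ a ≤ -2) ∨ (2 ≤ a ∧ a < m)
  | .n, a => -m ≤ a ∧ a ≤ -2
  | .p, a => a = -m ∨ (2 ≤ a ∧ a < m)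
  | .q, a => -m ≤ a ∧ a ≤ -2

/-- First part of a split letter. -/
noncomputable def spl : St → ℤ → ℤ
  | .p, _ => 1
  | _, a => if a < 0 then -1 else 1

/-- Second part of a split letter. -/
noncomputable def rem (m : ℤ) (X : St) (a : ℤ) : ℤ :=
  if a - spl X a = -m - 1 then m - 1 else a - spl X a

/-- Letters that may be read in a given state. -/
def Adm (m : ℤ) : St → ℤ → Prop
  | .s, _ => True
  | .p, b => ¬ (-m < b ∧ b < 0)
  | .n, b => ¬ (0 < b ∧ b < m)
  | .q, b => ¬ (0 < b ∧ b < m - 1)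

/-- Words whose first letter may be read in a given state. -/
def AdmW (m : ℤ) (X : St) : List ℤ → Prop
  | [] => True
  | b :: _ => Adm m X b

/-- Priority of a letter. -/
noncomputable def rank : St → ℤ → ℕ
  | .p, a => if a = 1 then 0 else 1
  | _, a => if a = -1 then 0 else if a < 0 then 1 else if a = 1 then 2 else 3

/-- Whether the number of leading zeros is odd. -/
def ZOdd : List ℤ → Prop
  | [] => False
  | a :: w => a = 0 ∧ ¬ ZOdd w

/-- Class of a word read from a given state. -/
noncomputable def cls (m : ℤ) : St → List ℤ → Cls
  | _, [] => .k
  | X, a :: w => if a = 0 then (if ZOdd w then .d else .u) else if Up m X a then .u else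
      match tr m X a with
      | none => .k
      | some Y => if AdmW m Y w then cls m Y w else .d

/-- Base-four weight of a word, by which the matching is triangular. -/
noncomputable def val (m : ℤ) : St → List ℤ → ℕ
  | _, [] => 0
  | X, a :: w => rank X a * 4 ^ w.length + match tr m X a with
      | none => 0
      | some Y => val m Y w

/-- The matching, with signs. -/
noncomputable def vW (m : ℤ) : St → List ℤ → WChain
  | _, [] => 0
  | X, a :: w => if a = 0 then (if ZOdd w then 0 else Finsupp.single (0 :: 0 :: w) 1)
      else if Up m X a then -Finsupp.single (spl X a :: rem m X a :: w) 1 else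
      match tr m X a with
      | none => 0
      | some Y => if AdmW m Y w then -consL a (vW m Y w) else 0

section Letters

variable {m : ℤ} {X Y : St} {a b : ℤ}

lemma Up.ne_zero (hm : 3 ≤ m) (h : Up m X a) : a ≠ 0 := by
  cases X <;> simp only [Up] at h <;> omega

lemma tr_ne_zero (hm : 3 ≤ m) (h : tr m X a = some Y) : a ≠ 0 := by
  rintro rfl
  have : m - 1 ≠ 0 := by omega
  cases X <;> simp [tr] at h
  omega

lemma tr_not_up (hm : 3 ≤ m) (h : tr m X a = some Y) : ¬ Up m X a := by
  cases X <;> simp only [tr, Up] at h ⊢ <;> split_ifs at h <;> omega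

lemma Up.mrg (hm : 3 ≤ m) (h : Up m X a) :
    Mrg m (spl X a) (rem m X a) ∧ mu m (spl X a) (rem m X a) = a := by
  cases X <;> simp only [Up, Mrg, mu, rem, spl] at h ⊢ <;> split_ifs <;> omega

lemma Up.adm_spl (h : Up m X a) (ha : Adm m X a) : Adm m X (spl X a) := by
  cases X <;> simp only [Up, spl, Adm] at h ha ⊢ <;> (try split_ifs) <;> omega

lemma Up.rank_spl (hm : 3 ≤ m) (h : Up m X a) (ha : Adm m X a) :
    rank X (spl X a) < rank X a := by
  cases X <;> simp only [Up, spl, Adm, rank] at h ha ⊢ <;> split_ifs <;> omega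

lemma Up.tr_spl (hm : 3 ≤ m) (h : Up m X a) (ha : Adm m X a) :
    ∃ Y, tr m X (spl X a) = some Y ∧ ¬ Adm m Y (rem m X a) := by
  have h1 : (1 : ℤ) ≠ -1 := by norm_num
  cases X
  · by_cases h0 : a < 0
    · refine ⟨.p, ?_⟩
      simp only [Up, tr, spl, Adm, rem] at h ha ⊢
      split_ifs <;> first | omega | simp; omega
    · refine ⟨.q, ?_⟩
      simp only [Up, tr, spl, Adm, rem] at h ha ⊢
      split_ifs <;> first | omega | simp; omega
  · refine ⟨.p, ?_⟩
    simp only [Up, tr, spl, Adm, rem] at h ha ⊢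
    split_ifs <;> first | omega | simp; omega
  · refine ⟨.n, ?_⟩
    simp only [Up, tr, spl, Adm, rem] at h ha ⊢
    split_ifs <;> first | omega | simp; omega
  · refine ⟨.p, ?_⟩
    simp only [Up, tr, spl, Adm, rem] at h ha ⊢
    split_ifs <;> first | omega | simp; omega

lemma tr_mrg (hm : 3 ≤ m) (h : tr m X a = some Y) (ha : Adm m X a) (hb : Adm m Y b)
    (hab : Mrg m a b) : Adm m X (mu m a b) ∧ rank X (mu m a b) < rank X a := by
  cases X <;> simp only [tr] at h <;> split_ifs at h <;> cases h <;>
    simp only [Adm, Mrg, rank, mu, true_and] at * <;> split_ifs <;> omega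

lemma tr_not_adm (hm : 3 ≤ m) (h : tr m X a = some Y) (ha : Adm m X a) (hb : ¬ Adm m Y b) :
    Up m X (mu m a b) ∧ spl X (mu m a b) = a ∧ rem m X (mu m a b) = b ∧
      Adm m X (mu m a b) := by
  cases X <;> simp only [tr] at h <;> split_ifs at h <;> cases h <;>
    simp only [Adm, Up, spl, mu, rem, and_true, not_true_eq_false] at * <;>
    split_ifs <;> omega

lemma adm_mu (hm : 3 ≤ m) (ha : Adm m X a) (hab : Mrg m a b) : Adm m X (mu m a b) := by
  cases X <;> simp only [Adm, Mrg, mu] at * <;> split_ifs <;> omega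

lemma adm_zero : Adm m X 0 := by
  cases X <;> simp [Adm]

lemma rank_lt : rank X a < 4 := by
  cases X <;> simp only [rank] <;> split_ifs <;> omega

end Letters

lemma val_lt (m : ℤ) (X : St) (w : List ℤ) : val m X w < 4 ^ w.length := by
  induction w generalizing X with
  | nil => simp [val]
  | cons a w ih =>
    have h1 : rank X a * 4 ^ w.length ≤ 3 * 4 ^ w.length :=
      Nat.mul_le_mul_right _ (by have := @rank_lt X a; omega)
    simp only [val, List.length_cons, pow_succ]
    cases h : tr m X a with
    | none => have : 0 < 4 ^ w.length := by positivity
              simp only; omega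
    | some Y => have := ih Y; simp only; omega

lemma val_lt_of_rank {m : ℤ} {X : St} {a b : ℤ} {w w' : List ℤ} (h : rank X a < rank X b)
    (hl : w.length = w'.length) : val m X (a :: w) < val m X (b :: w') := by
  have h1 : (rank X a + 1) * 4 ^ w.length ≤ rank X b * 4 ^ w.length :=
    Nat.mul_le_mul_right _ h
  simp only [val, ← hl]
  have h2 : (match tr m X a with
      | none => 0
      | some Y => val m Y w) < 4 ^ w.length := by
    cases h : tr m X a with
    | none => simp
    | some Y => exact val_lt m Y w
  rw [add_mul, one_mul] at h1
  omega

lemma val_cons_lt {m : ℤ} {X Y : St} {a : ℤ} {w w' : List ℤ} (h : tr m X a = some Y)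
    (hl : w.length = w'.length) (hv : val m Y w < val m Y w') :
    val m X (a :: w) < val m X (a :: w') := by
  simp only [val, h, hl]; omega

lemma cls_cons {m : ℤ} (hm : 3 ≤ m) {X Y : St} {a : ℤ} {w : List ℤ} (h : tr m X a = some Y)
    (hw : AdmW m Y w) : cls m X (a :: w) = cls m Y w := by
  rw [cls, if_neg (tr_ne_zero hm h), if_neg (tr_not_up hm h), h]
  simp [hw]

lemma cls_cons_of_not_adm {m : ℤ} (hm : 3 ≤ m) {X Y : St} {a : ℤ} {w : List ℤ}
    (h : tr m X a = some Y) (hw : ¬ AdmW m Y w) : cls m X (a :: w) = .d := by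
  rw [cls, if_neg (tr_ne_zero hm h), if_neg (tr_not_up hm h), h]
  simp [hw]

lemma vW_cons {m : ℤ} (hm : 3 ≤ m) {X Y : St} {a : ℤ} {w : List ℤ} (h : tr m X a = some Y)
    (hw : AdmW m Y w) : vW m X (a :: w) = -consL a (vW m Y w) := by
  rw [vW, if_neg (tr_ne_zero hm h), if_neg (tr_not_up hm h), h]
  simp [hw]

/-- The lower cells in a given state: an odd run of zeros, a letter to be split, or a critical
letter followed by a lower cell. -/
lemma cls_u_cases {m : ℤ} {X : St} {w : List ℤ} (h : cls m X w = .u) :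
    (∃ r, w = 0 :: r ∧ ¬ ZOdd r) ∨ (∃ a r, w = a :: r ∧ a ≠ 0 ∧ Up m X a) ∨
      ∃ a r Y, w = a :: r ∧ tr m X a = some Y ∧ AdmW m Y r ∧ cls m Y r = .u := by
  cases w with
  | nil => simp [cls] at h
  | cons a r =>
    rw [cls] at h
    split_ifs at h with h1 h2 h3
    · exact Or.inl ⟨r, by rw [h1], h2⟩
    · exact Or.inr (Or.inl ⟨a, r, rfl, h1, h3⟩)
    · refine Or.inr (Or.inr ?_)
      cases hY : tr m X a with
      | none => simp [hY] at h
      | some Y =>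
        simp only [hY] at h
        split_ifs at h with h4
        exact ⟨a, r, Y, rfl, hY, h4, h⟩

lemma vW_zero {m : ℤ} {X : St} {r : List ℤ} (h : ¬ ZOdd r) :
    vW m X (0 :: r) = Finsupp.single (0 :: 0 :: r) 1 := by
  simp [vW, h]

lemma vW_up {m : ℤ} {X : St} {a : ℤ} {r : List ℤ} (h0 : a ≠ 0) (h : Up m X a) :
    vW m X (a :: r) = -Finsupp.single (spl X a :: rem m X a :: r) 1 := by
  simp [vW, h, h0]

lemma vW_eq_zero {m : ℤ} {X : St} {w : List ℤ} (h : cls m X w ≠ .u) : vW m X w = 0 := by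
  induction w generalizing X with
  | nil => rfl
  | cons a r ih =>
    rw [cls] at h
    rw [vW]
    split_ifs at h ⊢ with h1 h2 h3
    · rfl
    · simp at h
    · simp at h
    · cases hY : tr m X a with
      | none => rfl
      | some Y =>
        simp only [hY] at h ⊢
        split_ifs at h ⊢ with h4
        · rw [ih h, map_zero, neg_zero]
        · rfl

lemma vW_mem {m : ℤ} (hm : 3 ≤ m) {X : St} {w : List ℤ} (ha : AdmW m X w) :
    vW m X w ∈ supp fun w' => AdmW m X w' ∧ w'.length = w.length + 1 ∧ cls m X w' = .d := by
  induction w generalizing X with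
  | nil => exact Submodule.zero_mem _
  | cons a r ih =>
    by_cases hu : cls m X (a :: r) = .u
    · rcases cls_u_cases hu with ⟨r', h, hr⟩ | ⟨a', r', h, h0, hup⟩ | ⟨a', r', Y, h, hY, hr, -⟩
      · cases h
        rw [vW_zero hr]
        refine single_mem_supp ⟨adm_zero, rfl, ?_⟩ _
        simp [cls, ZOdd, hr]
      · cases h
        rw [vW_up h0 hup]
        refine Submodule.neg_mem _ (single_mem_supp ⟨hup.adm_spl ha, rfl, ?_⟩ _)
        obtain ⟨Y, hY, hn⟩ := hup.tr_spl hm ha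
        exact cls_cons_of_not_adm hm hY hn
      · cases h
        rw [vW_cons hm hY hr]
        refine Submodule.neg_mem _ (consL_mem ?_ (ih hr))
        rintro w ⟨h1, h2, h3⟩
        exact ⟨ha, by simp [h2], by rw [cls_cons hm hY h1, h3]⟩
    · rw [vW_eq_zero hu]; exact Submodule.zero_mem _

lemma exists_vW {m : ℤ} (hm : 3 ≤ m) {X : St} {w : List ℤ} (ha : AdmW m X w)
    (h : cls m X w = .d) : ∃ u, AdmW m X u ∧ cls m X u = .u ∧
      ∃ c : ℤ, Finsupp.single w 1 = c • vW m X u := by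
  induction w generalizing X with
  | nil => simp [cls] at h
  | cons a r ih =>
    rw [cls] at h
    split_ifs at h with h1 h2 h3
    · cases r with
      | nil => simp [ZOdd] at h2
      | cons b r =>
        obtain ⟨rfl, h2⟩ := h2
        subst h1
        exact ⟨0 :: r, adm_zero, by simp [cls, h2], 1, by simp [vW_zero h2]⟩
    · cases hY : tr m X a with
      | none => simp [hY] at h
      | some Y =>
        simp only [hY] at h
        split_ifs at h with h4
        · obtain ⟨u, hu, hc, c, hv⟩ := ih h4 h
          refine ⟨a :: u, ha, by rw [cls_cons hm hY hu, hc], -c, ?_⟩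
          rw [vW_cons hm hY hu, smul_neg, neg_smul, neg_neg, ← map_smul, ← hv, consL_single]
        · cases r with
          | nil => exact absurd trivial h4
          | cons b r =>
            obtain ⟨h5, h6, h7, h8⟩ := tr_not_adm hm hY ha h4
            refine ⟨mu m a b :: r, h8, ?_, -1, ?_⟩
            · simp [cls, h5.ne_zero hm, h5]
            · rw [vW_up (h5.ne_zero hm) h5, h6, h7]; simp

lemma gamW_mem {m : ℤ} (hm : 3 ≤ m) {X : St} {w : List ℤ} (ha : AdmW m X w) :
    gamW m w ∈ supp fun w' => AdmW m X w' ∧ w'.length + 1 = w.length := by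
  induction w generalizing X with
  | nil => exact Submodule.zero_mem _
  | cons a r ih =>
    rw [gamW]
    refine Submodule.sub_mem _ ?_ (consL_mem ?_ (ih (X := .s) (by cases r <;> trivial)))
    · cases r with
      | nil => exact Submodule.zero_mem _
      | cons b r =>
        rw [nuW]
        split_ifs with h1 h2
        · exact Submodule.neg_mem _ (single_mem_supp ⟨adm_mu hm ha h1, rfl⟩ _)
        · exact single_mem_supp ⟨adm_zero, rfl⟩ _
        · exact Submodule.zero_mem _
    · rintro w ⟨-, h⟩
      exact ⟨ha, by simp [h]⟩

lemma gamW_zero_mem (m : ℤ) (hm : 3 ≤ m) {r : List ℤ} (h : ¬ ZOdd r) :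
    gamW m (0 :: r) ∈ supp fun w => ∃ r', w = 0 :: r' ∧ ¬ ZOdd r' := by
  have h00 : ∀ a, ¬ Mrg m 0 a := by intro a; unfold Mrg; omega
  match r with
  | [] => simp [gamW, nuW]
  | a :: r =>
    rw [gamW, nuW, if_neg (h00 a)]
    by_cases ha : a = 0
    · subst ha
      match r with
      | [] => simp [ZOdd] at h
      | b :: r =>
        have hb : b = 0 := by by_contra hb; simp [ZOdd, hb] at h
        subst hb
        have hr : ¬ ZOdd r := by simpa [ZOdd] using h
        rw [gamW, nuW, if_neg (h00 0), if_pos ⟨rfl, rfl⟩]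
        simp only [map_sub, consL_single, and_self, if_true, sub_sub_cancel]
        refine consL_mem (fun w hw => ?_) (consL_mem (fun w hw => ?_) (gamW_zero_mem m hm hr))
          (P := fun w => ∃ r', w = 0 :: 0 :: r' ∧ ¬ ZOdd r')
        · obtain ⟨r', rfl, hr'⟩ := hw
          exact ⟨_, rfl, by simpa [ZOdd] using hr'⟩
        · obtain ⟨r', rfl, hr'⟩ := hw
          exact ⟨_, rfl, hr'⟩
    · rw [if_neg (by tauto), zero_sub]
      have key : gamW m (a :: r) ∈ supp fun w => ¬ ZOdd w := by
        rw [gamW]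
        refine Submodule.sub_mem _ ?_ (consL_mem (P := fun _ => True) ?_ (mem_supp_true _))
        · cases r with
          | nil => exact Submodule.zero_mem _
          | cons b r =>
            rw [nuW]
            split_ifs with h1 h2
            · refine Submodule.neg_mem _ (single_mem_supp ?_ _)
              have : mu m a b ≠ 0 := by unfold Mrg mu at *; split_ifs <;> omega
              simp [ZOdd, this]
            · exact absurd h2.1 ha
            · exact Submodule.zero_mem _
        · intro w _
          simp [ZOdd, ha]
      exact Submodule.neg_mem _ (consL_mem (fun w hw => ⟨w, rfl, hw⟩) key)

lemma gam_vW_sub {m : ℤ} (hm : 3 ≤ m) {X : St} {w : List ℤ} (ha : AdmW m X w)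
    (h : cls m X w = .u) : gam m (vW m X w) - Finsupp.single w 1 ∈
      supp fun w' => w'.length = w.length ∧ AdmW m X w' ∧
        (cls m X w' = .u → val m X w' < val m X w) := by
  induction w generalizing X with
  | nil => simp [cls] at h
  | cons a r ih =>
    rcases cls_u_cases h with ⟨r', e, hr⟩ | ⟨a', r', e, h0, hup⟩ | ⟨a', r', Y, e, hY, hr, hu⟩
    · cases e
      have h00 : ¬ Mrg m 0 0 := by unfold Mrg; omega
      rw [vW_zero hr, gam_single, gamW, nuW, if_neg h00, if_pos ⟨rfl, rfl⟩, sub_sub_cancel_left]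
      have h1 : gamW m (0 :: r) ∈ supp fun w => w.length = r.length ∧
          ∃ r', w = 0 :: r' ∧ ¬ ZOdd r' := by
        have h2 := gamW_mem hm (X := .s) (w := 0 :: r) trivial
        have h3 := gamW_zero_mem m hm hr
        rw [mem_supp] at h2 h3 ⊢
        intro w hw
        exact ⟨by simpa using (h2 w hw).2, h3 w hw⟩
      refine Submodule.neg_mem _ (consL_mem (fun w hw => ?_) h1)
      obtain ⟨hl, r', rfl, hr'⟩ := hw
      refine ⟨by simpa using hl, adm_zero, fun hc => ?_⟩
      simp [cls, ZOdd, hr'] at hc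
    · cases e
      rw [vW_up h0 hup, map_neg, gam_single, gamW, nuW, if_pos (hup.mrg hm).1, (hup.mrg hm).2]
      have h1 := gamW_mem hm (X := .s) (w := rem m X a :: r) trivial
      have e : -(-Finsupp.single (a :: r) (1 : ℤ) - consL (spl X a) (gamW m (rem m X a :: r))) -
        Finsupp.single (a :: r) 1 = consL (spl X a) (gamW m (rem m X a :: r)) := by abel
      rw [e]
      refine consL_mem (fun w hw => ?_) h1
      have hl : w.length = r.length := by simpa using hw.2
      exact ⟨by simpa using hl, hup.adm_spl ha, fun _ =>
        val_lt_of_rank (hup.rank_spl hm ha) hl⟩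
    · cases e
      rw [vW_cons hm hY hr, map_neg, gam_consL]
      have e : -(nu m a (vW m Y r) - consL a (gam m (vW m Y r))) - Finsupp.single (a :: r) 1 =
        consL a (gam m (vW m Y r) - Finsupp.single r 1) - nu m a (vW m Y r) := by
        rw [map_sub, consL_single]; abel
      rw [e]
      refine Submodule.sub_mem _ (consL_mem (fun w hw => ?_) (ih hr hu)) ?_
      · obtain ⟨hl, hw1, hw2⟩ := hw
        refine ⟨by simpa using hl, ha, fun hc => val_cons_lt hY hl (hw2 ?_)⟩
        rwa [cls_cons hm hY hw1] at hc
      · refine map_mem_supp _ (fun w hw => ?_) (vW_mem hm hr)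
        obtain ⟨hw1, hl, -⟩ := hw
        rw [nu_single]
        cases w with
        | nil => exact Submodule.zero_mem _
        | cons b w =>
          have hl' : w.length = r.length := by simpa using hl
          rw [nuW, if_neg (fun h' : a = 0 ∧ b = 0 => tr_ne_zero hm hY h'.1)]
          split_ifs with h1
          · obtain ⟨h2, h3⟩ := tr_mrg hm hY ha hw1 h1
            exact Submodule.neg_mem _ (single_mem_supp
              ⟨by simpa using hl', h2, fun _ => val_lt_of_rank h3 hl'⟩ _)
          · exact Submodule.zero_mem _


/-- Words in the letters `[-m, m)`. -/
def Valid (m : ℤ) (w : List ℤ) : Prop := ∀ a ∈ w, -m ≤ a ∧ a < m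

/-- The length of the path with given steps. -/
def wl (w : List ℤ) : ℕ := (w.map Int.natAbs).sum

/-- Words of the same length and displacement. -/
def Sim (m : ℤ) (w w' : List ℤ) : Prop :=
  (Valid m w → Valid m w') ∧ wl w' = wl w ∧ 2 * m ∣ w'.sum - w.sum

lemma wl_cons (a : ℤ) (w : List ℤ) : wl (a :: w) = a.natAbs + wl w := by simp [wl]

lemma valid_cons {m a : ℤ} {w : List ℤ} :
    Valid m (a :: w) ↔ (-m ≤ a ∧ a < m) ∧ Valid m w := by simp [Valid]

lemma Sim.cons {m a : ℤ} {w w' : List ℤ} (h : Sim m w w') : Sim m (a :: w) (a :: w') := by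
  obtain ⟨h1, h2, h3⟩ := h
  refine ⟨fun h => ?_, by rw [wl_cons, wl_cons, h2], by simpa using h3⟩
  rw [valid_cons] at h ⊢
  exact ⟨h.1, h1 h.2⟩

lemma sim_mrg {m a b : ℤ} {w : List ℤ} (h : Mrg m a b) :
    Sim m (a :: b :: w) (mu m a b :: w) := by
  refine ⟨fun h' => ?_, ?_, ?_⟩
  · simp only [valid_cons] at h' ⊢
    refine ⟨?_, h'.2.2⟩
    unfold Mrg mu at *; split_ifs <;> omega
  · simp only [wl_cons]
    unfold Mrg mu at *; split_ifs <;> omega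
  · simp only [List.sum_cons, mu]
    split_ifs with h'
    · exact ⟨-1, by linear_combination -h'⟩
    · exact ⟨0, by ring⟩

lemma sim_mrg' {m a b : ℤ} {w : List ℤ} (h : Mrg m a b) (ha : -m ≤ a ∧ a < m)
    (hb : -m ≤ b ∧ b < m) : Sim m (mu m a b :: w) (a :: b :: w) := by
  obtain ⟨-, h2, h3⟩ := sim_mrg (w := w) h
  refine ⟨fun h' => ?_, h2.symm, by rw [← dvd_neg, neg_sub]; exact h3⟩
  simp only [valid_cons] at h' ⊢
  exact ⟨ha, hb, h'.2⟩

lemma sim_zero {m : ℤ} (w : List ℤ) : Sim m (0 :: 0 :: w) (0 :: w) :=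
  ⟨fun h => by simp only [valid_cons] at h ⊢; exact h.2, by simp [wl_cons], by simp⟩

lemma sim_zero' {m : ℤ} (w : List ℤ) : Sim m (0 :: w) (0 :: 0 :: w) :=
  ⟨fun h => by simp only [valid_cons] at h ⊢; exact ⟨h.1, h⟩, by simp [wl_cons], by simp⟩

lemma gamW_sim (m : ℤ) (w : List ℤ) : gamW m w ∈ supp (Sim m w) := by
  induction w with
  | nil => exact Submodule.zero_mem _
  | cons a r ih =>
    rw [gamW]
    refine Submodule.sub_mem _ ?_ (consL_mem (fun _ h => h.cons) ih)
    cases r with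
    | nil => exact Submodule.zero_mem _
    | cons b r =>
      rw [nuW]
      split_ifs with h1 h2
      · exact Submodule.neg_mem _ (single_mem_supp (sim_mrg h1) _)
      · obtain ⟨rfl, rfl⟩ := h2
        exact single_mem_supp (sim_zero _) _
      · exact Submodule.zero_mem _

lemma vW_sim {m : ℤ} (hm : 3 ≤ m) (X : St) (w : List ℤ) : vW m X w ∈ supp (Sim m w) := by
  induction w generalizing X with
  | nil => exact Submodule.zero_mem _
  | cons a r ih =>
    by_cases hu : cls m X (a :: r) = .u
    · rcases cls_u_cases hu with ⟨r', h, hr⟩ | ⟨a', r', h, h0, hup⟩ | ⟨a', r', Y, h, hY, hr, -⟩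
      · cases h
        rw [vW_zero hr]
        exact single_mem_supp (sim_zero' _) _
      · cases h
        rw [vW_up h0 hup]
        refine Submodule.neg_mem _ (single_mem_supp ?_ _)
        obtain ⟨h1, h2⟩ := hup.mrg hm
        have h3 : (-m ≤ spl X a ∧ spl X a < m) ∧ (-m ≤ rem m X a ∧ rem m X a < m) := by
          cases X <;> simp only [Up, rem, spl] at hup ⊢ <;> split_ifs <;> omega
        have h4 := sim_mrg' (w := r) h1 h3.1 h3.2
        rwa [h2] at h4
      · cases h
        rw [vW_cons hm hY hr]
        exact Submodule.neg_mem _ (consL_mem (fun _ h => h.cons) (ih Y))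
    · rw [vW_eq_zero hu]; exact Submodule.zero_mem _

/-- Valid words with `n` steps, of length `l`. -/
def Ln (m : ℤ) (n l : ℕ) (w : List ℤ) : Prop :=
  Valid m w ∧ w.length = n ∧ wl w = l

lemma Ln.sim {m : ℤ} {n n' l : ℕ} {w w' : List ℤ} (h : Ln m n l w) (hs : Sim m w w')
    (hn : w'.length = n') : Ln m n' l w' :=
  ⟨hs.1 h.1, hn, hs.2.1.trans h.2.2⟩

lemma gamW_Sim {m : ℤ} (hm : 3 ≤ m) (w : List ℤ) :
    gamW m w ∈ supp fun w' => Sim m w w' ∧ w'.length + 1 = w.length := by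
  have h1 := gamW_sim m w
  have h2 := gamW_mem hm (X := .s) (w := w) (by cases w <;> trivial)
  rw [mem_supp] at *
  exact fun w' hw' => ⟨h1 w' hw', (h2 w' hw').2⟩

lemma vW_Sim {m : ℤ} (hm : 3 ≤ m) (w : List ℤ) :
    vW m .s w ∈ supp fun w' => Sim m w w' ∧ w'.length = w.length + 1 := by
  have h1 := vW_sim hm .s w
  have h2 := vW_mem hm (X := .s) (w := w) (by cases w <;> trivial)
  rw [mem_supp] at *
  exact fun w' hw' => ⟨h1 w' hw', (h2 w' hw').2.1⟩

lemma Sim.trans {m : ℤ} {w w' w'' : List ℤ} (h : Sim m w w') (h' : Sim m w' w'') :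
    Sim m w w'' := by
  refine ⟨fun hv => h'.1 (h.1 hv), h'.2.1.trans h.2.1, ?_⟩
  have := dvd_add h'.2.2 h.2.2
  rwa [sub_add_sub_cancel] at this

lemma Sim.refl (m : ℤ) (w : List ℤ) : Sim m w w := ⟨id, rfl, by simp⟩

/-- A linear endomorphism decreasing a weight is locally nilpotent. -/
lemma exists_pow_eq_zero (E : Module.End ℤ WChain) (μ : List ℤ → ℕ)
    (h : ∀ w, E (Finsupp.single w 1) ∈ supp fun w' => μ w' < μ w) (x : WChain) :
    ∃ k, (E ^ k) x = 0 := by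
  have key : ∀ N : ℕ, ∀ x ∈ supp (fun w => μ w < N), (E ^ N) x = 0 := by
    intro N
    induction N with
    | zero =>
      intro x hx
      have : x = 0 := by
        ext w
        by_contra hw
        exact absurd (mem_supp.1 hx w hw) (Nat.not_lt_zero _)
      rw [this, map_zero]
    | succ N ih =>
      intro x hx
      rw [pow_succ, Module.End.mul_apply]
      refine ih _ (map_mem_supp E (fun w hw => supp_mono (fun w' hw' => ?_) (h w)) hx)
      omega
  refine ⟨x.support.sup μ + 1, key _ x (mem_supp.2 fun w hw => ?_)⟩
  exact Nat.lt_succ_of_le (Finset.le_sup (Finsupp.mem_support_iff.2 hw))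

lemma one_sub_bijective (E : Module.End ℤ WChain)
    (h : ∀ x, ∃ k, (E ^ k) x = 0) :
    Function.Bijective ⇑((1 : Module.End ℤ WChain) - E) ∧
      ∀ N : Submodule ℤ WChain, (∀ x ∈ N, E x ∈ N) →
        ∀ y, (1 - E : Module.End ℤ WChain) y ∈ N → y ∈ N := by
  have h2 : ∀ N : Submodule ℤ WChain, (∀ x ∈ N, E x ∈ N) →
      ∀ y, (1 - E : Module.End ℤ WChain) y ∈ N → y ∈ N := by
    intro N hN y hy
    obtain ⟨k, hk⟩ := h y
    have e := LinearMap.congr_fun (geom_sum_mul_neg E k) y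
    rw [Module.End.mul_apply, LinearMap.sub_apply 1 (E ^ k), hk, sub_zero,
      Module.End.one_apply] at e
    rw [← e, LinearMap.sum_apply]
    refine Submodule.sum_mem _ ?_
    rintro i -
    induction i with
    | zero => simpa using hy
    | succ i ih => rw [pow_succ', Module.End.mul_apply]; exact hN _ ih
  refine ⟨⟨?_, fun x => ?_⟩, h2⟩
  · rw [← LinearMap.ker_eq_bot, LinearMap.ker_eq_bot']
    intro y hy
    exact (Submodule.mem_bot ℤ).1 (h2 ⊥ (by simp) y (by simp [hy]))
  · obtain ⟨k, hk⟩ := h x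
    refine ⟨(∑ i ∈ Finset.range k, E ^ i) x, ?_⟩
    rw [← Module.End.mul_apply, mul_neg_geom_sum, LinearMap.sub_apply, hk, sub_zero,
      Module.End.one_apply]

/-- Linear extension of the matching. -/
noncomputable def V (m : ℤ) : WChain →ₗ[ℤ] WChain := Finsupp.linearCombination ℤ (vW m .s)

/-- Projection to the cells of a class. -/
noncomputable def proj (m : ℤ) (c : Cls) : WChain →ₗ[ℤ] WChain :=
  Finsupp.linearCombination ℤ fun w => if cls m .s w = c then Finsupp.single w 1 else 0

/-- The change of basis replacing lower cells by boundaries of upper cells. -/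
noncomputable def T (m : ℤ) : Module.End ℤ WChain := gam m ∘ₗ V m + (1 - proj m .u)

@[simp] lemma V_single (m : ℤ) (w : List ℤ) : V m (Finsupp.single w 1) = vW m .s w := by
  simp [V]

@[simp] lemma proj_single (m : ℤ) (c : Cls) (w : List ℤ) : proj m c (Finsupp.single w 1) =
    if cls m .s w = c then Finsupp.single w 1 else 0 := by
  simp [proj]

lemma proj_add (m : ℤ) (x : WChain) : proj m .u x + proj m .d x + proj m .k x = x := by
  refine eq_on_supp (proj m .u + proj m .d + proj m .k) LinearMap.id (fun w _ => ?_)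
    (mem_supp_true x)
  simp only [LinearMap.add_apply, proj_single, LinearMap.id_apply]
  cases cls m .s w <;> simp

lemma proj_mem {m : ℤ} {P : List ℤ → Prop} {c : Cls} {x : WChain} (hx : x ∈ supp P) :
    proj m c x ∈ supp fun w => cls m .s w = c ∧ P w := by
  refine map_mem_supp _ (fun w hw => ?_) hx
  rw [proj_single]
  split_ifs with h
  · exact single_mem_supp ⟨h, hw⟩ _
  · exact Submodule.zero_mem _

lemma proj_mem' {m : ℤ} {c : Cls} (x : WChain) : proj m c x ∈ supp fun w => cls m .s w = c :=
  supp_mono (fun _ h => h.1) (proj_mem (mem_supp_true x))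

lemma proj_eq_self {m : ℤ} {c : Cls} {x : WChain} (hx : x ∈ supp fun w => cls m .s w = c) :
    proj m c x = x :=
  eq_on_supp (proj m c) LinearMap.id (fun w hw => by simp [hw]) hx

lemma proj_eq_zero {m : ℤ} {c c' : Cls} (hc : c' ≠ c) {x : WChain}
    (hx : x ∈ supp fun w => cls m .s w = c') : proj m c x = 0 :=
  eq_on_supp (proj m c) 0 (fun w hw => by simp [hw, hc]) hx

lemma admW_s (m : ℤ) (w : List ℤ) : AdmW m .s w := by cases w <;> trivial

lemma V_mem_d {m : ℤ} (hm : 3 ≤ m) (x : WChain) : V m x ∈ supp fun w => cls m .s w = .d :=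
  map_mem_supp _ (fun w _ => by
    rw [V_single]
    exact supp_mono (fun _ h => h.2.2) (vW_mem hm (admW_s m w))) (mem_supp_true x)

lemma exists_V {m : ℤ} (hm : 3 ≤ m) {x : WChain} (hx : x ∈ supp fun w => cls m .s w = .d) :
    ∃ u ∈ supp (fun w => cls m .s w = .u), V m u = x := by
  have := map_mem_supp (N := (supp fun w => cls m .s w = .u).map (V m)) LinearMap.id
    (fun w hw => ?_) hx
  · exact this
  · obtain ⟨u, -, hu, c, hc⟩ := exists_vW hm (admW_s m w) hw
    exact ⟨Finsupp.single u c, single_mem_supp hu c, by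
      rw [LinearMap.id_apply, hc, ← V_single, ← map_smul, Finsupp.smul_single, smul_eq_mul,
        mul_one]⟩

lemma T_u {m : ℤ} {x : WChain} (hx : x ∈ supp fun w => cls m .s w = .u) :
    T m x = gam m (V m x) := by
  simp [T, proj_eq_self hx]

lemma T_of_ne {m : ℤ} {c : Cls} (hc : c ≠ .u) {x : WChain}
    (hx : x ∈ supp fun w => cls m .s w = c) : T m x = x := by
  have : V m x = 0 := eq_on_supp (V m) 0 (fun w hw => by
    rw [V_single, vW_eq_zero (by rw [hw]; exact hc), LinearMap.zero_apply]) hx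
  simp [T, proj_eq_zero hc hx, this]

lemma one_sub_T_mem {m : ℤ} (hm : 3 ≤ m) (w : List ℤ) :
    (1 - T m) (Finsupp.single w 1) ∈ supp fun w' => (w'.length = w.length ∧ Sim m w w') ∧
      (if cls m .s w' = .u then val m .s w' + 1 else 0) <
        (if cls m .s w = .u then val m .s w + 1 else 0) := by
  by_cases h : cls m .s w = .u
  · have e : (1 - T m) (Finsupp.single w 1) =
        -(gam m (vW m .s w) - Finsupp.single w 1) := by
      rw [LinearMap.sub_apply, T_u (single_mem_supp h 1), V_single]; simp
    rw [e]
    refine Submodule.neg_mem _ ?_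
    have h1 := gam_vW_sub hm (admW_s m w) h
    have h2 : gam m (vW m .s w) - Finsupp.single w 1 ∈ supp (Sim m w) := by
      refine Submodule.sub_mem _ (map_mem_supp _ (fun w' hw' => ?_) (vW_sim hm .s w))
        (single_mem_supp (Sim.refl m w) 1)
      rw [gam_single]
      exact supp_mono (fun _ h => hw'.trans h) (gamW_sim m w')
    rw [mem_supp] at *
    intro w' hw'
    refine ⟨⟨(h1 w' hw').1, h2 w' hw'⟩, ?_⟩
    rw [if_pos h]
    split_ifs with h3
    · have := (h1 w' hw').2.2 h3; omega
    · omega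
  · have e : (1 - T m) (Finsupp.single w 1) = 0 := by
      rw [LinearMap.sub_apply, T_of_ne h
        (single_mem_supp (P := fun w' => cls m .s w' = cls m .s w) rfl 1)]; simp
    rw [e]
    exact Submodule.zero_mem _

lemma T_bijective_and {m : ℤ} (hm : 3 ≤ m) :
    Function.Bijective (T m) ∧ ∀ N : Submodule ℤ WChain, (∀ x ∈ N, (1 - T m) x ∈ N) →
      ∀ y, T m y ∈ N → y ∈ N := by
  have := one_sub_bijective (1 - T m) (exists_pow_eq_zero _ _ fun w =>
    supp_mono (fun _ h => h.2) (one_sub_T_mem hm w))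
  rwa [sub_sub_cancel] at this

/-- The inverse of `T`. -/
noncomputable def Ti {m : ℤ} (hm : 3 ≤ m) : WChain →ₗ[ℤ] WChain :=
  (LinearEquiv.ofBijective (T m) (T_bijective_and hm).1).symm

@[simp] lemma T_Ti {m : ℤ} (hm : 3 ≤ m) (x : WChain) : T m (Ti hm x) = x :=
  LinearEquiv.apply_symm_apply (LinearEquiv.ofBijective (T m) (T_bijective_and hm).1) x

@[simp] lemma Ti_T {m : ℤ} (hm : 3 ≤ m) (x : WChain) : Ti hm (T m x) = x :=
  LinearEquiv.symm_apply_apply (LinearEquiv.ofBijective (T m) (T_bijective_and hm).1) x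

lemma Ti_mem {m : ℤ} (hm : 3 ≤ m) {P : List ℤ → Prop}
    (hP : ∀ w w', P w → Sim m w w' → w'.length = w.length → P w') {x : WChain}
    (hx : x ∈ supp P) : Ti hm x ∈ supp P := by
  refine (T_bijective_and hm).2 (supp P) (fun x hx => ?_) _ (by rwa [T_Ti])
  refine map_mem_supp _ (fun w hw => ?_) hx
  exact supp_mono (fun w' h => hP w w' hw h.1.2 h.1.1) (one_sub_T_mem hm w)

/-- Boundaries of upper cells. -/
lemma exists_gam_d {m : ℤ} (hm : 3 ≤ m) {x : WChain} (hx : x ∈ supp fun w => cls m .s w = .d) :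
    ∃ u ∈ supp (fun w => cls m .s w = .u), V m u = x ∧ gam m x = T m u := by
  obtain ⟨u, hu, rfl⟩ := exists_V hm hx
  exact ⟨u, hu, rfl, (T_u hu).symm⟩

lemma d_eq_zero {m : ℤ} (hm : 3 ≤ m) {x : WChain} (hx : x ∈ supp fun w => cls m .s w = .d)
    (h : gam m x = 0) : x = 0 := by
  obtain ⟨u, -, rfl, h2⟩ := exists_gam_d hm hx
  rw [h] at h2
  have : u = 0 := by rw [← Ti_T hm u, ← h2, map_zero]
  rw [this, map_zero]

/-- Prepending `i` copies of the word of a half-turn. -/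
def rep (m : ℤ) : ℕ → List ℤ → List ℤ
  | 0, l => l
  | i + 1, l => 1 :: (m - 1) :: rep m i l

/-- Alternating words: `alt j a` starts with `a`. -/
def alt : ℕ → ℤ → List ℤ
  | 0, _ => []
  | j + 1, a => a :: alt j (-a)

lemma rep_spec {m : ℤ} (hm : 3 ≤ m) (i : ℕ) (l : List ℤ) :
    (rep m i l).length = 2 * i + l.length ∧ (wl (rep m i l) : ℤ) = m * i + wl l ∧
      (rep m i l).sum = m * i + l.sum ∧ (Valid m l → Valid m (rep m i l)) ∧
      (cls m .s (rep m i l) = cls m .s l) := by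
  induction i with
  | zero => simp [rep]
  | succ i ih =>
    obtain ⟨h1, h2, h3, h4, h5⟩ := ih
    refine ⟨by simp [rep, h1]; ring, ?_, by simp [rep, h3]; ring, fun hv => ?_, ?_⟩
    · simp only [rep, wl_cons, Nat.cast_add, h2]
      have : ((m - 1).natAbs : ℤ) = m - 1 := by omega
      rw [this]; push_cast; ring
    · simp only [rep, valid_cons]
      exact ⟨by omega, by omega, h4 hv⟩
    · rw [rep, cls_cons (Y := .q) hm (by simp [tr]) (by simp [AdmW, Adm]),
        cls_cons (Y := .s) hm (by simp [tr]; omega) (admW_s _ _), h5]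

lemma alt_spec {m : ℤ} (hm : 3 ≤ m) (j : ℕ) {a : ℤ} (ha : a = 1 ∨ a = -1) :
    (alt j a).length = j ∧ wl (alt j a) = j ∧ (alt j a).sum = a * (j % 2 : ℕ) ∧
      Valid m (alt j a) := by
  induction j generalizing a with
  | zero => simp [alt, wl, Valid]
  | succ j ih =>
    obtain ⟨h1, h2, h3, h4⟩ := ih (a := -a) (by omega)
    refine ⟨by simp [alt, h1], ?_, ?_, ?_⟩
    · rw [alt, wl_cons, h2]; omega
    · rw [alt, List.sum_cons, h3]
      rcases ha with rfl | rfl <;> omega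
    · rw [alt, valid_cons]
      exact ⟨by omega, h4⟩

lemma admW_alt (m : ℤ) (j : ℕ) : AdmW m .n (alt j (-1)) ∧ AdmW m .p (alt j 1) ∧
    AdmW m .q (alt j (-1)) := by
  cases j <;> simp [alt, AdmW, Adm]

lemma cls_alt {m : ℤ} (hm : 3 ≤ m) (j : ℕ) :
    cls m .n (alt j (-1)) = .k ∧ cls m .p (alt j 1) = .k := by
  induction j with
  | zero => simp [alt, cls]
  | succ j ih =>
    obtain ⟨h1, h2⟩ := ih
    have := admW_alt m j
    rw [alt, alt, neg_neg, cls_cons (Y := .p) hm (by simp [tr]) this.2.1,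
      cls_cons (Y := .n) hm (by simp [tr]) this.1]
    exact ⟨h2, h1⟩

lemma cls_s_alt {m : ℤ} (hm : 3 ≤ m) (j : ℕ) {a : ℤ} (ha : a = 1 ∨ a = -1) :
    cls m .s (alt j a) = .k := by
  cases j with
  | zero => simp [alt, cls]
  | succ j =>
    have h := admW_alt m j
    rcases ha with rfl | rfl
    · rw [alt, cls_cons (Y := .q) hm (by simp [tr]) h.2.2]
      cases j with
      | zero => simp [alt, cls]
      | succ j =>
        have h := admW_alt m j
        rw [alt, neg_neg, cls_cons (Y := .p) hm (by simp [tr]) h.2.1]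
        exact (cls_alt hm j).2
    · rw [alt, neg_neg, cls_cons (Y := .p) hm (by simp [tr]) h.2.1]
      exact (cls_alt hm j).2

/-- Critical words read from each state. -/
def Crit (m : ℤ) : St → List ℤ → Prop
  | .s, w => ∃ i j, w = rep m i (alt j 1) ∨ w = rep m i (alt j (-1))
  | .n, w => ∃ j, w = alt j (-1)
  | .p, w => ∃ j, w = alt j 1
  | .q, w => (∃ j, w = alt j (-1)) ∨ ∃ i j, w = (m - 1) :: rep m i (alt j 1) ∨
      w = (m - 1) :: rep m i (alt j (-1))

lemma crit_of_cls {m : ℤ} (hm : 3 ≤ m) {X : St} {w : List ℤ} (hv : Valid m w)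
    (ha : AdmW m X w) (h : cls m X w = .k) : Crit m X w := by
  induction w generalizing X with
  | nil =>
    cases X
    · exact ⟨0, 0, Or.inl rfl⟩
    · exact ⟨0, rfl⟩
    · exact ⟨0, rfl⟩
    · exact Or.inl ⟨0, rfl⟩
  | cons a r ih =>
    rw [valid_cons] at hv
    by_cases h0 : a = 0
    · simp only [cls, if_pos h0] at h
      split_ifs at h
    by_cases hup : Up m X a
    · simp only [cls, if_neg h0, if_pos hup] at h
      simp at h
    cases hY : tr m X a with
    | none =>
      exfalso
      change Adm m X a at ha
      cases X <;> simp only [Up, tr, Adm] at hup hY ha <;> split_ifs at hY <;> omega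
    | some Y =>
      by_cases hr : AdmW m Y r
      · rw [cls_cons hm hY hr] at h
        have hc := ih hv.2 hr h
        cases X <;> simp only [tr] at hY <;> split_ifs at hY <;> cases hY <;> subst a
        · obtain ⟨j, rfl⟩ := hc
          exact ⟨0, j + 1, Or.inr (by simp [rep, alt])⟩
        · rcases hc with ⟨j, rfl⟩ | ⟨i, j, rfl | rfl⟩
          · exact ⟨0, j + 1, Or.inl (by simp [rep, alt])⟩
          · exact ⟨i + 1, j, Or.inl rfl⟩
          · exact ⟨i + 1, j, Or.inr rfl⟩
        · obtain ⟨j, rfl⟩ := hc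
          exact ⟨j + 1, by simp [alt]⟩
        · obtain ⟨j, rfl⟩ := hc
          exact ⟨j + 1, by simp [alt]⟩
        · obtain ⟨j, rfl⟩ := hc
          exact Or.inl ⟨j + 1, by simp [alt]⟩
        · obtain ⟨i, j, rfl | rfl⟩ := hc
          · exact Or.inr ⟨i, j, Or.inl rfl⟩
          · exact Or.inr ⟨i, j, Or.inr rfl⟩
      · rw [cls_cons_of_not_adm hm hY hr] at h
        simp at h

lemma crit_numbers {m : ℤ} (hm : 3 ≤ m) {w : List ℤ} (hv : Valid m w)
    (h : cls m .s w = .k) : ∃ i j : ℕ, ∃ a : ℤ, (a = 1 ∨ a = -1) ∧ w = rep m i (alt j a) ∧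
      w.length = 2 * i + j ∧ (wl w : ℤ) = m * i + j ∧ w.sum = m * i + a * (j % 2 : ℕ) := by
  have key : ∀ i j : ℕ, ∀ a : ℤ, (a = 1 ∨ a = -1) → w = rep m i (alt j a) →
      w.length = 2 * i + j ∧ (wl w : ℤ) = m * i + j ∧ w.sum = m * i + a * (j % 2 : ℕ) := by
    rintro i j a ha rfl
    obtain ⟨h1, h2, h3, -⟩ := alt_spec hm j ha
    obtain ⟨r1, r2, r3, -⟩ := rep_spec hm i (alt j a)
    rw [h1] at r1; rw [h2] at r2; rw [h3] at r3
    exact ⟨r1, r2, r3⟩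
  obtain ⟨i, j, hw | hw⟩ := crit_of_cls hm hv (admW_s m w) h
  · exact ⟨i, j, 1, Or.inl rfl, hw, key i j 1 (Or.inl rfl) hw⟩
  · exact ⟨i, j, -1, Or.inr rfl, hw, key i j (-1) (Or.inr rfl) hw⟩

lemma crit_not_adjacent {m : ℤ} (hm : 3 ≤ m) {w w' : List ℤ} (hv : Valid m w)
    (h : cls m .s w = .k) (hv' : Valid m w') (h' : cls m .s w' = .k)
    (hl : wl w' = wl w) (hn : w'.length + 1 = w.length) (hs : 2 * m ∣ w'.sum - w.sum) :
    False := by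
  obtain ⟨i, j, a, ha, -, h1, h2, h3⟩ := crit_numbers hm hv h
  obtain ⟨i', j', a', ha', -, h1', h2', h3'⟩ := crit_numbers hm hv' h'
  have e1 : m * ((i' : ℤ) - i) + (j' - j) = 0 := by
    rw [hl, h2] at h2'; linear_combination -h2'
  have e2 : 2 * ((i' : ℤ) - i) + (j' - j) = -1 := by omega
  have e3 : (m - 2) * ((i' : ℤ) - i) = 1 := by linear_combination e1 - e2
  have e4 : m = 3 := by
    rcases Int.eq_one_or_neg_one_of_mul_eq_one e3 with h | h <;> omega
  subst e4
  rw [h3, h3'] at hs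
  rcases ha with rfl | rfl <;> rcases ha' with rfl | rfl <;> omega

lemma proj_k_Ti_gam {m : ℤ} (hm : 3 ≤ m) {x : WChain}
    (hx : x ∈ supp fun w => cls m .s w = .k ∧ Valid m w) :
    proj m .k (Ti hm (gam m x)) = 0 := by
  refine eq_on_supp (proj m .k ∘ₗ Ti hm ∘ₗ gam m) 0 (fun w hw => ?_) hx
  simp only [LinearMap.comp_apply, gam_single, LinearMap.zero_apply]
  have h1 := proj_mem (m := m) (c := .k) (Ti_mem hm (fun w' w'' h' hs hl =>
    ⟨h'.1.trans hs, by rw [hl]; exact h'.2⟩) (gamW_Sim hm w))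
  ext w'
  by_contra h
  obtain ⟨h2, h3, h4⟩ := mem_supp.1 h1 w' h
  exact crit_not_adjacent hm hw.2 hw.1 (h3.1 hw.2) h2 h3.2.1 h4 h3.2.2

/-- The preimage under `T` of the boundary of a valid critical chain. -/
lemma Ti_gam_k {m : ℤ} (hm : 3 ≤ m) {x : WChain}
    (hx : x ∈ supp fun w => cls m .s w = .k ∧ Valid m w) :
    Ti hm (gam m x) ∈ supp fun w => cls m .s w = .u := by
  set y := Ti hm (gam m x) with hy
  have h1 := proj_add m y
  rw [proj_k_Ti_gam hm hx, add_zero] at h1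
  have h2 : gam m x = gam m (V m (proj m .u y)) + proj m .d y := by
    rw [← T_u (proj_mem' y), ← T_of_ne (c := .d) (by simp) (proj_mem' (c := .d) y), ← map_add, h1,
      hy, T_Ti]
  have h3 : gam m (proj m .d y) = 0 := by
    have := congrArg (gam m) h2
    rw [map_add, gam_gam m hm, gam_gam m hm, zero_add] at this
    exact this.symm
  rw [d_eq_zero hm (proj_mem' y) h3, add_zero] at h1
  rw [← h1]
  exact proj_mem' y

lemma Ti_gam_mem {m : ℤ} (hm : 3 ≤ m) {y : WChain} (hy : y ∈ supp (Valid m)) :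
    Ti hm (gam m y) ∈ supp fun w => cls m .s w = .u := by
  have h0 : Ti hm y ∈ supp (Valid m) := Ti_mem hm (fun _ _ h hs _ => hs.1 h) hy
  set x := Ti hm y with hx
  have h1 := proj_add m x
  have h2 : gam m y = gam m (proj m .d x) + gam m (proj m .k x) := by
    rw [← T_Ti hm y, ← hx]
    conv_lhs => rw [← h1]
    rw [map_add (T m), map_add (T m), T_u (proj_mem' x), T_of_ne (c := .d) (by simp) (proj_mem' x),
      T_of_ne (c := .k) (by simp) (proj_mem' x), map_add, map_add, gam_gam m hm, zero_add]
  obtain ⟨u, hu, -, h3⟩ := exists_gam_d hm (proj_mem' (c := .d) x)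
  rw [h2, map_add, h3, Ti_T]
  exact Submodule.add_mem _ hu (Ti_gam_k hm (proj_mem h0))

/-- The coordinates of the homology class of a cycle. -/
noncomputable def R {m : ℤ} (hm : 3 ≤ m) : WChain →ₗ[ℤ] WChain := proj m .k ∘ₗ Ti hm

lemma Ti_mem_Ln {m : ℤ} (hm : 3 ≤ m) {n l : ℕ} {x : WChain} (hx : x ∈ supp (Ln m n l)) :
    Ti hm x ∈ supp (Ln m n l) :=
  Ti_mem hm (fun _ _ h hs hl => h.sim hs (hl.trans h.2.1)) hx

lemma V_mem_Ln {m : ℤ} (hm : 3 ≤ m) {n l : ℕ} {x : WChain} (hx : x ∈ supp (Ln m n l)) :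
    V m x ∈ supp (Ln m (n + 1) l) :=
  map_mem_supp _ (fun w hw => by
    rw [V_single]
    exact supp_mono (fun w' h => hw.sim h.1 (by rw [h.2, hw.2.1])) (vW_Sim hm w)) hx

lemma R_mem {m : ℤ} (hm : 3 ≤ m) {n l : ℕ} {x : WChain} (hx : x ∈ supp (Ln m n l)) :
    R hm x ∈ supp fun w => cls m .s w = .k ∧ Ln m n l w :=
  proj_mem (Ti_mem_Ln hm hx)

lemma R_gam {m : ℤ} (hm : 3 ≤ m) {n l : ℕ} {y : WChain} (hy : y ∈ supp (Ln m n l)) :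
    R hm (gam m y) = 0 :=
  proj_eq_zero (by simp) (Ti_gam_mem hm (supp_mono (fun _ h => h.1) hy))

lemma exists_gam_eq {m : ℤ} (hm : 3 ≤ m) {n l : ℕ} {z : WChain} (hz : z ∈ supp (Ln m n l))
    (hg : gam m z = 0) (hR : R hm z = 0) : ∃ y ∈ supp (Ln m (n + 1) l), gam m y = z := by
  have h0 := Ti_mem_Ln hm hz
  set x := Ti hm z with hx
  have h1 := proj_add m x
  change proj m .k x = 0 at hR
  rw [hR, add_zero] at h1
  have h2 : z = gam m (V m (proj m .u x)) + proj m .d x := by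
    rw [← T_u (proj_mem' x), ← T_of_ne (c := .d) (by simp) (proj_mem' (c := .d) x), ← map_add, h1,
      hx, T_Ti]
  have h3 : gam m (proj m .d x) = 0 := by
    rw [h2, map_add, gam_gam m hm, zero_add] at hg
    exact hg
  rw [d_eq_zero hm (proj_mem' x) h3, add_zero] at h2
  exact ⟨_, V_mem_Ln hm (supp_mono (fun _ h => h.2) (proj_mem h0)), h2.symm⟩

lemma gam_mem_Ln {m : ℤ} (hm : 3 ≤ m) {n l : ℕ} {x : WChain} (hx : x ∈ supp (Ln m (n + 1) l)) :
    gam m x ∈ supp (Ln m n l) :=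
  map_mem_supp _ (fun w hw => by
    rw [gam_single]
    refine supp_mono (fun w' h => hw.sim h.1 ?_) (gamW_Sim hm w)
    have := hw.2.1; have := h.2; omega) hx

lemma exists_cycle {m : ℤ} (hm : 3 ≤ m) {n l : ℕ} {k : WChain}
    (hk : k ∈ supp fun w => cls m .s w = .k ∧ Ln m n l w) :
    ∃ z ∈ supp (Ln m n l), gam m z = 0 ∧ R hm z = k := by
  have hk' : k ∈ supp (Ln m n l) := supp_mono (fun _ h => h.2) hk
  have hk2 : k ∈ supp fun w => cls m .s w = .k := supp_mono (fun _ h => h.1) hk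
  have hu := Ti_gam_mem hm (supp_mono (fun _ h => h.1) hk')
  refine ⟨k - V m (Ti hm (gam m k)), Submodule.sub_mem _ hk' ?_, ?_, ?_⟩
  · cases n with
    | zero =>
      have : gam m k = 0 := eq_on_supp (gam m) 0 (fun w hw => by
        have : w = [] := List.length_eq_zero_iff.1 hw.2.1
        simp [this, gamW]) hk'
      rw [this, map_zero, map_zero]
      exact Submodule.zero_mem _
    | succ n => exact V_mem_Ln hm (Ti_mem_Ln hm (gam_mem_Ln hm hk'))
  · rw [map_sub, ← T_u hu, T_Ti, sub_self]
  · have h1 : Ti hm k = k := by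
      conv_lhs => rw [← T_of_ne (c := .k) (by simp) hk2]
      rw [Ti_T]
    have h2 := V_mem_d hm (Ti hm (gam m k))
    have h3 : Ti hm (V m (Ti hm (gam m k))) = V m (Ti hm (gam m k)) := by
      conv_lhs => rw [← T_of_ne (c := .d) (by simp) h2]
      rw [Ti_T]
    rw [R, LinearMap.comp_apply, map_sub, h1, h3, map_sub, proj_eq_self hk2,
      proj_eq_zero (by simp) h2, sub_zero]


section Cycle

variable {m : ℕ}

lemma two_mul_pos (hm : 3 ≤ m) : 0 < 2 * m := by omega

/-- The signed step from `x` to `y`, in `[-m, m)`. -/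
def st (x y : Fin (2 * m)) : ℤ :=
  if (y : ℤ) - x < -m then (y : ℤ) - x + 2 * m
  else if (m : ℤ) ≤ (y : ℤ) - x then (y : ℤ) - x - 2 * m else (y : ℤ) - x

lemma st_range (x y : Fin (2 * m)) : -(m : ℤ) ≤ st x y ∧ st x y < m := by
  have := x.isLt; have := y.isLt
  unfold st; split_ifs <;> omega

lemma st_eq_zero {x y : Fin (2 * m)} : st x y = 0 ↔ x = y := by
  have := x.isLt; have := y.isLt
  rw [Fin.ext_iff]
  unfold st; split_ifs <;> omega

lemma st_inj {x y z : Fin (2 * m)} (h : st x y = st x z) : y = z := by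
  have := x.isLt; have := y.isLt; have := z.isLt
  rw [Fin.ext_iff]
  unfold st at h; split_ifs at h <;> omega

lemma exists_st (x : Fin (2 * m)) {a : ℤ} (ha : -(m : ℤ) ≤ a ∧ a < m) : ∃ y, st x y = a := by
  have := x.isLt
  obtain ⟨k, hk, hk'⟩ : ∃ k : ℕ, k < 2 * m ∧
      ((k : ℤ) = x + a ∨ (k : ℤ) = x + a + 2 * m ∨ (k : ℤ) = x + a - 2 * m) := by
    by_cases h1 : (x : ℤ) + a < 0
    · exact ⟨(x + a + 2 * m).toNat, by omega, by omega⟩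
    · by_cases h2 : (2 * m : ℤ) ≤ (x : ℤ) + a
      · exact ⟨(x + a - 2 * m).toNat, by omega, by omega⟩
      · exact ⟨(x + a).toNat, by omega, by omega⟩
  refine ⟨⟨k, hk⟩, ?_⟩
  unfold st; simp only []; split_ifs <;> omega

lemma adj_iff (hm : 3 ≤ m) (x y : Fin (2 * m)) :
    (SimpleGraph.cycleGraph (2 * m)).Adj x y ↔ st x y = 1 ∨ st x y = -1 := by
  rw [SimpleGraph.cycleGraph_adj']
  have := x.isLt; have := y.isLt
  rw [Fin.sub_def, Fin.sub_def]
  simp only []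
  have h1 : (2 * m - (y : ℕ) + x) % (2 * m) =
      if (y : ℕ) ≤ x then (x : ℕ) - y else 2 * m - y + x := by
    split_ifs with h
    · rw [show 2 * m - (y : ℕ) + x = (x - y) + 2 * m by omega, Nat.add_mod_right,
        Nat.mod_eq_of_lt (by omega)]
    · exact Nat.mod_eq_of_lt (by omega)
  have h2 : (2 * m - (x : ℕ) + y) % (2 * m) =
      if (x : ℕ) ≤ y then (y : ℕ) - x else 2 * m - x + y := by
    split_ifs with h
    · rw [show 2 * m - (x : ℕ) + y = (y - x) + 2 * m by omega, Nat.add_mod_right,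
        Nat.mod_eq_of_lt (by omega)]
    · exact Nat.mod_eq_of_lt (by omega)
  rw [h1, h2]
  unfold st; split_ifs <;> omega

lemma st_trans (x y z : Fin (2 * m)) : ∃ k : ℤ, (k = -1 ∨ k = 0 ∨ k = 1) ∧
    st x z = st x y + st y z + 2 * m * k := by
  have := x.isLt; have := y.isLt; have := z.isLt
  have e : ∀ k : ℤ, 2 * (m : ℤ) * k = 2 * (m * k) := fun k => mul_assoc _ _ _
  by_cases h1 : st x z = st x y + st y z
  · exact ⟨0, by simp, by simp [h1]⟩
  by_cases h2 : st x z = st x y + st y z + 2 * m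
  · exact ⟨1, by simp, by simp [h2]⟩
  refine ⟨-1, by simp, ?_⟩
  unfold st at *; split_ifs at * <;> omega

lemma natAbs_st_le_length (hm : 3 ≤ m) {x y : Fin (2 * m)}
    (p : (SimpleGraph.cycleGraph (2 * m)).Walk x y) : (st x y).natAbs ≤ p.length := by
  induction p with
  | nil => simp [st_eq_zero.2]
  | @cons u v w h p ih =>
    rw [adj_iff hm] at h
    rw [SimpleGraph.Walk.length_cons]
    obtain ⟨k, hk, e⟩ := st_trans u v w
    have := st_range u w; have := st_range v w; have := st_range u v
    rcases hk with rfl | rfl | rfl <;> omega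

lemma exists_walk (hm : 3 ≤ m) (k : ℕ) (x y : Fin (2 * m)) (h : (st x y).natAbs = k) :
    ∃ p : (SimpleGraph.cycleGraph (2 * m)).Walk x y, p.length = k := by
  induction k generalizing x with
  | zero =>
    obtain rfl := st_eq_zero.1 (Int.natAbs_eq_zero.1 h)
    exact ⟨.nil, rfl⟩
  | succ k ih =>
    obtain ⟨z, hz⟩ := exists_st x (a := if 0 < st x y then 1 else -1) (by split_ifs <;> omega)
    have hxz : (SimpleGraph.cycleGraph (2 * m)).Adj x z := by
      rw [adj_iff hm, hz]; split_ifs <;> simp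
    obtain ⟨c, hc, e⟩ := st_trans x z y
    obtain ⟨p, hp⟩ := ih z (by
      have := st_range x y; have := st_range z y
      rw [hz] at e
      rcases hc with rfl | rfl | rfl <;> split_ifs at e <;> omega)
    exact ⟨.cons hxz p, by simp [hp]⟩

lemma dist_eq (hm : 3 ≤ m) (x y : Fin (2 * m)) :
    (SimpleGraph.cycleGraph (2 * m)).dist x y = (st x y).natAbs := by
  refine le_antisymm ?_ ?_
  · obtain ⟨p, hp⟩ := exists_walk hm _ x y rfl
    exact hp ▸ SimpleGraph.dist_le p
  · obtain ⟨p, hp⟩ :=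
      (cycleGraph_connected_of_pos (2 * m) (two_mul_pos hm)).exists_walk_length_eq_dist x y
    exact hp ▸ natAbs_st_le_length hm p

lemma d_eq (hm : 3 ≤ m) (x y : Fin (2 * m)) :
    (cycleQM (2 * m) (two_mul_pos hm)).d x y = ((st x y).natAbs : ℝ≥0∞) := by
  rw [← dist_eq hm]; rfl

lemma btw_iff_natAbs (hm : 3 ≤ m) (x y z : Fin (2 * m)) :
    (cycleQM (2 * m) (two_mul_pos hm)).Btw x y z ↔
      (st x y).natAbs + (st y z).natAbs = (st x z).natAbs := by
  rw [QuasiMetric.Btw, d_eq hm, d_eq hm, d_eq hm]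
  exact_mod_cast Iff.rfl

lemma btw_iff (hm : 3 ≤ m) (x y z : Fin (2 * m)) :
    (cycleQM (2 * m) (two_mul_pos hm)).Btw x y z ↔
      st x y = 0 ∨ st y z = 0 ∨ Mrg m (st x y) (st y z) := by
  rw [btw_iff_natAbs hm, Mrg]
  obtain ⟨k, hk, e⟩ := st_trans x y z
  have := st_range x y; have := st_range y z; have := st_range x z
  rcases hk with rfl | rfl | rfl <;> omega

lemma st_eq_mu {x y z : Fin (2 * m)} (h : Mrg m (st x y) (st y z)) :
    st x z = mu m (st x y) (st y z) := by
  obtain ⟨k, hk, e⟩ := st_trans x y z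
  have := st_range x y; have := st_range y z; have := st_range x z
  unfold Mrg mu at *
  rcases hk with rfl | rfl | rfl <;> split_ifs <;> omega

lemma btw_symm_iff (hm : 3 ≤ m) (x y : Fin (2 * m)) :
    (cycleQM (2 * m) (two_mul_pos hm)).Btw x y x ↔ x = y := by
  rw [btw_iff_natAbs hm, st_eq_zero.2 (rfl : x = x)]
  constructor
  · intro h
    exact st_eq_zero.1 (by omega)
  · rintro rfl
    simp [st_eq_zero.2]

/-- The word of steps of a tuple. -/
def wd {n : ℕ} (t : Fin (n + 1) → Fin (2 * m)) : List ℤ :=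
  List.ofFn fun i : Fin n => st (t i.castSucc) (t i.succ)

lemma wd_cons {n : ℕ} (x : Fin (2 * m)) (t : Fin (n + 1) → Fin (2 * m)) :
    wd (Fin.cons x t : Fin (n + 2) → Fin (2 * m)) = st x (t 0) :: wd t := by
  simp [wd, List.ofFn_succ]

lemma wd_zero (t : Fin 1 → Fin (2 * m)) : wd t = [] := by simp [wd]

lemma length_wd {n : ℕ} (t : Fin (n + 1) → Fin (2 * m)) : (wd t).length = n := by simp [wd]

lemma valid_wd {n : ℕ} (t : Fin (n + 1) → Fin (2 * m)) : Valid m (wd t) := by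
  intro a ha
  obtain ⟨i, rfl⟩ := List.mem_ofFn.1 ha
  exact st_range _ _

lemma wd_inj {n : ℕ} {t t' : Fin (n + 1) → Fin (2 * m)} (h0 : t 0 = t' 0) (h : wd t = wd t') :
    t = t' := by
  have h1 := List.ofFn_injective h
  funext i
  induction i using Fin.induction with
  | zero => exact h0
  | succ i ih =>
    have := congrFun h1 i
    simp only [ih] at this
    exact st_inj this

lemma exists_wd (x : Fin (2 * m)) {w : List ℤ} {n : ℕ} (hn : w.length = n) (hv : Valid m w) :
    ∃ t : Fin (n + 1) → Fin (2 * m), t 0 = x ∧ wd t = w := by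
  induction w generalizing x n with
  | nil =>
    subst hn
    exact ⟨fun _ => x, rfl, wd_zero _⟩
  | cons a w ih =>
    subst hn
    rw [valid_cons] at hv
    obtain ⟨y, hy⟩ := exists_st x hv.1
    obtain ⟨t, h0, ht⟩ := ih y rfl hv.2
    exact ⟨Fin.cons x t, rfl, by rw [wd_cons, h0, hy, ht]⟩

lemma len_eq (hm : 3 ≤ m) {n : ℕ} (t : Fin (n + 1) → Fin (2 * m)) :
    (cycleQM (2 * m) (two_mul_pos hm)).len t = (wl (wd t) : ℝ≥0∞) := by
  simp only [QuasiMetric.len, d_eq hm, wl, wd, List.map_ofFn, List.sum_ofFn]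
  push_cast
  rfl

lemma len_eq_iff (hm : 3 ≤ m) {n : ℕ} (t : Fin (n + 1) → Fin (2 * m)) (l : ℕ) :
    (cycleQM (2 * m) (two_mul_pos hm)).len t = (l : ℝ≥0∞) ↔ Ln m n l (wd t) := by
  rw [len_eq hm]
  constructor
  · intro h
    exact ⟨valid_wd t, length_wd t, by exact_mod_cast h⟩
  · intro h
    rw [h.2.2]

/-- A face of a tuple with its sign, as a chain. -/
noncomputable def face {X : Type} (q : QuasiMetric X) {n : ℕ} (t : Fin (n + 2) → X)
    (i : Fin (n + 2)) : MC X n :=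
  if q.delCond t i then ((-1 : ℤ) ^ (i : ℕ)) • Finsupp.single (t ∘ i.succAbove) (1 : ℤ) else 0

lemma bdry_single {X : Type} (q : QuasiMetric X) {n : ℕ} (t : Fin (n + 2) → X) :
    q.bdry n (Finsupp.single t 1) = ∑ i, face q t i := by
  simp [QuasiMetric.bdry, face]

lemma delCond_zero {X : Type} (q : QuasiMetric X) {n : ℕ} (t : Fin (n + 2) → X) :
    q.delCond t 0 ↔ q.Btw (t 1) (t 0) (t 1) := by
  simp [QuasiMetric.delCond]

lemma delCond_cons_one {X : Type} (q : QuasiMetric X) {n : ℕ} (x : X) (t : Fin (n + 2) → X) :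
    q.delCond (Fin.cons x t : Fin (n + 3) → X) (Fin.succ 0) ↔ q.Btw x (t 0) (t 1) := by
  simp [QuasiMetric.delCond]
  rfl

lemma delCond_cons {X : Type} (q : QuasiMetric X) {n : ℕ} (x : X) (t : Fin (n + 2) → X)
    (i : Fin (n + 1)) :
    q.delCond (Fin.cons x t : Fin (n + 3) → X) i.succ.succ ↔ q.delCond t i.succ := by
  simp [QuasiMetric.delCond]
  rfl

lemma cons_comp_succAbove {X : Type} {n : ℕ} (x : X) (t : Fin (n + 2) → X) (i : Fin (n + 2)) :
    (Fin.cons x t : Fin (n + 3) → X) ∘ i.succ.succAbove = Fin.cons x (t ∘ i.succAbove) := by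
  funext j
  cases j using Fin.cases <;> simp


/-- The words of the tuples starting at `x`. -/
noncomputable def words (x : Fin (2 * m)) (n : ℕ) : MC (Fin (2 * m)) n →ₗ[ℤ] WChain :=
  Finsupp.linearCombination ℤ fun t => if t 0 = x then Finsupp.single (wd t) 1 else 0

@[simp] lemma words_single (x : Fin (2 * m)) {n : ℕ} (t : Fin (n + 1) → Fin (2 * m)) :
    words x n (Finsupp.single t 1) = if t 0 = x then Finsupp.single (wd t) 1 else 0 := by
  simp [words]

lemma words_face_cons {q : QuasiMetric (Fin (2 * m))} {n : ℕ} (x : Fin (2 * m))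
    (t : Fin (n + 2) → Fin (2 * m)) (i : Fin (n + 1)) :
    words x (n + 1) (face q (Fin.cons x t : Fin (n + 3) → Fin (2 * m)) i.succ.succ) =
      -consL (st x (t 0)) (words (t 0) n (face q t i.succ)) := by
  have h0 : (t ∘ i.succ.succAbove) 0 = t 0 := by simp
  simp only [face, delCond_cons, cons_comp_succAbove]
  split_ifs
  · simp only [map_smul, words_single, Fin.cons_zero, if_true, wd_cons, h0, consL_single,
      Fin.val_succ, pow_succ]
    simp
  · simp

lemma words_face_cons_one (hm : 3 ≤ m) {n : ℕ} (x : Fin (2 * m))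
    (t : Fin (n + 2) → Fin (2 * m)) :
    words x (n + 1) (face (cycleQM (2 * m) (two_mul_pos hm))
      (Fin.cons x t : Fin (n + 3) → Fin (2 * m)) (Fin.succ 0)) =
      if st x (t 0) = 0 ∨ st (t 0) (t 1) = 0 ∨ Mrg m (st x (t 0)) (st (t 0) (t 1)) then
        -Finsupp.single (st x (t 1) :: wd (Fin.tail t)) 1 else 0 := by
  have h0 : t ∘ Fin.succAbove 0 = Fin.tail t := by funext j; simp [Fin.tail]
  simp only [face, delCond_cons_one, btw_iff hm, cons_comp_succAbove, h0]
  split_ifs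
  · rw [map_smul, words_single, Fin.cons_zero, if_pos rfl, wd_cons]
    simp [Fin.tail]
  · simp

lemma st_zero_left {x y z : Fin (2 * m)} (h : st x y = 0) : st x z = st y z := by
  rw [st_eq_zero.1 h]

lemma st_zero_right {x y z : Fin (2 * m)} (h : st y z = 0) : st x z = st x y := by
  rw [st_eq_zero.1 h]

lemma sum_words_face_succ (hm : 3 ≤ m) {n : ℕ} (t : Fin (n + 2) → Fin (2 * m)) :
    ∑ i : Fin (n + 1), words (t 0) n (face (cycleQM (2 * m) (two_mul_pos hm)) t i.succ) =
      gamW m (wd t) - if t 0 = t 1 then Finsupp.single (wd (Fin.tail t)) 1 else 0 := by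
  induction n with
  | zero =>
    have hd : (cycleQM (2 * m) (two_mul_pos hm)).delCond t 1 ↔ t 0 = t 1 := by
      rw [← btw_symm_iff hm]
      simp [QuasiMetric.delCond]
    have hs : wd t = [st (t 0) (t 1)] := by simp [wd]
    rw [hs, Fin.sum_univ_succ, Fin.sum_univ_zero, add_zero, Fin.succ_zero_eq_one, face, wd_zero]
    simp only [hd, gamW, nuW, map_zero, sub_zero, zero_sub]
    split_ifs
    · simp [wd_zero]
    · simp
  | succ n ih =>
    obtain ⟨x, t, rfl⟩ : ∃ x t', t = Fin.cons x t' :=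
      ⟨t 0, Fin.tail t, (Fin.cons_self_tail t).symm⟩
    have ht : wd t = st (t 0) (t 1) :: wd (Fin.tail t) := by
      conv_lhs => rw [← Fin.cons_self_tail t, wd_cons]
      rfl
    rw [Fin.sum_univ_succ]
    simp only [Fin.cons_zero, words_face_cons, Finset.sum_neg_distrib, ← map_sum, wd_cons, gamW,
      words_face_cons_one hm, Fin.tail_cons]
    rw [map_sum, ih t, ht, nuW]
    have e1 : (Fin.cons x t : Fin (n + 3) → Fin (2 * m)) 1 = t 0 := rfl
    simp only [e1, ← st_eq_zero]
    set a := st x (t 0)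
    set b := st (t 0) (t 1)
    by_cases hM : Mrg m a b
    · have ha : a ≠ 0 := by unfold Mrg at hM; omega
      have hb : b ≠ 0 := by unfold Mrg at hM; omega
      rw [if_pos (Or.inr (Or.inr hM)), if_pos hM, if_neg hb, if_neg ha,
        show st x (t 1) = mu m a b from st_eq_mu hM, sub_zero, sub_zero]
      exact (sub_eq_add_neg _ _).symm
    · rw [if_neg hM]
      by_cases ha : a = 0 <;> by_cases hb : b = 0
      · simp [ha, hb, st_zero_left ha, b]
        abel
      · simp [ha, hb, st_zero_left ha, b]
        abel
      · simp [ha, hb, st_zero_right hb, a]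
        abel
      · simp [ha, hb, hM]

lemma words_bdry_single (hm : 3 ≤ m) {n : ℕ} (t : Fin (n + 2) → Fin (2 * m)) :
    words (t 0) n ((cycleQM (2 * m) (two_mul_pos hm)).bdry n (Finsupp.single t 1)) =
      gamW m (wd t) := by
  have h0 : t ∘ Fin.succAbove 0 = Fin.tail t := by funext j; simp [Fin.tail]
  rw [bdry_single, map_sum, Fin.sum_univ_succ, sum_words_face_succ hm, face, delCond_zero,
    btw_symm_iff hm, h0]
  by_cases h : t 0 = t 1
  · simp [h, Fin.tail]
  · simp [h, Ne.symm h]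

lemma words_bdry_single_of_ne (hm : 3 ≤ m) {n : ℕ} (t : Fin (n + 2) → Fin (2 * m))
    {x : Fin (2 * m)} (h : t 0 ≠ x) :
    words x n ((cycleQM (2 * m) (two_mul_pos hm)).bdry n (Finsupp.single t 1)) = 0 := by
  rw [bdry_single, map_sum]
  refine Finset.sum_eq_zero fun i _ => ?_
  rw [face]
  split_ifs with hd
  · rw [map_smul, words_single, if_neg, smul_zero]
    cases i using Fin.cases with
    | zero =>
      rw [delCond_zero, btw_symm_iff hm] at hd
      simpa [← hd] using h
    | succ i => simpa using h
  · exact map_zero _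

lemma words_bdry (hm : 3 ≤ m) (x : Fin (2 * m)) {n : ℕ} (c : MC (Fin (2 * m)) (n + 1)) :
    words x n ((cycleQM (2 * m) (two_mul_pos hm)).bdry n c) = gam m (words x (n + 1) c) := by
  have : words x n ∘ₗ (cycleQM (2 * m) (two_mul_pos hm)).bdry n = gam m ∘ₗ words x (n + 1) := by
    refine Finsupp.lhom_ext' fun t => LinearMap.ext_ring ?_
    simp only [LinearMap.comp_apply, Finsupp.lsingle_apply, words_single]
    split_ifs with h
    · subst h
      rw [words_bdry_single hm, gam_single]
    · rw [words_bdry_single_of_ne hm t h, map_zero]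
  exact LinearMap.congr_fun this c

lemma words_apply {n : ℕ} (t : Fin (n + 1) → Fin (2 * m)) (c : MC (Fin (2 * m)) n) :
    words (t 0) n c (wd t) = c t := by
  have : Finsupp.lapply (wd t) ∘ₗ words (t 0) n = Finsupp.lapply t := by
    refine Finsupp.lhom_ext' fun t' => LinearMap.ext_ring ?_
    simp only [LinearMap.comp_apply, Finsupp.lsingle_apply, words_single, Finsupp.lapply_apply]
    by_cases h : t' = t
    · simp [h]
    · rw [Finsupp.single_eq_of_ne' h]
      split_ifs with h0
      · rw [Finsupp.single_eq_of_ne' fun h1 => h (wd_inj h0 h1)]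
      · rfl
  exact LinearMap.congr_fun this c

lemma words_ext {n : ℕ} {c c' : MC (Fin (2 * m)) n} (h : ∀ x, words x n c = words x n c') :
    c = c' := by
  ext t
  rw [← words_apply t c, h, words_apply]

lemma words_mem (hm : 3 ≤ m) {n l : ℕ} {c : MC (Fin (2 * m)) n}
    (hc : c ∈ (cycleQM (2 * m) (two_mul_pos hm)).grMC n l) (x : Fin (2 * m)) :
    words x n c ∈ supp (Ln m n l) := by
  refine (Submodule.span_le (p := (supp (Ln m n l)).comap (words x n))).2 ?_ hc
  rintro _ ⟨t, ht, rfl⟩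
  rw [len_eq_iff hm] at ht
  simp only [Submodule.comap_coe, Set.mem_preimage, words_single, SetLike.mem_coe]
  split_ifs
  · exact single_mem_supp ht 1
  · exact Submodule.zero_mem _

lemma exists_words_eq (hm : 3 ≤ m) {n l : ℕ} (f : Fin (2 * m) → WChain)
    (hf : ∀ x, f x ∈ supp (Ln m n l)) :
    ∃ c ∈ (cycleQM (2 * m) (two_mul_pos hm)).grMC n l, ∀ x, words x n c = f x := by
  have key : ∀ x, ∀ y ∈ supp (Ln m n l), ∃ c ∈ (cycleQM (2 * m) (two_mul_pos hm)).grMC n l,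
      ∀ x', words x' n c = if x = x' then y else 0 := by
    intro x y hy
    rw [supp_eq_span] at hy
    induction hy using Submodule.span_induction with
    | mem y hy =>
      obtain ⟨w, hw, rfl⟩ := hy
      obtain ⟨t, rfl, rfl⟩ := exists_wd x hw.2.1 hw.1
      exact ⟨_, Submodule.subset_span ⟨t, (len_eq_iff hm t l).2 hw, rfl⟩, fun x' => by simp⟩
    | zero => exact ⟨0, Submodule.zero_mem _, by simp⟩
    | add y y' _ _ h h' =>
      obtain ⟨c, hc, e⟩ := h
      obtain ⟨c', hc', e'⟩ := h'
      exact ⟨c + c', Submodule.add_mem _ hc hc', fun x' => by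
        rw [map_add, e, e']; split_ifs <;> simp⟩
    | smul r y _ h =>
      obtain ⟨c, hc, e⟩ := h
      exact ⟨r • c, Submodule.smul_mem _ _ hc, fun x' => by
        rw [map_smul, e]; split_ifs <;> simp⟩
  choose g hg hw using fun x => key x (f x) (hf x)
  exact ⟨∑ x, g x, Submodule.sum_mem _ fun x _ => hg x, fun x => by simp [hw]⟩

lemma mem_grZ_iff (hm : 3 ≤ m) {n l : ℕ} {c : MC (Fin (2 * m)) n} :
    c ∈ (cycleQM (2 * m) (two_mul_pos hm)).grZ n l ↔
      c ∈ (cycleQM (2 * m) (two_mul_pos hm)).grMC n l ∧ ∀ x, gam m (words x n c) = 0 := by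
  cases n with
  | zero =>
    refine ⟨fun h => ⟨h, fun x => ?_⟩, fun h => h.1⟩
    refine eq_on_supp (gam m) 0 (fun w hw => ?_) (words_mem hm h x)
    have : w = [] := List.length_eq_zero_iff.1 hw.2.1
    simp [this, gamW]
  | succ n =>
    simp only [QuasiMetric.grZ, Submodule.mem_inf, LinearMap.mem_ker, ← words_bdry hm]
    refine and_congr_right fun _ => ⟨fun h x => by rw [h, map_zero], fun h => words_ext ?_⟩
    simpa using h

lemma mem_grB_iff (hm : 3 ≤ m) {n l : ℕ} {c : MC (Fin (2 * m)) n} :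
    c ∈ (cycleQM (2 * m) (two_mul_pos hm)).grB n l ↔
      ∀ x, ∃ y ∈ supp (Ln m (n + 1) l), gam m y = words x n c := by
  constructor
  · rintro ⟨c, hc, rfl⟩ x
    exact ⟨_, words_mem hm hc x, (words_bdry hm x c).symm⟩
  · intro h
    choose f hf e using h
    obtain ⟨c', hc', e'⟩ := exists_words_eq hm f hf
    exact ⟨c', hc', words_ext fun x => by rw [words_bdry hm, e', e]⟩

/-- The critical words with `n` steps, of length `l`. -/
def critWords (m : ℤ) (n l : ℕ) : Set (List ℤ) := {w | cls m .s w = .k ∧ Ln m n l w}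

/-- The coordinates of a cycle, one family for each starting vertex. -/
noncomputable def coord (hm : 3 ≤ m) (n l : ℕ) :
    ↥((cycleQM (2 * m) (two_mul_pos hm)).grZ n l) →ₗ[ℤ]
      (Fin (2 * m) → supp fun w => w ∈ critWords m n l) :=
  LinearMap.pi fun x =>
    (R (Int.ofNat_le.2 hm) ∘ₗ words x n ∘ₗ Submodule.subtype _).codRestrict _ fun z =>
      R_mem _ (words_mem hm ((mem_grZ_iff hm).1 z.2).1 x)

lemma coord_apply (hm : 3 ≤ m) {n l : ℕ} (z : ↥((cycleQM (2 * m) (two_mul_pos hm)).grZ n l))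
    (x : Fin (2 * m)) : (coord hm n l z x : WChain) = R (Int.ofNat_le.2 hm) (words x n z) := rfl

lemma coord_surjective (hm : 3 ≤ m) (n l : ℕ) : Function.Surjective (coord hm n l) := by
  intro f
  choose z hz hg hR using fun x => exists_cycle (Int.ofNat_le.2 hm) (f x).2
  obtain ⟨c, hc, e⟩ := exists_words_eq hm z hz
  refine ⟨⟨c, (mem_grZ_iff hm).2 ⟨hc, fun x => by rw [e]; exact hg x⟩⟩, ?_⟩
  funext x
  refine Subtype.ext ?_
  rw [coord_apply, e]
  exact hR x

lemma ker_coord (hm : 3 ≤ m) (n l : ℕ) : LinearMap.ker (coord hm n l) =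
    Submodule.comap ((cycleQM (2 * m) (two_mul_pos hm)).grZ n l).subtype
      ((cycleQM (2 * m) (two_mul_pos hm)).grB n l) := by
  ext z
  rw [LinearMap.mem_ker, Submodule.mem_comap, mem_grB_iff hm]
  obtain ⟨hz, hg⟩ := (mem_grZ_iff hm).1 z.2
  constructor
  · intro h x
    refine exists_gam_eq (Int.ofNat_le.2 hm) (words_mem hm hz x) (hg x) ?_
    exact (coord_apply hm z x).symm.trans (congrArg Subtype.val (congrFun h x))
  · intro h
    funext x
    refine Subtype.ext ?_
    obtain ⟨y, hy, e⟩ := h x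
    exact (congrArg _ e.symm).trans (R_gam _ hy)

/-- Homology classes are determined by their coordinates on critical words. -/
noncomputable def homologyEquiv (hm : 3 ≤ m) (n l : ℕ) :
    (cycleQM (2 * m) (two_mul_pos hm)).grMH n l ≃ₗ[ℤ] (Fin (2 * m) → critWords m n l →₀ ℤ) :=
  (Submodule.quotEquivOfEq _ _ (ker_coord hm n l).symm).trans <|
    ((coord hm n l).quotKerEquivOfSurjective (coord_surjective hm n l)).trans <|
      LinearEquiv.piCongrRight fun _ => Finsupp.supportedEquivFinsupp _

lemma rep_injective (m : ℤ) (i : ℕ) : Function.Injective (rep m i) := by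
  induction i with
  | zero => exact fun _ _ h => h
  | succ i ih => exact fun _ _ h => ih (by simpa [rep] using h)

lemma mem_critWords_iff (hm : 3 ≤ m) {n l : ℕ} {w : List ℤ} : w ∈ critWords m n l ↔
    ∃ i j : ℕ, (w = rep m i (alt j 1) ∨ w = rep m i (alt j (-1))) ∧ n = 2 * i + j ∧
      l = m * i + j := by
  have hm' : 3 ≤ (m : ℤ) := Int.ofNat_le.2 hm
  constructor
  · rintro ⟨hk, hv, rfl, rfl⟩
    obtain ⟨i, j, a, ha, hw, h1, h2, -⟩ := crit_numbers hm' hv hk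
    refine ⟨i, j, ?_, h1, by exact_mod_cast h2⟩
    rcases ha with rfl | rfl
    · exact Or.inl hw
    · exact Or.inr hw
  · rintro ⟨i, j, hw, rfl, rfl⟩
    obtain ⟨a, ha, rfl⟩ : ∃ a : ℤ, (a = 1 ∨ a = -1) ∧ w = rep m i (alt j a) := by
      rcases hw with hw | hw
      · exact ⟨1, Or.inl rfl, hw⟩
      · exact ⟨-1, Or.inr rfl, hw⟩
    obtain ⟨a1, a2, -, a4⟩ := alt_spec hm' j ha
    obtain ⟨r1, r2, -, r4, r5⟩ := rep_spec hm' i (alt j a)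
    refine ⟨r5.trans (cls_s_alt hm' j ha), r4 a4, by rw [r1, a1], ?_⟩
    rw [a2] at r2
    exact_mod_cast r2

lemma critWords_eq (hm : 3 ≤ m) (i j : ℕ) : critWords m (2 * i + j) (m * i + j) =
    {rep m i (alt j 1), rep m i (alt j (-1))} := by
  ext w
  rw [mem_critWords_iff hm, Set.mem_insert_iff, Set.mem_singleton_iff]
  refine ⟨?_, fun h => ⟨i, j, h, rfl, rfl⟩⟩
  rintro ⟨i', j', h, h1, h2⟩
  have h3 : ((m : ℤ) - 2) * (i - i') = 0 := by
    zify at h1 h2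
    linear_combination h2 - h1
  have h4 : i = i' := by
    rcases mul_eq_zero.1 h3 with h | h <;> omega
  subst h4
  obtain rfl : j = j' := by omega
  exact h

lemma ncard_critWords_zero (hm : 3 ≤ m) (i : ℕ) : (critWords m (2 * i) (m * i)).ncard = 1 := by
  have := critWords_eq hm i 0
  rw [add_zero, add_zero] at this
  rw [this, alt, alt, Set.pair_eq_singleton, Set.ncard_singleton]

lemma ncard_critWords_pos (hm : 3 ≤ m) (i : ℕ) {j : ℕ} (hj : 0 < j) :
    (critWords m (2 * i + j) (m * i + j)).ncard = 2 := by
  rw [critWords_eq hm, Set.ncard_pair]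
  intro h
  obtain ⟨j, rfl⟩ := Nat.exists_eq_succ_of_ne_zero hj.ne'
  simpa [alt] using rep_injective _ _ h

lemma nontrivial_homology_iff (hm : 3 ≤ m) (n l : ℕ) :
    Nontrivial ((cycleQM (2 * m) (two_mul_pos hm)).grMH n l) ↔ (critWords m n l).Nonempty := by
  rw [(homologyEquiv hm n l).toEquiv.nontrivial_congr]
  have : Nonempty (Fin (2 * m)) := ⟨⟨0, by omega⟩⟩
  constructor
  · intro h
    by_contra he
    have : IsEmpty (critWords m n l) := Set.isEmpty_coe_sort.2 (Set.not_nonempty_iff_eq_empty.1 he)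
    exact not_subsingleton (Fin (2 * m) → critWords m n l →₀ ℤ) inferInstance
  · intro h
    have := h.to_subtype
    infer_instance

lemma free_homology (hm : 3 ≤ m) (n l : ℕ) :
    Module.Free ℤ ((cycleQM (2 * m) (two_mul_pos hm)).grMH n l) :=
  Module.Free.of_equiv (homologyEquiv hm n l).symm

lemma finrank_homology (hm : 3 ≤ m) {n l : ℕ} (hf : (critWords m n l).Finite) :
    Module.finrank ℤ ((cycleQM (2 * m) (two_mul_pos hm)).grMH n l) =
      2 * m * (critWords m n l).ncard := by
  have := hf.fintype
  rw [(homologyEquiv hm n l).finrank_eq, Module.finrank_pi_fintype]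
  rw [Finset.sum_congr rfl fun _ _ => Module.finrank_finsupp_self ℤ, Finset.sum_const,
    Finset.card_univ, Fintype.card_fin, ← Nat.card_eq_fintype_card, Nat.card_coe_set_eq,
    smul_eq_mul]

end Cycle

end EvenCycle

/-- **Statement 16.** Let `m ≥ 3` and `N = 2m`, and let `C_N` be the cycle graph on `N`
vertices with the shortest path metric. Then (1) `MH_n^ℓ(C_N) ≠ 0` iff
`(n,ℓ) = (2i+j, mi+j)` for some `i, j ≥ 0`; (2) `MH_{2i}^{mi}(C_N)` is free of rank `N`;
(3) for `j > 0`, `MH_{2i+j}^{mi+j}(C_N)` is free of rank `2N`. -/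
theorem magnitude_homology_even_cycle (m : ℕ) (hm : 3 ≤ m) :
    (∀ n ℓ : ℕ,
      Nontrivial ((cycleQM (2 * m) (by omega)).grMH n (ℓ : ℝ≥0∞)) ↔
        ∃ i j : ℕ, n = 2 * i + j ∧ ℓ = m * i + j) ∧
    (∀ i : ℕ,
      Module.Free ℤ ((cycleQM (2 * m) (by omega)).grMH (2 * i) ((m * i : ℕ) : ℝ≥0∞)) ∧
      Module.finrank ℤ
          ((cycleQM (2 * m) (by omega)).grMH (2 * i) ((m * i : ℕ) : ℝ≥0∞)) = 2 * m) ∧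
    (∀ i j : ℕ, 0 < j →
      Module.Free ℤ
        ((cycleQM (2 * m) (by omega)).grMH (2 * i + j) ((m * i + j : ℕ) : ℝ≥0∞)) ∧
      Module.finrank ℤ
          ((cycleQM (2 * m) (by omega)).grMH (2 * i + j) ((m * i + j : ℕ) : ℝ≥0∞)) =
        2 * (2 * m)) := by
  open EvenCycle in
  refine ⟨fun n ℓ => ?_, fun i => ⟨free_homology hm _ _, ?_⟩,
    fun i j hj => ⟨free_homology hm _ _, ?_⟩⟩
  · rw [nontrivial_homology_iff hm]
    constructor
    · rintro ⟨w, hw⟩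
      obtain ⟨i, j, -, h⟩ := (mem_critWords_iff hm).1 hw
      exact ⟨i, j, h⟩
    · rintro ⟨i, j, h⟩
      exact ⟨_, (mem_critWords_iff hm).2 ⟨i, j, Or.inl rfl, h⟩⟩
  · have h := ncard_critWords_zero hm i
    rw [finrank_homology hm (Set.finite_of_ncard_ne_zero (by omega)), h, mul_one]
  · have h := ncard_critWords_pos hm i hj
    rw [finrank_homology hm (Set.finite_of_ncard_ne_zero (by omega)), h, mul_comm]
end
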